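/- arXiv:2410.03614 — 2 statements merged into one kernel-verified Lean document; each statement's English description precedes it below -/
import Mathlib

section
/- For generic L ∈ ℂ^{(d+1)×(n+1)} and generic u ∈ ℂ^{n+1}, the number of solutions of the scattering equations ∂ℒ_u/∂x_1 = ⋯ = ∂ℒ_u/∂x_d = 0 in X equals the degree of the reciprocal linear space ℛ_L, which equals the binomial coefficient C(n,d). (Equivalently, the Proudfoot–Speyer homotopy is optimal: the number of solution paths tracked equals the number of solutions.) -/
open scoped BigOperators
noncomputable section

namespace ScatteringPaper

open CategoryTheory AlgebraicTopology

/- ## Topological Euler characteristic via rational singular homology -/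

/-- The singular chain complex of a topological space, with rational coefficients. -/
def singularChainComplex (X : Type) [TopologicalSpace X] : ChainComplex (ModuleCat ℚ) ℕ :=
  (alternatingFaceMapComplex (ModuleCat ℚ)).obj
    (((SimplicialObject.whiskering _ _).obj (ModuleCat.free ℚ)).obj (TopCat.toSSet.obj (TopCat.of X)))

/-- The `q`-th (rational) Betti number of a topological space. -/
def betti (X : Type) [TopologicalSpace X] (q : ℕ) : ℕ :=
  Module.finrank ℚ ((singularChainComplex X).homology q)

/-- The topological Euler characteristic, as the alternating sum of Betti numbers. -/
def eulerChar (X : Type) [TopologicalSpace X] : ℤ :=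
  ∑ᶠ q : ℕ, (-1 : ℤ) ^ q * (betti X q : ℤ)

variable {d : ℕ} {ι : Type} [Fintype ι] [DecidableEq ι]

/- ## Hyperplane arrangements: `(ℓ_i(x))_i = (1, x_1, …, x_d) · L` -/

/-- Value of the affine-linear form encoded by column `i` of `L`. -/
def ell (K : Type) [Field K] (L : Matrix (Fin (d+1)) ι K) (x : Fin d → K) (i : ι) : K :=
  L 0 i + ∑ j : Fin d, x j * L j.succ i

/-- The complement `X = ℂ^d ∖ 𝒜` of the arrangement `𝒜 = V(∏ ℓ_i)`. -/
def complementX (L : Matrix (Fin (d+1)) ι ℂ) : Set (Fin d → ℂ) := {x | ∀ i, ell ℂ L x i ≠ 0}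

/-- `x ∈ X` is a solution of the scattering equations
`∂ℒ_u/∂x_k = ∑_i u_i a_{ki}/ℓ_i(x) = 0`, `k = 1, …, d`. -/
def IsSol (L : Matrix (Fin (d+1)) ι ℂ) (u : ι → ℂ) (x : Fin d → ℂ) : Prop :=
  x ∈ complementX L ∧ ∀ k : Fin d, ∑ i : ι, u i * L k.succ i / ell ℂ L x i = 0

/-- An arrangement is essential if some subset of its hyperplanes meets in a single point. -/
def IsEssential (L : Matrix (Fin (d+1)) ι ℂ) : Prop :=
  ∃ (S : Set ι) (x₀ : Fin d → ℂ), {x : Fin d → ℂ | ∀ i ∈ S, ell ℂ L x i = 0} = {x₀}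

/-- `P u` holds for all `u` outside a proper algebraic subset (i.e. for generic `u`). -/
def Generically {σ : Type} [Fintype σ] [DecidableEq σ] (P : (σ → ℂ) → Prop) : Prop :=
  ∃ g : MvPolynomial σ ℂ, g ≠ 0 ∧ ∀ u : σ → ℂ, MvPolynomial.eval u g ≠ 0 → P u

/- ## Matroid data of the columns of `L` -/

/-- Rank of the set `I` of columns of `L` (the matroid rank in `M(L)`). -/
def rkL (K : Type) [Field K] (L : Matrix (Fin (d+1)) ι K) (I : Set ι) : ℕ :=
  Module.finrank K (Submodule.span K ((fun i => fun r => L r i) '' I))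

/-- Rank of the set `I` of columns of `A^⊤` (`L` with its first row deleted). -/
def rkA (K : Type) [Field K] (L : Matrix (Fin (d+1)) ι K) (I : Set ι) : ℕ :=
  Module.finrank K (Submodule.span K ((fun i => fun k : Fin d => L k.succ i) '' I))

/-- `I` is a flat of the matroid `M(L)`. -/
def IsFlat (K : Type) [Field K] (L : Matrix (Fin (d+1)) ι K) (I : Set ι) : Prop :=
  ∀ i ∉ I, rkL K L I < rkL K L (insert i I)

/-- `C` is a circuit of `M(L)`: a minimal linearly dependent set of columns. -/
def IsCircuit (K : Type) [Field K] (L : Matrix (Fin (d+1)) ι K) (C : Finset ι) : Prop :=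
  (¬ LinearIndependent K (fun i : {a // a ∈ C} => fun r => L r i.1)) ∧
  ∀ D : Finset ι, D ⊂ C → LinearIndependent K (fun i : {a // a ∈ D} => fun r => L r i.1)

/-- `M(L)` is connected: there is no separation into two nonempty parts with additive rank. -/
def MatroidConnected (K : Type) [Field K] (L : Matrix (Fin (d+1)) ι K) : Prop :=
  ∀ S : Set ι, S.Nonempty → Sᶜ.Nonempty → rkL K L S + rkL K L Sᶜ ≠ rkL K L Set.univ

/- ## The reciprocal linear space -/

/-- Zariski closure of a subset of affine space `K^ι`. -/
def zarClosure (K : Type) [Field K] (S : Set (ι → K)) : Set (ι → K) :=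
  {v | ∀ f : MvPolynomial ι K, (∀ w ∈ S, MvPolynomial.eval w f = 0) → MvPolynomial.eval v f = 0}

/-- The affine cone over the image of `φ : x ↦ (ℓ_0(x)⁻¹ : ⋯ : ℓ_n(x)⁻¹)`. -/
def coneImage (L : Matrix (Fin (d+1)) ι ℂ) : Set (ι → ℂ) :=
  {v | ∃ (c : ℂ) (x : Fin d → ℂ), x ∈ complementX L ∧ v = fun i => c / ell ℂ L x i}

/-- The vanishing ideal of a subset of affine space. -/
def vanishingIdeal (K : Type) [Field K] (S : Set (ι → K)) : Ideal (MvPolynomial ι K) where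
  carrier := {f | ∀ v ∈ S, MvPolynomial.eval v f = 0}
  add_mem' := by
    intro a b ha hb v hv
    simp [map_add, ha v hv, hb v hv]
  zero_mem' := by intro v hv; simp
  smul_mem' := by
    intro c f hf v hv
    simp [smul_eq_mul, map_mul, hf v hv]

/-- Projective space `ℙ^n = ℙ(ℂ^ι)`. -/
abbrev Pn (ι : Type) [Fintype ι] := Projectivization ℂ (ι → ℂ)

/-- The reciprocal linear space `ℛ_L ⊂ ℙ^n`, the Zariski closure of `im φ`. -/
def RL (L : Matrix (Fin (d+1)) ι ℂ) : Set (Pn ι) :=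
  {p | p.rep ∈ zarClosure ℂ (coneImage L)}

/-- The linear space `𝕃_u = {y : A^⊤ diag(u) y = 0} ⊂ ℙ^n`. -/
def LuSet (L : Matrix (Fin (d+1)) ι ℂ) (u : ι → ℂ) : Set (Pn ι) :=
  {p | ∀ k : Fin d, ∑ i : ι, L k.succ i * u i * p.rep i = 0}

/-- The torus orbit `U_I = {y ∈ ℙ^n : y_i ≠ 0 ⇔ i ∈ I}`. -/
def Ustratum (I : Set ι) : Set (Pn ι) := {p : Pn ι | ∀ i : ι, p.rep i ≠ 0 ↔ i ∈ I}

/-- `p = φ(x)` for the map `φ : x ↦ (ℓ_0(x)⁻¹ : ⋯ : ℓ_n(x)⁻¹)`. -/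
def PhiRel (L : Matrix (Fin (d+1)) ι ℂ) (x : Fin d → ℂ) (p : Pn ι) : Prop :=
  ∃ hv : (fun i => (ell ℂ L x i)⁻¹) ≠ 0, p = Projectivization.mk ℂ (fun i => (ell ℂ L x i)⁻¹) hv

/-- The image of `φ` in `ℙ^n`. -/
def imPhi (L : Matrix (Fin (d+1)) ι ℂ) : Set (Pn ι) :=
  {p | ∃ x ∈ complementX L, PhiRel L x p}

/-- Complement of the subarrangement `𝒜_I`. -/
def subComplement (L : Matrix (Fin (d+1)) ι ℂ) (I : Set ι) : Set (Fin d → ℂ) :=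
  {x | ∀ i ∈ I, ell ℂ L x i ≠ 0}

/-- The affine cone over the image of the reciprocal map of the subarrangement indexed by `I`,
embedded in the coordinate subspace `{y_i = 0, i ∉ I}`. -/
def coneImageSub (L : Matrix (Fin (d+1)) ι ℂ) (I : Set ι) : Set (ι → ℂ) :=
  {v | ∃ (c : ℂ) (x : Fin d → ℂ), x ∈ subComplement L I ∧
      v = I.indicator (fun i => c / ell ℂ L x i)}

/-- The reciprocal linear space `ℛ_{L_I}` of the submatrix `L_I`, embedded in `ℙ^n`. -/
def RLsub (L : Matrix (Fin (d+1)) ι ℂ) (I : Set ι) : Set (Pn ι) :=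
  {p | p.rep ∈ zarClosure ℂ (coneImageSub L I)}

/-- The open stratum `ℛ_{L_I}^∘ = ℛ_{L_I} ∩ U_I`. -/
def RLsubOpen (L : Matrix (Fin (d+1)) ι ℂ) (I : Set ι) : Set (Pn ι) :=
  RLsub L I ∩ Ustratum I

/- ## The very affine variety `X_I = (ℂ^d ∖ 𝒜_I)/K_I` -/

/-- Quotient of `ℂ^d ∖ 𝒜_I` by translation by the left kernel `K_I` of `A_I^⊤`:
two points are identified iff `A_I^⊤` takes the same values on them. -/
def XIsetoid (L : Matrix (Fin (d+1)) ι ℂ) (I : Set ι) : Setoid ↥(subComplement L I) where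
  r x y := ∀ i ∈ I, ∑ k : Fin d, (x : Fin d → ℂ) k * L k.succ i
      = ∑ k : Fin d, (y : Fin d → ℂ) k * L k.succ i
  iseqv := ⟨fun _ _ _ => rfl, fun h i hi => (h i hi).symm, fun h1 h2 i hi => (h1 i hi).trans (h2 i hi)⟩

/-- The very affine variety `X_I = (ℂ^d ∖ 𝒜_I)/K_I`. -/
def XI (L : Matrix (Fin (d+1)) ι ℂ) (I : Set ι) : Type := Quotient (XIsetoid L I)

instance (L : Matrix (Fin (d+1)) ι ℂ) (I : Set ι) : TopologicalSpace (XI L I) :=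
  instTopologicalSpaceQuotient

/-- The complement of the arrangement, over a general field `K`. -/
def complementK (K : Type) [Field K] (L : Matrix (Fin (d+1)) ι K) : Set (Fin d → K) :=
  {x | ∀ i, ell K L x i ≠ 0}

/-- The affine cone over the image of the reciprocal map, over a general field `K`. -/
def coneImageK (K : Type) [Field K] (L : Matrix (Fin (d+1)) ι K) : Set (ι → K) :=
  {v | ∃ (c : K) (x : Fin d → K), x ∈ complementK K L ∧ v = fun i => c / ell K L x i}

/- ## Hilbert functions, degree, Hilbert regularity -/

/-- The Hilbert function of the graded algebra `K[y]/I`: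
`q ↦ dim_K (K[y]/I)_q`. -/
def hilb (K : Type) [Field K] (I : Ideal (MvPolynomial ι K)) (q : ℕ) : ℕ :=
  Module.finrank K ((MvPolynomial.homogeneousSubmodule ι K q).map
    (Ideal.Quotient.mkₐ K I).toLinearMap)

/-- `k` is the degree of the `d`-dimensional projective variety with homogeneous
coordinate ring `K[y]/I`: the Hilbert polynomial has degree `d` and leading
coefficient `k/d!`. -/
def IsProjDegree (K : Type) [Field K] (I : Ideal (MvPolynomial ι K)) (d k : ℕ) : Prop :=
  ∃ P : Polynomial ℚ, (∃ N : ℕ, ∀ q : ℕ, N ≤ q → Polynomial.eval (q : ℚ) P = hilb K I q) ∧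
    P.degree = (d : WithBot ℕ) ∧ P.leadingCoeff = (k : ℚ) / (Nat.factorial d : ℚ)

/-- The Hilbert function, extended by `0` to negative integers. -/
def HFZ (K : Type) [Field K] (I : Ideal (MvPolynomial ι K)) (q : ℤ) : ℕ :=
  if 0 ≤ q then hilb K I q.toNat else 0

/-- The Hilbert regularity: the smallest degree from which the Hilbert function
agrees with a (necessarily unique) polynomial. -/
def HReg (K : Type) [Field K] (I : Ideal (MvPolynomial ι K)) : ℤ :=
  sInf {i : ℤ | ∃ P : Polynomial ℚ, ∀ q : ℤ, i ≤ q → Polynomial.eval (q : ℚ) P = HFZ K I q}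


/- ### Part 1: genericity of `L` -/

/-- All maximal minors of `L`, and of `L` without its first row, are nonzero. -/
structure GoodL {d n : ℕ} (L : Matrix (Fin (d+1)) (Fin (n+1)) ℂ) : Prop where
  top : ∀ f : Fin (d+1) → Fin (n+1), Function.Injective f → (L.submatrix id f).det ≠ 0
  low : ∀ f : Fin d → Fin (n+1), Function.Injective f → (L.submatrix Fin.succ f).det ≠ 0

theorem exists_good_poly (d n : ℕ) :
    ∃ G : MvPolynomial (Fin (d+1) × Fin (n+1)) ℂ, G ≠ 0 ∧
      ∀ L : Matrix (Fin (d+1)) (Fin (n+1)) ℂ,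
        MvPolynomial.eval (fun p : Fin (d+1) × Fin (n+1) => L p.1 p.2) G ≠ 0 → GoodL L := by
  classical
  let M : Matrix (Fin (d+1)) (Fin (n+1)) (MvPolynomial (Fin (d+1) × Fin (n+1)) ℂ) :=
    Matrix.of fun i j => MvPolynomial.X (i, j)
  have hM : ∀ L : Matrix (Fin (d+1)) (Fin (n+1)) ℂ,
      M.map (MvPolynomial.eval (fun p : Fin (d+1) × Fin (n+1) => L p.1 p.2)) = L := by
    intro L; ext i j; simp [M]
  have hev : ∀ {k : ℕ} (L : Matrix (Fin (d+1)) (Fin (n+1)) ℂ) (r : Fin k → Fin (d+1))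
      (f : Fin k → Fin (n+1)),
      MvPolynomial.eval (fun p : Fin (d+1) × Fin (n+1) => L p.1 p.2) (M.submatrix r f).det
        = (L.submatrix r f).det := by
    intro k L r f
    rw [RingHom.map_det, RingHom.mapMatrix_apply, ← Matrix.submatrix_map, hM]
  have hne : ∀ {k : ℕ} (r : Fin k → Fin (d+1)) (f : Fin k → Fin (n+1)),
      Function.Injective r → Function.Injective f → (M.submatrix r f).det ≠ 0 := by
    intro k r f hr hf h0
    let L : Matrix (Fin (d+1)) (Fin (n+1)) ℂ :=
      Matrix.of fun i j => if ∃ a, r a = i ∧ f a = j then 1 else 0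
    have h1 : L.submatrix r f = 1 := by
      ext i j
      simp only [L, Matrix.submatrix_apply, Matrix.of_apply, Matrix.one_apply]
      congr 1
      apply propext
      constructor
      · rintro ⟨a, ha, hb⟩
        rw [← hr ha, hf hb]
      · rintro rfl
        exact ⟨i, rfl, rfl⟩
    have h2 := hev L r f
    rw [h0, h1] at h2
    simp at h2
  refine ⟨(∏ f : Fin (d+1) → Fin (n+1), if Function.Injective f then (M.submatrix id f).det else 1) *
    (∏ f : Fin d → Fin (n+1), if Function.Injective f then (M.submatrix Fin.succ f).det else 1),
    ?_, ?_⟩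
  · apply mul_ne_zero
    · rw [Finset.prod_ne_zero_iff]
      intro f _
      split_ifs with hf
      · exact hne _ _ Function.injective_id hf
      · exact one_ne_zero
    · rw [Finset.prod_ne_zero_iff]
      intro f _
      split_ifs with hf
      · exact hne _ _ (Fin.succ_injective _) hf
      · exact one_ne_zero
  · intro L hL
    rw [map_mul, map_prod, map_prod] at hL
    constructor
    · intro f hf
      have := (Finset.prod_ne_zero_iff.mp (left_ne_zero_of_mul hL)) f (Finset.mem_univ _)
      rwa [if_pos hf, hev] at this
    · intro f hf
      have := (Finset.prod_ne_zero_iff.mp (right_ne_zero_of_mul hL)) f (Finset.mem_univ _)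
      rwa [if_pos hf, hev] at this

section good
variable {d n : ℕ} {L : Matrix (Fin (d+1)) (Fin (n+1)) ℂ}

/-- A vector supported on a finset, summed over an enumeration. -/
theorem sum_orderEmb {k N : ℕ} (T : Finset (Fin N)) (hT : T.card = k) (g : Fin N → ℂ)
    (hg : ∀ i ∉ T, g i = 0) : ∑ i, g i = ∑ a, g (T.orderEmbOfFin hT a) := by
  classical
  rw [← Finset.sum_subset (Finset.subset_univ T) (fun i _ hi => hg i hi)]
  conv_lhs => rw [← Finset.map_orderEmbOfFin_univ T hT]
  rw [Finset.sum_map]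
  rfl

theorem GoodL.ker_small (hL : GoodL L) (hdn : d ≤ n) (y : Fin (n+1) → ℂ) (hy : L.mulVec y = 0)
    (T : Finset (Fin (n+1))) (hT : T.card ≤ d+1) (hyT : ∀ i ∉ T, y i = 0) : y = 0 := by
  obtain ⟨T', hTT', hT'⟩ := Finset.exists_superset_card_eq hT (by simpa using hdn)
  have hy' : ∀ i ∉ T', y i = 0 := fun i hi => hyT i (fun h => hi (hTT' h))
  have h1 : (L.submatrix id (T'.orderEmbOfFin hT')).mulVec (y ∘ T'.orderEmbOfFin hT') = 0 := by
    ext k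
    have := congrFun hy k
    rw [Matrix.mulVec, dotProduct, sum_orderEmb T' hT' _ (fun i hi => by simp [hy' i hi])] at this
    simpa [Matrix.mulVec, dotProduct] using this
  have h2 := Matrix.eq_zero_of_mulVec_eq_zero (hL.top _ (T'.orderEmbOfFin hT').injective) h1
  ext i
  by_cases hi : i ∈ T'
  · have : i ∈ Set.range (T'.orderEmbOfFin hT') := by simpa using hi
    obtain ⟨a, rfl⟩ := this
    exact congrFun h2 a
  · exact hy' i hi

theorem GoodL.ker_smallA (hL : GoodL L) (hdn : d ≤ n) (y : Fin (n+1) → ℂ)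
    (hy : ∀ k : Fin d, ∑ i, L k.succ i * y i = 0)
    (T : Finset (Fin (n+1))) (hT : T.card ≤ d) (hyT : ∀ i ∉ T, y i = 0) : y = 0 := by
  obtain ⟨T', hTT', hT'⟩ := Finset.exists_superset_card_eq hT (by simp; omega)
  have hy' : ∀ i ∉ T', y i = 0 := fun i hi => hyT i (fun h => hi (hTT' h))
  have h1 : (L.submatrix Fin.succ (T'.orderEmbOfFin hT')).mulVec (y ∘ T'.orderEmbOfFin hT') = 0 := by
    ext k
    have := hy k
    rw [sum_orderEmb T' hT' _ (fun i hi => by simp [hy' i hi])] at this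
    simpa [Matrix.mulVec, dotProduct] using this
  have h2 := Matrix.eq_zero_of_mulVec_eq_zero (hL.low _ (T'.orderEmbOfFin hT').injective) h1
  ext i
  by_cases hi : i ∈ T'
  · have : i ∈ Set.range (T'.orderEmbOfFin hT') := by simpa using hi
    obtain ⟨a, rfl⟩ := this
    exact congrFun h2 a
  · exact hy' i hi

theorem GoodL.solve (hL : GoodL L) (T : Finset (Fin (n+1))) (hT : T.card = d+1)
    (θ : Fin (d+1) → ℂ) : ∃ y : Fin (n+1) → ℂ, (∀ i ∉ T, y i = 0) ∧ L.mulVec y = θ := by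
  classical
  have hu : IsUnit (L.submatrix id (T.orderEmbOfFin hT)).det :=
    (hL.top _ (T.orderEmbOfFin hT).injective).isUnit
  let w := (L.submatrix id (T.orderEmbOfFin hT))⁻¹.mulVec θ
  have hw : (L.submatrix id (T.orderEmbOfFin hT)).mulVec w = θ := by
    simp [w, Matrix.mulVec_mulVec, Matrix.mul_nonsing_inv _ hu]
  refine ⟨Function.extend (T.orderEmbOfFin hT) w 0, ?_, ?_⟩
  · intro i hi
    rw [Function.extend_apply']
    · rfl
    · rintro ⟨a, rfl⟩
      exact hi (Finset.orderEmbOfFin_mem T hT a)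
  · ext k
    rw [Matrix.mulVec, dotProduct, sum_orderEmb T hT]
    · rw [← hw]
      simp [Matrix.mulVec, dotProduct, (T.orderEmbOfFin hT).injective.extend_apply]
    · intro i hi
      rw [Function.extend_apply']
      · simp
      · rintro ⟨a, rfl⟩
        exact hi (Finset.orderEmbOfFin_mem T hT a)

theorem GoodL.solveT (hL : GoodL L) (T : Finset (Fin (n+1))) (hT : T.card = d+1)
    (r : Fin (n+1) → ℂ) : ∃ X : Fin (d+1) → ℂ, ∀ i ∈ T, Matrix.vecMul X L i = r i := by
  classical
  have hu : IsUnit (L.submatrix id (T.orderEmbOfFin hT)).det :=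
    (hL.top _ (T.orderEmbOfFin hT).injective).isUnit
  let w := Matrix.vecMul (r ∘ (T.orderEmbOfFin hT)) (L.submatrix id (T.orderEmbOfFin hT))⁻¹
  have hw : Matrix.vecMul w (L.submatrix id (T.orderEmbOfFin hT)) = r ∘ (T.orderEmbOfFin hT) := by
    simp [w, Matrix.vecMul_vecMul, Matrix.nonsing_inv_mul _ hu]
  refine ⟨w, fun i hi => ?_⟩
  have : i ∈ Set.range (T.orderEmbOfFin hT) := by simpa using hi
  obtain ⟨a, rfl⟩ := this
  exact congrFun hw a

theorem GoodL.kerT (hL : GoodL L) (T : Finset (Fin (n+1))) (hT : T.card = d+1)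
    (X : Fin (d+1) → ℂ) (hX : ∀ i ∈ T, Matrix.vecMul X L i = 0) : X = 0 := by
  classical
  refine Matrix.eq_zero_of_vecMul_eq_zero (hL.top _ (T.orderEmbOfFin hT).injective) ?_
  ext a
  exact hX _ (Finset.orderEmbOfFin_mem T hT a)

theorem GoodL.kerT' (hL : GoodL L) (T : Finset (Fin (n+1))) (hT : T.card = d)
    (X : Fin (d+1) → ℂ) (hX0 : X 0 = 0) (hX : ∀ i ∈ T, Matrix.vecMul X L i = 0) : X = 0 := by
  classical
  have h : (X ∘ Fin.succ : Fin d → ℂ) = 0 := by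
    refine Matrix.eq_zero_of_vecMul_eq_zero (hL.low _ (T.orderEmbOfFin hT).injective) ?_
    ext a
    have := hX _ (Finset.orderEmbOfFin_mem T hT a)
    rw [Matrix.vecMul, dotProduct, Fin.sum_univ_succ, hX0] at this
    simpa [Matrix.vecMul, dotProduct] using this
  ext k
  refine Fin.cases hX0 (fun j => congrFun h j) k

/-- The finset `{0} ∪ (S + 1)` of columns. -/
def zS {n : ℕ} (S : Finset (Fin n)) : Finset (Fin (n+1)) :=
  insert 0 (S.map (Fin.succEmb n))

theorem mem_zS_zero {n : ℕ} (S : Finset (Fin n)) : (0 : Fin (n+1)) ∈ zS S := by simp [zS]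

theorem mem_zS_succ {n : ℕ} (S : Finset (Fin n)) (j : Fin n) : j.succ ∈ zS S ↔ j ∈ S := by
  simp [zS]

theorem card_zS {n : ℕ} (S : Finset (Fin n)) : (zS S).card = S.card + 1 := by
  rw [zS, Finset.card_insert_of_notMem (by simp), Finset.card_map]

/-- Circuit vectors. -/
theorem GoodL.exists_circuit (hL : GoodL L) (hdn : d ≤ n) (S : Finset (Fin n))
    (hS : S.card = d+1) : ∃ c : Fin (n+1) → ℂ, L.mulVec c = 0 ∧ ∀ i, c i ≠ 0 ↔ i ∈ zS S := by
  classical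
  obtain ⟨y, hy1, hy2⟩ := hL.solve (S.map (Fin.succEmb n)) (by simpa using hS)
    (- L.mulVec (Pi.single 0 1))
  have h00 : (0 : Fin (n+1)) ∉ S.map (Fin.succEmb n) := by simp
  have hc0 : (y + Pi.single 0 1 : Fin (n+1) → ℂ) 0 = 1 := by
    simp [hy1 0 h00]
  have hker : L.mulVec (y + Pi.single 0 1) = 0 := by
    rw [Matrix.mulVec_add, hy2]; simp
  have hsupp : ∀ i ∉ zS S, (y + Pi.single 0 1 : Fin (n+1) → ℂ) i = 0 := by
    intro i hi
    simp only [zS, Finset.mem_insert, not_or] at hi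
    simp [hy1 i hi.2, hi.1]
  refine ⟨y + Pi.single 0 1, hker, fun i => ⟨fun h => ?_, fun hi h => ?_⟩⟩
  · by_contra hi
    exact h (hsupp i hi)
  · have := hL.ker_small hdn _ hker ((zS S).erase i) (by
      rw [Finset.card_erase_of_mem hi, card_zS]; omega) (by
      intro j hj
      by_cases hji : j = i
      · rw [hji, h]
      · exact hsupp j (fun hj' => hj (Finset.mem_erase.mpr ⟨hji, hj'⟩)))
    rw [this] at hc0
    simp at hc0

end good

/- ### Part 2: spanning by monomials in `θ` and `ζ` -/

section spanning
open MvPolynomial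

/-- The linear form with coefficient vector `v`. -/
def lin {N : ℕ} (A : Type) [CommRing A] [Algebra ℂ A] (v : Fin N → ℂ) : MvPolynomial (Fin N) A :=
  ∑ i, C (algebraMap ℂ A (v i)) * X i

/-- `lin` as a linear map. -/
def linL {N : ℕ} (A : Type) [CommRing A] [Algebra ℂ A] :
    (Fin N → ℂ) →ₗ[ℂ] MvPolynomial (Fin N) A where
  toFun := lin A
  map_add' v w := by simp [lin, add_mul, Finset.sum_add_distrib]
  map_smul' c v := by
    simp only [lin, Pi.smul_apply, smul_eq_mul, map_mul, RingHom.id_apply, Finset.smul_sum]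
    refine Finset.sum_congr rfl fun i _ => ?_
    rw [Algebra.smul_def, MvPolynomial.algebraMap_apply, mul_assoc]

theorem lin_single {N : ℕ} (A : Type) [CommRing A] [Algebra ℂ A] (i : Fin N) :
    lin A (Pi.single i 1) = X i := by
  classical
  rw [lin, Finset.sum_eq_single i]
  · simp
  · intro j _ hj; simp [hj]
  · simp

theorem lin_homog {N : ℕ} (A : Type) [CommRing A] [Algebra ℂ A] (v : Fin N → ℂ) :
    lin A v ∈ homogeneousSubmodule (Fin N) A 1 := by
  rw [lin]
  refine Submodule.sum_mem _ fun i _ => ?_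
  exact isHomogeneous_C_mul_X _ _

/-- Monomial in a family. -/
def mon {R : Type} [CommRing R] {k : ℕ} (v : Fin k → R) (b : Fin k →₀ ℕ) : R :=
  b.prod fun i e => v i ^ e

theorem mon_zero {R : Type} [CommRing R] {k : ℕ} (v : Fin k → R) : mon v 0 = 1 := by
  simp [mon]

theorem mon_single {R : Type} [CommRing R] {k : ℕ} (v : Fin k → R) (i : Fin k) :
    mon v (Finsupp.single i 1) = v i := by
  simp [mon]

theorem mon_add {R : Type} [CommRing R] {k : ℕ} (v : Fin k → R) (a b : Fin k →₀ ℕ) :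
    mon v (a + b) = mon v a * mon v b := by
  classical
  exact Finsupp.prod_add_index' (fun _ => pow_zero _) (fun _ _ _ => pow_add _ _ _)

theorem map_mon {R R' : Type} [CommRing R] [CommRing R'] (φ : R →+* R') {k : ℕ} (v : Fin k → R)
    (b : Fin k →₀ ℕ) : φ (mon v b) = mon (fun i => φ (v i)) b := by
  simp [mon, Finsupp.prod, map_prod]

theorem span_pow_le_mon {A R : Type} [CommRing A] [CommRing R] [Algebra A R] {k : ℕ}
    (v : Fin k → R) (q : ℕ) :
    Submodule.span A (Set.range v) ^ q ≤ Submodule.span A {f | ∃ b, b.degree = q ∧ f = mon v b} := by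
  induction q with
  | zero =>
    rw [pow_zero, Submodule.one_eq_span, Submodule.span_le]
    rintro x rfl
    exact Submodule.subset_span ⟨0, by simp, by simp [mon_zero]⟩
  | succ q ih =>
    rw [pow_succ]
    refine (mul_le_mul' ih le_rfl).trans ?_
    rw [Submodule.span_mul_span, Submodule.span_le]
    rintro x ⟨f, ⟨b, hb, rfl⟩, g, ⟨i, rfl⟩, rfl⟩
    refine Submodule.subset_span ⟨b + Finsupp.single i 1, ?_, ?_⟩
    · rw [map_add, hb, Finsupp.degree_single]
    · simp [mon_add, mon_single]

theorem sup_pow_le {A R : Type} [CommRing A] [CommRing R] [Algebra A R] (U V : Submodule A R)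
    (q : ℕ) : (U ⊔ V) ^ (q+1) ≤ U * (U ⊔ V) ^ q ⊔ V ^ (q+1) := by
  induction q with
  | zero => simp
  | succ q ih =>
    rw [pow_succ' (U ⊔ V) (q+1), Submodule.sup_mul]
    refine sup_le le_sup_left ?_
    refine (mul_le_mul' le_rfl ih).trans ?_
    rw [Submodule.mul_sup]
    refine sup_le (le_sup_of_le_left ?_) (le_sup_of_le_right ?_)
    · rw [mul_left_comm]
      refine mul_le_mul' le_rfl ?_
      rw [pow_succ']
      exact mul_le_mul' le_sup_right le_rfl
    · rw [pow_succ' V (q+1)]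

variable {N e m : ℕ} (A : Type) [CommRing A] [Algebra ℂ A]
  (L : Matrix (Fin e) (Fin N) ℂ) (Z : Matrix (Fin m) (Fin N) ℂ)

/-- Span of linear forms given by rows. -/
def rowS {k N : ℕ} (A : Type) [CommRing A] [Algebra ℂ A] (M : Matrix (Fin k) (Fin N) ℂ) :
    Submodule A (MvPolynomial (Fin N) A) :=
  Submodule.span A (Set.range fun i => lin A (M i))

/-- Span of products `θ^b ζ^a` with `|a| ≤ d`, `|a| + |b| = q`. -/
def SS (d q : ℕ) : Submodule A (MvPolynomial (Fin N) A) :=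
  Submodule.span A {f | ∃ (b : Fin e →₀ ℕ) (a : Fin m →₀ ℕ), a.degree ≤ d ∧ a.degree + b.degree = q ∧
    f = mon (fun i => lin A (L i)) b * mon (fun i => lin A (Z i)) a}

variable {L Z}

theorem homog_one_le (hLZ : Submodule.span ℂ (Set.range L) ⊔ Submodule.span ℂ (Set.range Z) = ⊤) :
    homogeneousSubmodule (Fin N) A 1 ≤ rowS A L ⊔ rowS A Z := by
  rw [homogeneousSubmodule_one_eq_span_X, Submodule.span_le]
  rintro x ⟨i, rfl⟩
  have h : (⊤ : Submodule ℂ (Fin N → ℂ)) ≤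
      ((rowS A L ⊔ rowS A Z).restrictScalars ℂ).comap (linL A) := by
    rw [← hLZ]
    refine sup_le ?_ ?_
    · rw [Submodule.span_le]
      rintro _ ⟨k, rfl⟩
      exact (le_sup_left : rowS A L ≤ rowS A L ⊔ rowS A Z) (Submodule.subset_span ⟨k, rfl⟩)
    · rw [Submodule.span_le]
      rintro _ ⟨k, rfl⟩
      exact (le_sup_right : rowS A Z ≤ rowS A L ⊔ rowS A Z) (Submodule.subset_span ⟨k, rfl⟩)
  have : lin A (Pi.single i 1) ∈ rowS A L ⊔ rowS A Z :=
    h (Submodule.mem_top (x := (Pi.single i 1 : Fin N → ℂ)))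
  rwa [lin_single] at this

theorem rowS_le {k N : ℕ} (A : Type) [CommRing A] [Algebra ℂ A] (M : Matrix (Fin k) (Fin N) ℂ) :
    rowS A M ≤ homogeneousSubmodule (Fin N) A 1 := by
  rw [rowS, Submodule.span_le]
  rintro _ ⟨k, rfl⟩
  exact lin_homog A _

theorem homog_succ_le
    (hLZ : Submodule.span ℂ (Set.range L) ⊔ Submodule.span ℂ (Set.range Z) = ⊤) (q : ℕ) :
    homogeneousSubmodule (Fin N) A (q+1) ≤
      rowS A L * homogeneousSubmodule (Fin N) A q ⊔ rowS A Z ^ (q+1) := by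
  have h1 : homogeneousSubmodule (Fin N) A 1 = rowS A L ⊔ rowS A Z :=
    le_antisymm (homog_one_le A hLZ) (sup_le (rowS_le A L) (rowS_le A Z))
  rw [← homogeneousSubmodule_one_pow (σ := Fin N) (R := A) (q+1), ← homogeneousSubmodule_one_pow (σ := Fin N) (R := A) q, h1]
  exact sup_pow_le _ _ q

theorem rowS_mul_SS (d q : ℕ) : rowS A L * SS A L Z d q ≤ SS A L Z d (q+1) := by
  rw [rowS, SS, Submodule.span_mul_span, Submodule.span_le]
  rintro x ⟨_, ⟨k, rfl⟩, _, ⟨b, a, ha, hab, rfl⟩, rfl⟩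
  refine Submodule.subset_span ⟨b + Finsupp.single k 1, a, ha, ?_, ?_⟩
  · rw [map_add, Finsupp.degree_single]; omega
  · simp only [mon_add, mon_single]; ring

theorem rowS_pow_le_SS (d q : ℕ) (hq : q ≤ d) : rowS A Z ^ q ≤ SS A L Z d q := by
  refine (span_pow_le_mon _ q).trans ?_
  rw [Submodule.span_le]
  rintro _ ⟨b, hb, rfl⟩
  exact Submodule.subset_span ⟨0, b, by omega, by simp [hb], by simp [mon_zero]⟩

theorem homog_zero_le_SS (d : ℕ) : homogeneousSubmodule (Fin N) A 0 ≤ SS A L Z d 0 := by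
  rw [← homogeneousSubmodule_one_pow (σ := Fin N) (R := A) 0, pow_zero, ← pow_zero (rowS A Z)]
  exact rowS_pow_le_SS A d 0 (Nat.zero_le _)

theorem span_low (hLZ : Submodule.span ℂ (Set.range L) ⊔ Submodule.span ℂ (Set.range Z) = ⊤)
    (d q : ℕ) (hq : q ≤ d) : homogeneousSubmodule (Fin N) A q ≤ SS A L Z d q := by
  induction q with
  | zero => exact homog_zero_le_SS A d
  | succ q ih =>
    refine (homog_succ_le A hLZ q).trans (sup_le ?_ (rowS_pow_le_SS A d _ hq))
    exact (mul_le_mul' le_rfl (ih (by omega))).trans (rowS_mul_SS A d q)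

/-- Saturation of a submodule with respect to powers of `D`. -/
def Sat {A M : Type} [CommRing A] [AddCommGroup M] [Module A M] (D : A) (W : Submodule A M) :
    Submodule A M where
  carrier := {f | ∃ k : ℕ, D ^ k • f ∈ W}
  add_mem' := by
    rintro f g ⟨k, hk⟩ ⟨l, hl⟩
    refine ⟨k + l, ?_⟩
    rw [smul_add]
    refine W.add_mem ?_ ?_
    · rw [add_comm, pow_add, mul_smul]; exact W.smul_mem _ hk
    · rw [pow_add, mul_smul]; exact W.smul_mem _ hl
  zero_mem' := ⟨0, by simp⟩
  smul_mem' := by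
    rintro c f ⟨k, hk⟩
    exact ⟨k, by rw [smul_comm]; exact W.smul_mem _ hk⟩

theorem le_Sat {A M : Type} [CommRing A] [AddCommGroup M] [Module A M] (D : A)
    (W : Submodule A M) : W ≤ Sat D W := fun f hf => ⟨0, by simpa using hf⟩

theorem span_all (hLZ : Submodule.span ℂ (Set.range L) ⊔ Submodule.span ℂ (Set.range Z) = ⊤)
    (d : ℕ) (D : A) (J : Ideal (MvPolynomial (Fin N) A))
    (hred : ∀ f ∈ homogeneousSubmodule (Fin N) A (d+1),
      D • f ∈ rowS A L * homogeneousSubmodule (Fin N) A d ⊔ J.restrictScalars A) (q : ℕ) :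
    homogeneousSubmodule (Fin N) A q ≤ Sat D (SS A L Z d q ⊔ J.restrictScalars A) := by
  induction q with
  | zero => exact (homog_zero_le_SS A d).trans (le_sup_left.trans (le_Sat D _))
  | succ q ih =>
    have h1 : rowS A L * homogeneousSubmodule (Fin N) A q ≤
        Sat D (SS A L Z d (q+1) ⊔ J.restrictScalars A) := by
      rw [Submodule.mul_le]
      intro x hx y hy
      obtain ⟨k, hk⟩ := ih hy
      refine ⟨k, ?_⟩
      rw [← mul_smul_comm]
      obtain ⟨s, hs, j, hj, hsj⟩ := Submodule.mem_sup.mp hk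
      rw [← hsj, mul_add]
      refine Submodule.add_mem_sup ?_ (J.mul_mem_left _ hj)
      exact rowS_mul_SS A d q (Submodule.mul_mem_mul hx hs)
    by_cases hq : q + 1 ≤ d
    · exact (span_low A hLZ d (q+1) hq).trans (le_sup_left.trans (le_Sat D _))
    · have h2 : homogeneousSubmodule (Fin N) A (q+1) =
          homogeneousSubmodule (Fin N) A (q-d) * homogeneousSubmodule (Fin N) A (d+1) := by
        rw [← homogeneousSubmodule_one_pow (σ := Fin N) (R := A) (q+1), ← homogeneousSubmodule_one_pow (σ := Fin N) (R := A) (q-d),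
          ← homogeneousSubmodule_one_pow (σ := Fin N) (R := A) (d+1), ← pow_add]
        congr 1; omega
      have h3 : homogeneousSubmodule (Fin N) A (q-d) * homogeneousSubmodule (Fin N) A d ≤
          homogeneousSubmodule (Fin N) A q := by
        have := homogeneousSubmodule_mul (σ := Fin N) (R := A) (q-d) d
        rwa [Nat.sub_add_cancel (by omega)] at this
      rw [h2, Submodule.mul_le]
      intro x hx y hy
      have h4 : D • (x * y) ∈ rowS A L * homogeneousSubmodule (Fin N) A q ⊔ J.restrictScalars A := by
        rw [← mul_smul_comm]
        obtain ⟨s, hs, j, hj, hsj⟩ := Submodule.mem_sup.mp (hred y hy)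
        rw [← hsj, mul_add]
        refine Submodule.add_mem_sup ?_ (J.mul_mem_left _ hj)
        have h5 : x * s ∈ homogeneousSubmodule (Fin N) A (q-d) *
          (rowS A L * homogeneousSubmodule (Fin N) A d) := Submodule.mul_mem_mul hx hs
        rw [mul_left_comm] at h5
        exact mul_le_mul' le_rfl h3 h5
      have h6 : rowS A L * homogeneousSubmodule (Fin N) A q ⊔ J.restrictScalars A ≤
          Sat D (SS A L Z d (q+1) ⊔ J.restrictScalars A) :=
        sup_le h1 (le_sup_right.trans (le_Sat D _))
      obtain ⟨k, hk⟩ := h6 h4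
      exact ⟨k + 1, by rw [pow_succ, mul_smul]; exact hk⟩

end spanning

theorem GoodL.exists_Z {d n : ℕ} {L : Matrix (Fin (d+1)) (Fin (n+1)) ℂ} (hL : GoodL L)
    (hdn : d ≤ n) : ∃ Z : Matrix (Fin (n-d)) (Fin (n+1)) ℂ,
    Submodule.span ℂ (Set.range L) ⊔ Submodule.span ℂ (Set.range Z) = ⊤ := by
  obtain ⟨T, -, hT⟩ := Finset.exists_superset_card_eq (s := (∅ : Finset (Fin (n+1)))) (n := d+1)
    (by simp) (by simpa using hdn)
  have hli : LinearIndependent ℂ (fun k => L k : Fin (d+1) → Fin (n+1) → ℂ) := by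
    rw [Fintype.linearIndependent_iff]
    intro g hg
    have : g = 0 := by
      refine hL.kerT T hT g fun i _ => ?_
      have := congrFun hg i
      simpa [Matrix.vecMul, dotProduct] using this
    intro i; rw [this]; rfl
  obtain ⟨W, hW⟩ := Submodule.exists_isCompl (Submodule.span ℂ (Set.range L))
  have hf : Module.finrank ℂ W = n - d := by
    have h1 := Submodule.finrank_add_eq_of_isCompl hW
    rw [finrank_span_eq_card hli] at h1
    simp at h1
    omega
  let b := Module.finBasisOfFinrankEq ℂ W hf
  refine ⟨fun j => (b j : Fin (n+1) → ℂ), ?_⟩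
  have h2 : Submodule.span ℂ (Set.range fun j => (b j : Fin (n+1) → ℂ)) = W := by
    have := b.span_eq
    have h3 := congrArg (Submodule.map W.subtype) this
    rw [Submodule.map_span, ← Set.range_comp, Submodule.map_top, Submodule.range_subtype] at h3
    exact h3
  have h4 := hW.sup_eq_top
  rw [← h2] at h4
  exact h4

/- ### Part 3: reduction in degree `d+1` -/

section reduction
open MvPolynomial

/-- The finite set of exponents of degree `k`. -/
def mons (m k : ℕ) : Finset (Fin m →₀ ℕ) := Finset.finsuppAntidiag Finset.univ k

theorem mem_mons {m k : ℕ} {a : Fin m →₀ ℕ} : a ∈ mons m k ↔ a.degree = k := by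
  simp [mons, Finset.mem_finsuppAntidiag, Finsupp.degree_eq_sum]

theorem card_mons (m k : ℕ) : (mons m k).card = m.multichoose k := by
  rw [mons, Finset.card_finsuppAntidiag_nat_eq_multichoose]; simp

theorem eval_lin {N : ℕ} (v y : Fin N → ℂ) : eval y (lin ℂ v) = ∑ i, v i * y i := by
  simp [lin]

theorem aev {N : ℕ} (y : Fin N → ℂ) (f : MvPolynomial (Fin N) ℂ) :
    (aeval y f : ℂ) = eval y f := by rw [← coe_aeval_eq_eval]; rfl

theorem rowS_mul_le_ker {k N : ℕ} (M : Matrix (Fin k) (Fin N) ℂ) (y : Fin N → ℂ)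
    (hy : M.mulVec y = 0) (W : Submodule ℂ (MvPolynomial (Fin N) ℂ)) :
    rowS ℂ M * W ≤ LinearMap.ker (aeval y : MvPolynomial (Fin N) ℂ →ₐ[ℂ] ℂ).toLinearMap := by
  rw [Submodule.mul_le]
  intro f hf g _
  have h : rowS ℂ M ≤ LinearMap.ker (aeval y : MvPolynomial (Fin N) ℂ →ₐ[ℂ] ℂ).toLinearMap := by
    rw [rowS, Submodule.span_le]
    rintro _ ⟨i, rfl⟩
    have := congrFun hy i
    simp only [SetLike.mem_coe, LinearMap.mem_ker, AlgHom.toLinearMap_apply, aev, eval_lin]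
    simpa [Matrix.mulVec, dotProduct] using this
  have := h hf
  simp only [LinearMap.mem_ker, AlgHom.toLinearMap_apply, map_mul] at this ⊢
  rw [this, zero_mul]

/-- The squarefree monomial `∏_{j ∈ S} Y_{j+1}`. -/
def yS {n : ℕ} (A : Type) [CommRing A] (S : Finset (Fin n)) : MvPolynomial (Fin (n+1)) A :=
  ∏ j ∈ S, X j.succ

theorem yS_homog {n : ℕ} (A : Type) [CommRing A] (S : Finset (Fin n)) {k : ℕ} (hS : S.card = k) :
    yS A S ∈ homogeneousSubmodule (Fin (n+1)) A k := by
  have := IsHomogeneous.prod S (fun j : Fin n => (X j.succ : MvPolynomial (Fin (n+1)) A))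
    (fun _ => 1) (fun j _ => isHomogeneous_X _ _)
  simp only [Finset.sum_const, smul_eq_mul, mul_one, hS] at this
  exact this

variable {d n : ℕ} {L : Matrix (Fin (d+1)) (Fin (n+1)) ℂ} {Z : Matrix (Fin (n-d)) (Fin (n+1)) ℂ}

theorem top_span (hL : GoodL L) (hdn : d ≤ n)
    (hLZ : Submodule.span ℂ (Set.range L) ⊔ Submodule.span ℂ (Set.range Z) = ⊤) :
    homogeneousSubmodule (Fin (n+1)) ℂ (d+1) ≤
      rowS ℂ L * homogeneousSubmodule (Fin (n+1)) ℂ d ⊔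
      Submodule.span ℂ (Set.range fun S : {S : Finset (Fin n) // S.card = d+1} => yS ℂ S.1) := by
  classical
  set W := rowS ℂ L * homogeneousSubmodule (Fin (n+1)) ℂ d with hW
  choose c hc1 hc2 using fun S : {S : Finset (Fin n) // S.card = d+1} =>
    hL.exists_circuit hdn S.1 S.2
  have hev : ∀ S S' : {S : Finset (Fin n) // S.card = d+1},
      eval (c S) (yS ℂ S'.1) ≠ 0 ↔ S' = S := by
    intro S S'
    simp only [yS, map_prod, eval_X, Finset.prod_ne_zero_iff]
    constructor
    · intro h
      apply Subtype.ext
      refine Finset.eq_of_subset_of_card_le (fun j hj => ?_) (by rw [S.2, S'.2])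
      exact (mem_zS_succ _ _).mp ((hc2 S _).mp (h j hj))
    · rintro rfl j hj
      exact (hc2 _ _).mpr ((mem_zS_succ _ _).mpr hj)
  have hli : LinearIndependent ℂ
      (fun S : {S : Finset (Fin n) // S.card = d+1} => W.mkQ (yS ℂ S.1)) := by
    rw [Fintype.linearIndependent_iff]
    intro g hg S
    have h1 : W.mkQ (∑ S' : {S : Finset (Fin n) // S.card = d+1}, g S' • yS ℂ S'.1) = 0 := by
      rw [map_sum]; simpa using hg
    rw [Submodule.mkQ_apply, Submodule.Quotient.mk_eq_zero] at h1
    have h2 := rowS_mul_le_ker L (c S) (hc1 S) _ h1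
    simp only [LinearMap.mem_ker, AlgHom.toLinearMap_apply, map_sum, map_smul,
      aev, smul_eq_mul] at h2
    rw [Finset.sum_eq_single S] at h2
    · exact (mul_eq_zero.mp h2).resolve_right ((hev S S).mpr rfl)
    · intro S' _ hS'
      rw [not_ne_iff.mp (mt (hev S S').mp hS'), mul_zero]
    · simp
  set V := Submodule.span ℂ
    (Set.range fun S : {S : Finset (Fin n) // S.card = d+1} => W.mkQ (yS ℂ S.1)) with hV
  set U := (homogeneousSubmodule (Fin (n+1)) ℂ (d+1)).map W.mkQ with hU
  have hVU : V ≤ U := by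
    rw [hV, Submodule.span_le]
    rintro _ ⟨S, rfl⟩
    exact Submodule.mem_map_of_mem (yS_homog ℂ S.1 S.2)
  have hU2 : U ≤ Submodule.span ℂ
      (((mons (n-d) (d+1)).image fun a => W.mkQ (mon (fun i => lin ℂ (Z i)) a) : Finset _) : Set _) := by
    rw [hU, Submodule.map_le_iff_le_comap]
    refine (homog_succ_le ℂ hLZ d).trans (sup_le ?_ ?_)
    · intro f hf
      rw [Submodule.mem_comap, Submodule.mkQ_apply, (Submodule.Quotient.mk_eq_zero _).mpr hf]
      exact Submodule.zero_mem _
    · refine (span_pow_le_mon _ _).trans ?_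
      rw [Submodule.span_le]
      rintro _ ⟨b, hb, rfl⟩
      exact Submodule.subset_span (by
        rw [Finset.coe_image]
        exact ⟨b, mem_mons.mpr hb, rfl⟩)
  have hfd : Module.Finite ℂ (Submodule.span ℂ
      (((mons (n-d) (d+1)).image fun a => W.mkQ (mon (fun i => lin ℂ (Z i)) a) : Finset _) :
        Set (MvPolynomial (Fin (n+1)) ℂ ⧸ W))) := Module.Finite.span_finset ℂ _
  have hfin : Module.Finite ℂ U := Submodule.finiteDimensional_of_le hU2
  have hUc : Module.finrank ℂ U ≤ Module.finrank ℂ V := by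
    refine (Submodule.finrank_mono hU2).trans ?_
    refine (finrank_span_finset_le_card _).trans ?_
    refine Finset.card_image_le.trans ?_
    rw [card_mons, hV, finrank_span_eq_card hli, Nat.multichoose_eq]
    simp only [Fintype.card_finset_len, Fintype.card_fin]
    rw [show n - d + (d+1) - 1 = n by omega]
  have hVU' : V = U := Submodule.eq_of_le_of_finrank_le hVU hUc
  intro f hf
  have hf1 : W.mkQ f ∈ V := by rw [hVU']; exact Submodule.mem_map_of_mem hf
  have hV2 : V = (Submodule.span ℂ
      (Set.range fun S : {S : Finset (Fin n) // S.card = d+1} => yS ℂ S.1)).map W.mkQ := by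
    rw [Submodule.map_span, ← Set.range_comp]; rfl
  rw [hV2] at hf1
  obtain ⟨g, hg, hgf⟩ := hf1
  have : f - g ∈ W := by
    rw [← Submodule.Quotient.mk_eq_zero, Submodule.Quotient.mk_sub, sub_eq_zero]
    exact hgf.symm
  have h3 := Submodule.add_mem_sup this hg
  simpa using h3

/-- The relations of the (scaled) reciprocal plane. -/
def FS (A : Type) [CommRing A] [Algebra ℂ A] (u : Fin (n+1) → A) (c : Fin (n+1) → ℂ)
    (S : Finset (Fin n)) : MvPolynomial (Fin (n+1)) A :=
  ∑ i ∈ zS S, C (algebraMap ℂ A (c i) * u i) * ∏ j ∈ (zS S).erase i, X j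

/-- The ideal of relations. -/
def JJ (A : Type) [CommRing A] [Algebra ℂ A] (u : Fin (n+1) → A)
    (c : {S : Finset (Fin n) // S.card = d+1} → Fin (n+1) → ℂ) :
    Ideal (MvPolynomial (Fin (n+1)) A) :=
  Ideal.span (Set.range fun S => FS A u (c S) S.1)

theorem homog_le_span_mon (N : ℕ) (A : Type) [CommRing A] (q : ℕ) :
    homogeneousSubmodule (Fin N) A q ≤
      Submodule.span A {f | ∃ b, b.degree = q ∧ f = mon (fun i => X i) b} := by
  rw [← homogeneousSubmodule_one_pow (σ := Fin N) (R := A), homogeneousSubmodule_one_eq_span_X]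
  exact span_pow_le_mon _ q

theorem erase_homog (A : Type) [CommRing A] (S : Finset (Fin n)) (hS : S.card = d+1)
    (i : Fin (n+1)) (hi : i ∈ zS S) :
    (∏ j ∈ (zS S).erase i, X j : MvPolynomial (Fin (n+1)) A) ∈
      homogeneousSubmodule (Fin (n+1)) A (d+1) := by
  have := IsHomogeneous.prod ((zS S).erase i) (fun j => (X j : MvPolynomial (Fin (n+1)) A))
    (fun _ => 1) (fun j _ => isHomogeneous_X _ _)
  simp only [Finset.sum_const, smul_eq_mul, mul_one, Finset.card_erase_of_mem hi, card_zS, hS] at this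
  exact this

theorem zS_erase_zero (S : Finset (Fin n)) : (zS S).erase 0 = S.map (Fin.succEmb n) := by
  rw [zS, Finset.erase_insert (by simp)]

theorem exists_D (hL : GoodL L) (hdn : d ≤ n)
    (hLZ : Submodule.span ℂ (Set.range L) ⊔ Submodule.span ℂ (Set.range Z) = ⊤)
    (c : {S : Finset (Fin n) // S.card = d+1} → Fin (n+1) → ℂ)
    (hc : ∀ S i, c S i ≠ 0 ↔ i ∈ zS S.1) :
    ∃ D : MvPolynomial (Fin (n+1)) ℂ, eval (Pi.single 0 1) D = 1 ∧
      ∀ f ∈ homogeneousSubmodule (Fin (n+1)) (MvPolynomial (Fin (n+1)) ℂ) (d+1),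
        D • f ∈ rowS (MvPolynomial (Fin (n+1)) ℂ) L *
            homogeneousSubmodule (Fin (n+1)) (MvPolynomial (Fin (n+1)) ℂ) d ⊔
          (JJ (MvPolynomial (Fin (n+1)) ℂ) X c).restrictScalars (MvPolynomial (Fin (n+1)) ℂ) := by
  classical
  have hXI0 : ∀ i, (X i - C ((Pi.single 0 1 : Fin (n+1) → ℂ) i) : MvPolynomial (Fin (n+1)) ℂ) ∈
      RingHom.ker (eval (Pi.single 0 1 : Fin (n+1) → ℂ)) := by
    intro i
    rw [RingHom.mem_ker]
    simp
  set A := MvPolynomial (Fin (n+1)) ℂ with hA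
  set N' := rowS A L * homogeneousSubmodule (Fin (n+1)) A d ⊔ (JJ A X c).restrictScalars A with hN'
  set H := homogeneousSubmodule (Fin (n+1)) A (d+1) with hH
  set I : Ideal A := RingHom.ker (eval (Pi.single 0 1 : Fin (n+1) → ℂ)) with hI
  have hXI : ∀ i, (X i - C ((Pi.single 0 1 : Fin (n+1) → ℂ) i) : A) ∈ I := by
    intro i
    exact hXI0 i
  -- the squarefree monomials
  have hyS : ∀ S : {S : Finset (Fin n) // S.card = d+1}, yS A S.1 ∈ I • H ⊔ N' := by
    intro S
    have h0 : c S 0 ≠ 0 := (hc S 0).mpr (mem_zS_zero _)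
    have h1 : algebraMap ℂ A (c S 0) • yS A S.1 =
        ∑ i ∈ zS S.1, (-(algebraMap ℂ A (c S i)) *
          (X i - C ((Pi.single 0 1 : Fin (n+1) → ℂ) i))) • (∏ j ∈ (zS S.1).erase i, X j) +
        FS A X (c S) S.1 := by
      rw [FS, ← Finset.sum_add_distrib]
      rw [Finset.sum_eq_single 0]
      · simp only [Pi.single_eq_same, zS_erase_zero, Finset.prod_map, Fin.coe_succEmb, yS]
        simp only [smul_eq_C_mul, map_mul, map_neg, map_sub, map_one, mul_sub]
        ring
      · intro i _ hi
        rw [Pi.single_eq_of_ne hi]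
        simp only [smul_eq_C_mul, map_mul, map_neg, map_sub, map_zero, mul_sub]
        ring
      · intro h; exact absurd (mem_zS_zero _) h
    have h2 : algebraMap ℂ A (c S 0) • yS A S.1 ∈ I • H ⊔ N' := by
      rw [h1]
      refine Submodule.add_mem_sup ?_ ?_
      · refine Submodule.sum_mem _ fun i hi => ?_
        exact Submodule.smul_mem_smul (I.mul_mem_left _ (hXI i)) (erase_homog A S.1 S.2 i hi)
      · exact (le_sup_right : (JJ A X c).restrictScalars A ≤ N') (Ideal.subset_span ⟨S, rfl⟩)
    have h3 := (I • H ⊔ N').smul_mem (algebraMap ℂ A (c S 0)⁻¹) h2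
    rwa [smul_smul, ← map_mul, inv_mul_cancel₀ h0, map_one, one_smul] at h3
  let φ : MvPolynomial (Fin (n+1)) ℂ →ₐ[ℂ] MvPolynomial (Fin (n+1)) A :=
    mapAlgHom (Algebra.ofId ℂ A)
  have hφlin : ∀ v, φ (lin ℂ v) = lin A v := by
    intro v
    simp [φ, lin]
  have hcomap : homogeneousSubmodule (Fin (n+1)) ℂ (d+1) ≤
      ((I • H ⊔ N').restrictScalars ℂ).comap φ.toLinearMap := by
    refine (top_span hL hdn hLZ).trans (sup_le ?_ ?_)
    · rw [Submodule.mul_le]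
      intro f hf g hg
      have hf' : φ f ∈ rowS A L := by
        have : rowS ℂ L ≤ ((rowS A L).restrictScalars ℂ).comap φ.toLinearMap := by
          rw [rowS, Submodule.span_le]
          rintro _ ⟨i, rfl⟩
          change φ (lin ℂ (L i)) ∈ rowS A L
          rw [hφlin]
          exact Submodule.subset_span ⟨i, rfl⟩
        exact this hf
      have hg' : φ g ∈ homogeneousSubmodule (Fin (n+1)) A d :=
        IsHomogeneous.map hg (algebraMap ℂ A)
      change φ (f * g) ∈ I • H ⊔ N'
      rw [map_mul]
      exact (le_sup_left.trans le_sup_right :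
        rowS A L * homogeneousSubmodule (Fin (n+1)) A d ≤ I • H ⊔ N') (Submodule.mul_mem_mul hf' hg')
    · rw [Submodule.span_le]
      rintro _ ⟨S, rfl⟩
      change φ (yS ℂ S.1) ∈ I • H ⊔ N'
      have : φ (yS ℂ S.1) = yS A S.1 := by simp [φ, yS]
      rw [this]
      exact hyS S
  have hHle : H ≤ I • H ⊔ N' := by
    refine (homog_le_span_mon _ _ _).trans ?_
    rw [Submodule.span_le]
    rintro _ ⟨b, hb, rfl⟩
    have h1 : mon (fun i => (X i : MvPolynomial (Fin (n+1)) ℂ)) b ∈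
        homogeneousSubmodule (Fin (n+1)) ℂ (d+1) := by
      have h2 : mon (fun i => (X i : MvPolynomial (Fin (n+1)) ℂ)) b = monomial b 1 := by
        rw [monomial_eq]; simp [mon]
      rw [h2]
      exact isHomogeneous_monomial _ hb
    have h3 := hcomap h1
    change φ (mon _ b) ∈ I • H ⊔ N' at h3
    have h4 : φ (mon (fun i => (X i : MvPolynomial (Fin (n+1)) ℂ)) b) =
        mon (fun i => (X i : MvPolynomial (Fin (n+1)) A)) b := by
      have := map_mon (φ : MvPolynomial (Fin (n+1)) ℂ →+* MvPolynomial (Fin (n+1)) A)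
        (fun i => (X i : MvPolynomial (Fin (n+1)) ℂ)) b
      simpa [φ] using this
    rwa [h4] at h3
  have hfg : (H.map N'.mkQ).FG := Submodule.FG.map _ (homogeneousSubmodule_fg _ _ _)
  obtain ⟨r, hr1, hr2⟩ := Submodule.exists_sub_one_mem_and_smul_eq_zero_of_fg_of_le_smul I
    (H.map N'.mkQ) hfg (by
      rw [← Submodule.map_smul'']
      refine (Submodule.map_mono hHle).trans ?_
      rw [Submodule.map_sup, Submodule.mkQ_map_self, sup_bot_eq])
  refine ⟨r, ?_, ?_⟩
  · rw [hI, RingHom.mem_ker, map_sub, map_one, sub_eq_zero] at hr1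
    exact hr1
  · intro f hf
    have := hr2 _ (Submodule.mem_map_of_mem (f := N'.mkQ) hf)
    rw [← map_smul, Submodule.mkQ_apply, Submodule.Quotient.mk_eq_zero] at this
    exact this

end reduction

/- ### Part 4: specialization and interpolation -/

section interp
open MvPolynomial

variable {d n : ℕ} {L : Matrix (Fin (d+1)) (Fin (n+1)) ℂ} {Z : Matrix (Fin (n-d)) (Fin (n+1)) ℂ}

theorem map_lin {N : ℕ} (u : Fin (n+1) → ℂ) (v : Fin N → ℂ) :
    map (eval u) (lin (MvPolynomial (Fin (n+1)) ℂ) v) = lin ℂ v := by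
  simp [lin, MvPolynomial.algebraMap_eq]

theorem map_FS (u : Fin (n+1) → ℂ) (c : Fin (n+1) → ℂ) (S : Finset (Fin n)) :
    map (eval u) (FS (MvPolynomial (Fin (n+1)) ℂ) X c S) = FS ℂ u c S := by
  simp [FS, MvPolynomial.algebraMap_eq, map_sum, map_prod]

theorem map_JJ (u : Fin (n+1) → ℂ) (c : {S : Finset (Fin n) // S.card = d+1} → Fin (n+1) → ℂ)
    (f : MvPolynomial (Fin (n+1)) (MvPolynomial (Fin (n+1)) ℂ))
    (hf : f ∈ JJ (MvPolynomial (Fin (n+1)) ℂ) X c) : map (eval u) f ∈ JJ ℂ u c := by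
  have h : JJ (MvPolynomial (Fin (n+1)) ℂ) X c ≤ (JJ ℂ u c).comap (map (eval u)) := by
    rw [JJ, Ideal.span_le]
    rintro _ ⟨S, rfl⟩
    change map (eval u) _ ∈ JJ ℂ u c
    rw [map_FS]
    exact Ideal.subset_span ⟨S, rfl⟩
  exact h hf

theorem map_rowS (u : Fin (n+1) → ℂ)
    (f : MvPolynomial (Fin (n+1)) (MvPolynomial (Fin (n+1)) ℂ))
    (hf : f ∈ rowS (MvPolynomial (Fin (n+1)) ℂ) L) : map (eval u) f ∈ rowS ℂ L := by
  induction hf using Submodule.span_induction with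
  | mem x h =>
    obtain ⟨i, rfl⟩ := h
    rw [map_lin]
    exact Submodule.subset_span ⟨i, rfl⟩
  | zero => rw [map_zero]; exact Submodule.zero_mem _
  | add x y _ _ hx hy => rw [map_add]; exact Submodule.add_mem _ hx hy
  | smul a x _ hx =>
    rw [smul_eq_C_mul, map_mul, map_C, ← smul_eq_C_mul]
    exact Submodule.smul_mem _ _ hx

theorem red_special (c : {S : Finset (Fin n) // S.card = d+1} → Fin (n+1) → ℂ)
    (D : MvPolynomial (Fin (n+1)) ℂ)
    (hD : ∀ f ∈ homogeneousSubmodule (Fin (n+1)) (MvPolynomial (Fin (n+1)) ℂ) (d+1),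
        D • f ∈ rowS (MvPolynomial (Fin (n+1)) ℂ) L *
            homogeneousSubmodule (Fin (n+1)) (MvPolynomial (Fin (n+1)) ℂ) d ⊔
          (JJ (MvPolynomial (Fin (n+1)) ℂ) X c).restrictScalars (MvPolynomial (Fin (n+1)) ℂ))
    (u : Fin (n+1) → ℂ) (hu : eval u D ≠ 0) :
    ∀ f ∈ homogeneousSubmodule (Fin (n+1)) ℂ (d+1),
      f ∈ rowS ℂ L * homogeneousSubmodule (Fin (n+1)) ℂ d ⊔ (JJ ℂ u c).restrictScalars ℂ := by
  intro f hf
  have h1 := hD (map C f) (IsHomogeneous.map hf C)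
  obtain ⟨g, hg, j, hj, hgj⟩ := Submodule.mem_sup.mp h1
  have h2 := congrArg (map (eval u)) hgj
  have h3 : map (eval u) (map C f) = f := by
    rw [map_map]
    convert map_id f
    ext x; simp
  rw [smul_eq_C_mul, map_mul, map_C, h3, ← smul_eq_C_mul, map_add] at h2
  have h4 : eval u D • f ∈
      rowS ℂ L * homogeneousSubmodule (Fin (n+1)) ℂ d ⊔ (JJ ℂ u c).restrictScalars ℂ := by
    rw [← h2]
    refine Submodule.add_mem_sup ?_ (map_JJ u c j hj)
    clear h2 hgj
    induction hg using Submodule.mul_induction_on' with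
    | mem_mul_mem x hx y hy =>
      rw [map_mul]
      exact Submodule.mul_mem_mul (map_rowS u x hx) (IsHomogeneous.map hy _)
    | add x _ y _ hx hy => rw [map_add]; exact Submodule.add_mem _ (hx) (hy)
  have h5 := Submodule.smul_mem _ (eval u D)⁻¹ h4
  rwa [smul_smul, inv_mul_cancel₀ hu, one_smul] at h5

theorem span_special
    (hLZ : Submodule.span ℂ (Set.range L) ⊔ Submodule.span ℂ (Set.range Z) = ⊤)
    (J : Ideal (MvPolynomial (Fin (n+1)) ℂ))
    (hred : ∀ f ∈ homogeneousSubmodule (Fin (n+1)) ℂ (d+1),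
      f ∈ rowS ℂ L * homogeneousSubmodule (Fin (n+1)) ℂ d ⊔ J.restrictScalars ℂ) (q : ℕ) :
    homogeneousSubmodule (Fin (n+1)) ℂ q ≤ SS ℂ L Z d q ⊔ J.restrictScalars ℂ := by
  intro f hf
  obtain ⟨k, hk⟩ := span_all ℂ hLZ d 1 J (by simpa using hred) q hf
  simpa using hk

/-- Exponents of degree at most `d`. -/
def amons (m d : ℕ) : Finset (Fin m →₀ ℕ) := (Finset.range (d+1)).biUnion (mons m)

theorem mem_amons {m d : ℕ} {a : Fin m →₀ ℕ} : a ∈ amons m d ↔ a.degree ≤ d := by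
  simp [amons, mem_mons]

theorem sum_multichoose (m d : ℕ) :
    ∑ k ∈ Finset.range (d+1), m.multichoose k = (m+1).multichoose d := by
  induction d with
  | zero => simp
  | succ d ih => rw [Finset.sum_range_succ, ih, Nat.multichoose_succ_succ, add_comm]

theorem card_amons_sum (m d : ℕ) :
    (amons m d).card = ∑ k ∈ Finset.range (d+1), m.multichoose k := by
  rw [amons, Finset.card_biUnion]
  · simp [card_mons]
  · intro i _ j _ hij
    rw [Function.onFun, Finset.disjoint_left]
    intro a ha hb
    exact hij ((mem_mons.mp ha).symm.trans (mem_mons.mp hb))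

theorem card_amons (hdn : d ≤ n) : (amons (n-d) d).card = n.choose d := by
  rw [card_amons_sum, sum_multichoose, Nat.multichoose_eq]
  congr 1; omega

theorem eval_mon {N k : ℕ} (M : Matrix (Fin k) (Fin N) ℂ) (b : Fin k →₀ ℕ) (y : Fin N → ℂ) :
    eval y (mon (fun i => lin ℂ (M i)) b) = mon (M.mulVec y) b := by
  rw [map_mon]
  congr 1
  ext i
  rw [eval_lin]; rfl

theorem SS_eval (q : ℕ) (f : MvPolynomial (Fin (n+1)) ℂ) (hf : f ∈ SS ℂ L Z d q)
    (θ : Fin (d+1) → ℂ) :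
    ∃ lam : amons (n-d) d → ℂ, ∀ y, L.mulVec y = θ →
      eval y f = ∑ a, lam a * mon (Z.mulVec y) a.1 := by
  classical
  induction hf using Submodule.span_induction with
  | mem x h =>
    obtain ⟨b, a, ha, hab, rfl⟩ := h
    refine ⟨fun a' => if a' = ⟨a, mem_amons.mpr ha⟩ then mon θ b else 0, fun y hy => ?_⟩
    rw [map_mul, eval_mon, eval_mon, hy]
    simp
  | zero => exact ⟨0, by simp⟩
  | add x y _ _ hx hy =>
    obtain ⟨l1, h1⟩ := hx
    obtain ⟨l2, h2⟩ := hy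
    refine ⟨l1 + l2, fun z hz => ?_⟩
    rw [map_add, h1 z hz, h2 z hz, ← Finset.sum_add_distrib]
    simp [add_mul]
  | smul t x _ hx =>
    obtain ⟨l1, h1⟩ := hx
    refine ⟨t • l1, fun z hz => ?_⟩
    rw [smul_eval, h1 z hz, Finset.mul_sum]
    simp [mul_assoc]

/-- Index type for the limit points. -/
abbrev FF (n d : ℕ) := {F : Finset (Fin n) // F.card = d}

theorem interp (hdn : d ≤ n)
    (hLZ : Submodule.span ℂ (Set.range L) ⊔ Submodule.span ℂ (Set.range Z) = ⊤)
    (θ : Fin (d+1) → ℂ) (y : FF n d → Fin (n+1) → ℂ) (hy : ∀ F, L.mulVec (y F) = θ)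
    (hy2 : ∀ F i, y F i ≠ 0 ↔ i ∈ zS F.1) (v : amons (n-d) d → ℂ)
    (hv : ∀ F, ∑ a, v a * mon (Z.mulVec (y F)) a.1 = 0) : v = 0 := by
  classical
  let T : (amons (n-d) d → ℂ) →ₗ[ℂ] (FF n d → ℂ) :=
    { toFun := fun v F => ∑ a, v a * mon (Z.mulVec (y F)) a.1
      map_add' := by intro v w; ext F; simp [add_mul, Finset.sum_add_distrib]
      map_smul' := by intro t w; ext F; simp [Finset.mul_sum, mul_assoc] }
  have hev : ∀ F F' : FF n d, eval (y F) (yS ℂ F'.1) ≠ 0 ↔ F' = F := by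
    intro S S'
    simp only [yS, map_prod, eval_X, Finset.prod_ne_zero_iff]
    constructor
    · intro h
      apply Subtype.ext
      refine Finset.eq_of_subset_of_card_le (fun j hj => ?_) (by rw [S.2, S'.2])
      exact (mem_zS_succ _ _).mp ((hy2 S _).mp (h j hj))
    · rintro rfl j hj
      exact (hy2 _ _).mpr ((mem_zS_succ _ _).mpr hj)
  choose lam hlam using fun F : FF n d => SS_eval (L := L) (Z := Z) d (yS ℂ F.1)
    (span_low ℂ hLZ d d le_rfl (yS_homog ℂ F.1 F.2)) θ
  have hT1 : ∀ F F' : FF n d, T (lam F') F = eval (y F) (yS ℂ F'.1) :=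
    fun F F' => (hlam F' (y F) (hy F)).symm
  have hsurj : Function.Surjective T := by
    intro w
    refine ⟨∑ F, (w F / eval (y F) (yS ℂ F.1)) • lam F, ?_⟩
    ext F
    rw [map_sum, Finset.sum_apply, Finset.sum_eq_single F]
    · rw [map_smul, Pi.smul_apply, hT1, smul_eq_mul, div_mul_cancel₀ _ ((hev F F).mpr rfl)]
    · intro F' _ hF'
      rw [map_smul, Pi.smul_apply, hT1, not_ne_iff.mp (mt (hev F F').mp hF'), smul_zero]
    · simp
  have hfr : Module.finrank ℂ (amons (n-d) d → ℂ) = Module.finrank ℂ (FF n d → ℂ) := by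
    rw [Module.finrank_fintype_fun_eq_card, Module.finrank_fintype_fun_eq_card, Fintype.card_coe,
      card_amons hdn]
    simp
  have hinj := (LinearMap.injective_iff_surjective_of_finrank_eq_finrank hfr).mpr hsurj
  apply hinj
  rw [map_zero]
  ext F
  exact hv F

/-- Points supported exactly on `{0} ∪ F`. -/
def EE (n d : ℕ) : Set (Fin (n+1) → ℂ) := {e | ∃ F : FF n d, ∀ i, e i ≠ 0 ↔ i ∈ zS F.1}

theorem free_on_EE (hL : GoodL L) (hdn : d ≤ n)
    (hLZ : Submodule.span ℂ (Set.range L) ⊔ Submodule.span ℂ (Set.range Z) = ⊤)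
    (p : amons (n-d) d → MvPolynomial (Fin (d+1)) ℂ)
    (hp : ∀ e ∈ EE n d, ∑ a, eval (L.mulVec e) (p a) * mon (Z.mulVec e) a.1 = 0) : p = 0 := by
  classical
  choose y hy1 hy2 using fun (F : FF n d) (k : Fin (d+1)) =>
    hL.solve (zS F.1) (by rw [card_zS, F.2]) (Pi.single k 1)
  -- the solution as a function of `θ`
  let Y : FF n d → (Fin (d+1) → ℂ) → Fin (n+1) → ℂ := fun F θ i => ∑ k, θ k * y F k i
  have hY1 : ∀ F θ, ∀ i ∉ zS F.1, Y F θ i = 0 := by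
    intro F θ i hi
    exact Finset.sum_eq_zero fun k _ => by rw [hy1 F k i hi, mul_zero]
  have hY2 : ∀ F θ, L.mulVec (Y F θ) = θ := by
    intro F θ
    have : Y F θ = ∑ k, θ k • y F k := by ext i; simp [Y]
    rw [this, Matrix.mulVec_sum]
    simp_rw [Matrix.mulVec_smul, hy2]
    ext i
    simp [Pi.single_apply]
  let Q : MvPolynomial (Fin (d+1)) ℂ := ∏ F : FF n d, ∏ i ∈ zS F.1, lin ℂ (fun k => y F k i)
  have hQev : ∀ θ, eval θ Q = ∏ F : FF n d, ∏ i ∈ zS F.1, Y F θ i := by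
    intro θ
    simp only [Q, map_prod, eval_lin, Y]
    refine Finset.prod_congr rfl fun F _ => Finset.prod_congr rfl fun i _ =>
      Finset.sum_congr rfl fun k _ => mul_comm _ _
  have hQ : Q ≠ 0 := by
    refine Finset.prod_ne_zero_iff.mpr fun F _ => Finset.prod_ne_zero_iff.mpr fun i hi h0 => ?_
    have h1 : Y F (L.mulVec (Pi.single i 1)) - Pi.single i 1 = 0 := by
      refine hL.ker_small hdn _ ?_ (zS F.1) (by rw [card_zS, F.2]) ?_
      · rw [Matrix.mulVec_sub, hY2, sub_self]
      · intro j hj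
        rw [Pi.sub_apply, hY1 F _ j hj, Pi.single_eq_of_ne (by rintro rfl; exact hj hi), sub_zero]
    have h2 := congrFun h1 i
    have h3 := congrArg (eval (L.mulVec (Pi.single i 1))) h0
    rw [eval_lin, map_zero] at h3
    simp only [Pi.sub_apply, Pi.single_eq_same, Pi.zero_apply, Y] at h2
    rw [Finset.sum_congr rfl fun k _ => mul_comm (y F k i) _] at h3
    rw [h3] at h2
    norm_num at h2
  ext1 a
  have key : p a * Q = 0 := by
    apply MvPolynomial.funext
    intro θ
    rw [map_mul, map_zero]
    by_cases hθ : eval θ Q = 0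
    · rw [hθ, mul_zero]
    rw [hQev] at hθ
    have hne : ∀ F : FF n d, ∀ i, Y F θ i ≠ 0 ↔ i ∈ zS F.1 := by
      intro F i
      constructor
      · intro h; by_contra hi; exact h (hY1 F θ i hi)
      · intro hi
        exact Finset.prod_ne_zero_iff.mp (Finset.prod_ne_zero_iff.mp hθ F (Finset.mem_univ _)) i hi
    have := interp hdn hLZ θ (fun F => Y F θ) (fun F => hY2 F θ) hne (fun a => eval θ (p a)) (by
      intro F
      have := hp (Y F θ) ⟨F, hne F⟩
      rwa [hY2] at this)
    have h4 := congrFun this a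
    simp only [Pi.zero_apply] at h4
    rw [h4, zero_mul]
  exact (mul_eq_zero.mp key).resolve_right hQ

end interp

/- ### Part 5: limits and freeness -/

section limits
open MvPolynomial Filter Topology

variable {d n : ℕ} {L : Matrix (Fin (d+1)) (Fin (n+1)) ℂ} {Z : Matrix (Fin (n-d)) (Fin (n+1)) ℂ}

/-- Restriction of polynomials to the scaled cone. -/
def RA (L : Matrix (Fin (d+1)) (Fin (n+1)) ℂ) (u : Fin (n+1) → ℂ) :
    MvPolynomial (Fin (n+1)) ℂ →ₐ[ℂ] (coneImage L → ℂ) :=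
  AlgHom.pi (fun v => aeval (fun i => u i * v.1 i))

theorem RA_apply (u : Fin (n+1) → ℂ) (f : MvPolynomial (Fin (n+1)) ℂ) (v : coneImage L) :
    RA L u f v = eval (fun i => u i * v.1 i) f := by
  rw [← aev]; rfl

/-- The products `θ^b ζ^a`. -/
def gg (L : Matrix (Fin (d+1)) (Fin (n+1)) ℂ) (Z : Matrix (Fin (n-d)) (Fin (n+1)) ℂ)
    (p : (Fin (d+1) →₀ ℕ) × (Fin (n-d) →₀ ℕ)) : MvPolynomial (Fin (n+1)) ℂ :=
  mon (fun i => lin ℂ (L i)) p.1 * mon (fun i => lin ℂ (Z i)) p.2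

theorem eval_monomial_mon {k : ℕ} (θ : Fin k → ℂ) (b : Fin k →₀ ℕ) (r : ℂ) :
    eval θ (monomial b r) = r * mon θ b := by
  rw [eval_monomial]; rfl

theorem vecMul_ell (X : Fin (d+1) → ℂ) (hX : X 0 ≠ 0) (i : Fin (n+1)) :
    Matrix.vecMul X L i = X 0 * ell ℂ L (fun k => X k.succ / X 0) i := by
  rw [ell, Matrix.vecMul, dotProduct, Fin.sum_univ_succ, mul_add, Finset.mul_sum]
  congr 1
  refine Finset.sum_congr rfl fun k _ => ?_
  field_simp

theorem mem_cone_of_vecMul (X : Fin (d+1) → ℂ) (hX : X 0 ≠ 0)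
    (h : ∀ i, Matrix.vecMul X L i ≠ 0) : (fun i => 1 / Matrix.vecMul X L i) ∈ coneImage L := by
  refine ⟨1 / X 0, fun k => X k.succ / X 0, ?_, ?_⟩
  · intro i hi
    apply h i
    rw [vecMul_ell X hX, hi, mul_zero]
  · ext i
    rw [vecMul_ell X hX, div_div]

/-- The degeneration of parameters. -/
def uu (n : ℕ) (t : ℂ) : Fin (n+1) → ℂ := fun i => if i = 0 then 1 else t

theorem curve (hL : GoodL L) (e : Fin (n+1) → ℂ) (he : e ∈ EE n d) :
    ∃ γ : ℂ → Fin (n+1) → ℂ, Tendsto γ (𝓝[≠] 0) (𝓝 e) ∧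
      ∀ᶠ t in 𝓝[≠] 0, ∃ v ∈ coneImage L, γ t = fun i => uu n t i * v i := by
  classical
  obtain ⟨F, hF⟩ := he
  have hcard : (zS F.1).card = d + 1 := by rw [card_zS, F.2]
  obtain ⟨X0, hX0⟩ := hL.solveT (zS F.1) hcard (fun i => if i = 0 then 1 / e 0 else 0)
  obtain ⟨X1, hX1⟩ := hL.solveT (zS F.1) hcard (fun i => if i = 0 then 0 else 1 / e i)
  have he0 : e 0 ≠ 0 := (hF 0).mpr (mem_zS_zero _)
  have hX0z : Matrix.vecMul X0 L 0 = 1 / e 0 := by simpa using hX0 0 (mem_zS_zero _)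
  have hX0ne : X0 ≠ 0 := by
    rintro rfl
    rw [Matrix.zero_vecMul] at hX0z
    exact one_div_ne_zero he0 hX0z.symm
  have hX0F : ∀ j ∈ F.1, Matrix.vecMul X0 L j.succ = 0 := by
    intro j hj
    rw [hX0 _ ((mem_zS_succ _ _).mpr hj), if_neg (Fin.succ_ne_zero j)]
  have hX00 : X0 0 ≠ 0 := by
    intro h
    refine hX0ne (hL.kerT' (F.1.map (Fin.succEmb n)) (by simpa using F.2) X0 h ?_)
    intro i hi
    obtain ⟨j, hj, rfl⟩ := Finset.mem_map.mp hi
    exact hX0F j hj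
  have hX0off : ∀ i ∉ zS F.1, Matrix.vecMul X0 L i ≠ 0 := by
    intro i hi h
    refine hX0ne (hL.kerT (insert i (F.1.map (Fin.succEmb n))) ?_ X0 ?_)
    · rw [Finset.card_insert_of_notMem, Finset.card_map, F.2]
      intro h'
      exact hi (Finset.mem_insert_of_mem h')
    · intro k hk
      rcases Finset.mem_insert.mp hk with rfl | hk
      · exact h
      · obtain ⟨j, hj, rfl⟩ := Finset.mem_map.mp hk
        exact hX0F j hj
  let Xt : ℂ → Fin (d+1) → ℂ := fun t => X0 + t • X1
  have hXt : ∀ t i, Matrix.vecMul (Xt t) L i = Matrix.vecMul X0 L i + t * Matrix.vecMul X1 L i := by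
    intro t i
    simp [Xt, Matrix.add_vecMul, Matrix.smul_vecMul]
  have hcont : ∀ i, Continuous fun t => Matrix.vecMul (Xt t) L i := by
    intro i; simp_rw [hXt]; fun_prop
  have hon : ∀ t, t ≠ 0 → ∀ i ∈ zS F.1, uu n t i / Matrix.vecMul (Xt t) L i = e i ∧
      Matrix.vecMul (Xt t) L i ≠ 0 := by
    intro t ht i hi
    have hei := (hF i).mpr hi
    rw [hXt, hX0 i hi, hX1 i hi, uu]
    by_cases h : i = 0
    · subst h; simp [he0]
    · simp only [h, if_false]
      rw [zero_add]
      refine ⟨by field_simp, mul_ne_zero ht (one_div_ne_zero hei)⟩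
  have hoff : ∀ i ∉ zS F.1, ∀ᶠ t in 𝓝[≠] (0:ℂ), Matrix.vecMul (Xt t) L i ≠ 0 := by
    intro i hi
    refine Filter.Eventually.filter_mono nhdsWithin_le_nhds ?_
    refine (hcont i).continuousAt.eventually_ne ?_
    simpa [hXt] using hX0off i hi
  have ht0 : ∀ᶠ t in 𝓝[≠] (0:ℂ), t ≠ 0 := eventually_mem_nhdsWithin
  have hX00t : ∀ᶠ t in 𝓝[≠] (0:ℂ), Xt t 0 ≠ 0 := by
    refine Filter.Eventually.filter_mono nhdsWithin_le_nhds ?_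
    have hc : Continuous fun t => Xt t 0 := by
      simp only [Xt, Pi.add_apply, Pi.smul_apply, smul_eq_mul]; fun_prop
    refine hc.continuousAt.eventually_ne ?_
    simpa [Xt] using hX00
  have hall : ∀ᶠ t in 𝓝[≠] (0:ℂ), ∀ i, Matrix.vecMul (Xt t) L i ≠ 0 := by
    rw [Filter.eventually_all]
    intro i
    by_cases hi : i ∈ zS F.1
    · filter_upwards [ht0] with t ht using (hon t ht i hi).2
    · exact hoff i hi
  refine ⟨fun t i => uu n t i / Matrix.vecMul (Xt t) L i, ?_, ?_⟩
  · rw [tendsto_pi_nhds]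
    intro i
    by_cases hi : i ∈ zS F.1
    · refine Tendsto.congr' ?_ tendsto_const_nhds
      filter_upwards [ht0] with t ht using (hon t ht i hi).1.symm
    · have hei : e i = 0 := not_ne_iff.mp (mt (hF i).mp hi)
      have hi0 : i ≠ 0 := by rintro rfl; exact hi (mem_zS_zero _)
      rw [hei]
      have : Tendsto (fun t => t / Matrix.vecMul (Xt t) L i) (𝓝[≠] 0)
          (𝓝 (0 / Matrix.vecMul (Xt 0) L i)) := by
        refine Tendsto.div (tendsto_id.mono_left nhdsWithin_le_nhds)
          (((hcont i).tendsto 0).mono_left nhdsWithin_le_nhds) ?_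
        simpa [hXt] using hX0off i hi
      simpa [uu, hi0] using this
  · filter_upwards [hX00t, hall] with t h1 h2
    exact ⟨_, mem_cone_of_vecMul (Xt t) h1 h2, by ext i; rw [mul_one_div]⟩

theorem indep_EE (hL : GoodL L) (hdn : d ≤ n)
    (hLZ : Submodule.span ℂ (Set.range L) ⊔ Submodule.span ℂ (Set.range Z) = ⊤)
    (K : Finset ((Fin (d+1) →₀ ℕ) × (Fin (n-d) →₀ ℕ))) (hK : ∀ p ∈ K, p.2.degree ≤ d)
    (α : (Fin (d+1) →₀ ℕ) × (Fin (n-d) →₀ ℕ) → ℂ)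
    (hα : ∀ e ∈ EE n d, ∑ p ∈ K, α p * eval e (gg L Z p) = 0) : ∀ p ∈ K, α p = 0 := by
  classical
  have h0 := free_on_EE hL hdn hLZ
    (fun a => ∑ p ∈ K.filter (fun p => p.2 = a.1), monomial p.1 (α p)) (by
      intro e he
      rw [← hα e he]
      rw [← Finset.sum_fiberwise_of_maps_to (t := amons (n-d) d) (g := fun p => p.2)
        (fun p hp => mem_amons.mpr (hK p hp)), ← Finset.sum_coe_sort (amons (n-d) d)]
      refine Finset.sum_congr rfl fun a _ => ?_
      rw [map_sum, Finset.sum_mul]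
      refine Finset.sum_congr rfl fun p hp => ?_
      rw [eval_monomial_mon, gg, map_mul, eval_mon, eval_mon, (Finset.mem_filter.mp hp).2, mul_assoc])
  intro p hp
  have h1 := congrArg (coeff p.1) (congrFun h0 ⟨p.2, mem_amons.mpr (hK p hp)⟩)
  simp only [coeff_sum, Pi.zero_apply, coeff_zero] at h1
  rw [Finset.sum_eq_single p] at h1
  · simpa using h1
  · intro p' hp' hne
    rw [coeff_monomial, if_neg]
    intro h
    exact hne (Prod.ext h (Finset.mem_filter.mp hp').2)
  · intro h
    exact (h (Finset.mem_filter.mpr ⟨hp, rfl⟩)).elim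

theorem exists_u0 (hL : GoodL L) (hdn : d ≤ n)
    (hLZ : Submodule.span ℂ (Set.range L) ⊔ Submodule.span ℂ (Set.range Z) = ⊤)
    (K : Finset ((Fin (d+1) →₀ ℕ) × (Fin (n-d) →₀ ℕ))) (hK : ∀ p ∈ K, p.2.degree ≤ d) :
    ∃ u : Fin (n+1) → ℂ, (∀ i, u i ≠ 0) ∧
      LinearIndependent ℂ (fun p : K => RA L u (gg L Z p.1)) := by
  classical
  let w : EE n d → K → ℂ := fun e p => eval e.1 (gg L Z p.1)
  have hspan : Submodule.span ℂ (Set.range w) = ⊤ := by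
    by_contra hne
    obtain ⟨f, hf0, hf⟩ := Submodule.exists_le_ker_of_lt_top _ (lt_top_iff_ne_top.mpr hne)
    apply hf0
    let α : (Fin (d+1) →₀ ℕ) × (Fin (n-d) →₀ ℕ) → ℂ :=
      fun p => if h : p ∈ K then f (Pi.single ⟨p, h⟩ 1) else 0
    have hα := indep_EE hL hdn hLZ K hK α (by
      intro e he
      have h1 : f (w ⟨e, he⟩) = 0 := hf (Submodule.subset_span ⟨_, rfl⟩)
      rw [LinearMap.pi_apply_eq_sum_univ] at h1
      rw [← h1, ← Finset.sum_coe_sort K]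
      refine Finset.sum_congr rfl fun p _ => ?_
      simp only [α, p.2, dif_pos, w, smul_eq_mul]
      rw [mul_comm]
      congr 2
      ext q
      simp [Pi.single_apply, eq_comm])
    apply LinearMap.pi_ext'
    intro p
    ext
    have := hα p.1 p.2
    simp only [α, p.2, dif_pos] at this
    simpa using this
  obtain ⟨b, hbs, hb1, hb2⟩ := exists_linearIndependent ℂ (Set.range w)
  rw [hspan] at hb1
  let B : Module.Basis b ℂ (K → ℂ) := Module.Basis.mk hb2 (by
    rw [Subtype.range_coe]; exact hb1.ge)
  let ε : K ≃ b := (Pi.basisFun ℂ K).indexEquiv B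
  choose pt hpt using fun x : b => hbs x.2
  let M : Matrix K K ℂ := fun j p => eval (pt (ε j)).1 (gg L Z p.1)
  have hM : M.det ≠ 0 := by
    have h1 : LinearIndependent ℂ (fun j : K => ((ε j : b) : K → ℂ)) := hb2.comp ε ε.injective
    have h2 : LinearIndependent ℂ M.row := by
      convert h1 using 1
      ext j p
      have := congrFun (hpt (ε j)) p
      exact this
    have h3 := Matrix.linearIndependent_rows_iff_isUnit.mp h2
    exact ((Matrix.isUnit_iff_isUnit_det _).mp h3).ne_zero
  choose γ hγ1 hγ2 using fun j : K => curve hL (pt (ε j)).1 (pt (ε j)).2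
  have htend : Tendsto (fun t => (Matrix.of fun j p : K => eval (γ j t) (gg L Z p.1)).det)
      (𝓝[≠] 0) (𝓝 M.det) := by
    have hcd : Continuous (fun N : Matrix K K ℂ => N.det) := continuous_id.matrix_det
    refine (hcd.tendsto M).comp ?_
    refine tendsto_pi_nhds.mpr fun j => tendsto_pi_nhds.mpr fun p => ?_
    exact ((MvPolynomial.continuous_eval (gg L Z p.1)).tendsto _).comp (hγ1 j)
  have hev : ∀ᶠ t in 𝓝[≠] (0:ℂ), (∀ j : K, ∃ v ∈ coneImage L, γ j t = fun i => uu n t i * v i) ∧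
      (Matrix.of fun j p : K => eval (γ j t) (gg L Z p.1)).det ≠ 0 ∧ t ≠ 0 := by
    refine (Filter.eventually_all.mpr hγ2).and ((htend.eventually_ne hM).and ?_)
    exact eventually_mem_nhdsWithin
  obtain ⟨t, h1, h2, h3⟩ := hev.exists
  refine ⟨uu n t, ?_, ?_⟩
  · intro i
    by_cases hi : i = 0 <;> simp [uu, hi, h3]
  · rw [Fintype.linearIndependent_iff]
    intro g hg p
    have h4 : (Matrix.of fun j p : K => eval (γ j t) (gg L Z p.1)).mulVec g = 0 := by
      ext j
      obtain ⟨v, hv, hγv⟩ := h1 j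
      have h5 := congrFun hg ⟨v, hv⟩
      simp only [Finset.sum_apply, Pi.smul_apply, RA_apply, smul_eq_mul, Pi.zero_apply] at h5
      rw [Matrix.mulVec, dotProduct, Pi.zero_apply, ← h5]
      refine Finset.sum_congr rfl fun p _ => ?_
      rw [Matrix.of_apply, hγv, mul_comm]
    exact congrFun (Matrix.eq_zero_of_mulVec_eq_zero h2 h4) p

end limits

/- ### Part 6: freeness at good parameters -/

section freeness
open MvPolynomial

variable {d n : ℕ} {L : Matrix (Fin (d+1)) (Fin (n+1)) ℂ} {Z : Matrix (Fin (n-d)) (Fin (n+1)) ℂ}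

/-- Polynomials of degree at most `q`. -/
def PL (n q : ℕ) : Submodule ℂ (MvPolynomial (Fin (n+1)) ℂ) :=
  ⨆ k : Fin (q+1), homogeneousSubmodule (Fin (n+1)) ℂ k

theorem PL_fg (n q : ℕ) : (PL n q).FG :=
  Submodule.fg_iSup _ fun _ => homogeneousSubmodule_fg _ _ _

theorem RA_scale_homog (u w : Fin (n+1) → ℂ) (hw : ∀ i, w i ≠ 0) (q : ℕ) :
    (homogeneousSubmodule (Fin (n+1)) ℂ q).map (RA L u).toLinearMap ≤
      (homogeneousSubmodule (Fin (n+1)) ℂ q).map (RA L w).toLinearMap := by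
  rintro _ ⟨f, hf, rfl⟩
  refine ⟨aeval (fun i => C (u i / w i) * X i) f, ?_, ?_⟩
  · have := IsHomogeneous.aeval (m := q) hf
      (fun i => (C (u i / w i) * X i : MvPolynomial (Fin (n+1)) ℂ))
      (n := 1) (fun i => isHomogeneous_C_mul_X _ _)
    rw [one_mul] at this
    exact this
  · ext v
    simp only [AlgHom.toLinearMap_apply, RA_apply]
    rw [← aev, ← aev, ← AlgHom.comp_apply]
    congr 1
    ext i
    simp only [AlgHom.comp_apply, aeval_X, map_mul, aeval_C, Algebra.algebraMap_self, RingHom.id_apply]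
    have := hw i
    field_simp

theorem RA_scale (u w : Fin (n+1) → ℂ) (hw : ∀ i, w i ≠ 0) (q : ℕ) :
    (PL n q).map (RA L u).toLinearMap ≤ (PL n q).map (RA L w).toLinearMap := by
  rw [PL, Submodule.map_iSup, Submodule.map_iSup]
  exact iSup_mono fun k => RA_scale_homog u w hw k

theorem sum_circuit (x : Fin d → ℂ) (c : Fin (n+1) → ℂ) (hc : L.mulVec c = 0) :
    ∑ i, c i * ell ℂ L x i = 0 := by
  have h : ∀ k, ∑ i, L k i * c i = 0 := fun k => congrFun hc k
  simp only [ell, mul_add, Finset.mul_sum, Finset.sum_add_distrib]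
  rw [Finset.sum_comm]
  have h1 : ∑ i, c i * L 0 i = 0 := by simpa [mul_comm] using h 0
  rw [h1, zero_add]
  refine Finset.sum_eq_zero fun k _ => ?_
  have h2 : ∑ i, c i * (x k * L k.succ i) = x k * ∑ i, L k.succ i * c i := by
    rw [Finset.mul_sum]; exact Finset.sum_congr rfl fun i _ => by ring
  rw [h2, h, mul_zero]

theorem eval_FS (u c y : Fin (n+1) → ℂ) (S : Finset (Fin n)) :
    eval y (FS ℂ u c S) = ∑ i ∈ zS S, c i * u i * ∏ j ∈ (zS S).erase i, y j := by
  simp [FS, map_sum, map_prod]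

/-- Evaluation of the relations at points whose coordinatewise reciprocals are `w`. -/
theorem eval_FS_recip (u c y w : Fin (n+1) → ℂ) (S : Finset (Fin n))
    (hyw : ∀ i ∈ zS S, u i = w i * y i) :
    eval y (FS ℂ u c S) = (∑ i ∈ zS S, c i * w i) * ∏ j ∈ zS S, y j := by
  rw [eval_FS, Finset.sum_mul]
  refine Finset.sum_congr rfl fun i hi => ?_
  rw [hyw i hi, ← Finset.mul_prod_erase _ _ hi]
  ring

theorem JJ_le_ker (u : Fin (n+1) → ℂ)
    (c : {S : Finset (Fin n) // S.card = d+1} → Fin (n+1) → ℂ)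
    (hc1 : ∀ S, L.mulVec (c S) = 0) (hc2 : ∀ S i, c S i ≠ 0 ↔ i ∈ zS S.1) :
    JJ ℂ u c ≤ RingHom.ker (RA L u) := by
  rw [JJ, Ideal.span_le]
  rintro _ ⟨S, rfl⟩
  rw [SetLike.mem_coe, RingHom.mem_ker]
  ext v
  obtain ⟨v, t, x, hx, rfl⟩ := v
  rw [RA_apply, Pi.zero_apply]
  by_cases ht : t = 0
  · subst ht
    rw [eval_FS]
    refine Finset.sum_eq_zero fun i hi => ?_
    have : ((zS S.1).erase i).Nonempty := by
      rw [← Finset.card_pos, Finset.card_erase_of_mem hi, card_zS, S.2]; omega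
    obtain ⟨j, hj⟩ := this
    rw [Finset.prod_eq_zero hj (by simp), mul_zero]
  · rw [eval_FS_recip u (c S) _ (fun i => ell ℂ L x i / t) S.1]
    · have h1 : ∑ i ∈ zS S.1, c S i * (ell ℂ L x i / t) = ∑ i, c S i * (ell ℂ L x i / t) := by
        refine Finset.sum_subset (Finset.subset_univ _) fun i _ hi => ?_
        rw [not_ne_iff.mp (mt (hc2 S i).mp hi), zero_mul]
      have h2 : ∑ i, c S i * (ell ℂ L x i / t) = (∑ i, c S i * ell ℂ L x i) / t := by
        rw [Finset.sum_div]; exact Finset.sum_congr rfl fun i _ => by ring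
      rw [h1, h2, sum_circuit x _ (hc1 S), zero_div, zero_mul]
    · intro i _
      have := hx i
      field_simp

/-- Index set for the basis in degree at most `q`. -/
def KK (n d q : ℕ) : Finset ((Fin (d+1) →₀ ℕ) × (Fin (n-d) →₀ ℕ)) :=
  (amons (d+1) q ×ˢ amons (n-d) d).filter fun p => p.2.degree + p.1.degree ≤ q

theorem mem_KK {q : ℕ} {p : (Fin (d+1) →₀ ℕ) × (Fin (n-d) →₀ ℕ)} :
    p ∈ KK n d q ↔ p.2.degree ≤ d ∧ p.2.degree + p.1.degree ≤ q := by
  simp only [KK, Finset.mem_filter, Finset.mem_product, mem_amons]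
  constructor
  · rintro ⟨⟨-, h⟩, h'⟩; exact ⟨h, h'⟩
  · rintro ⟨h, h'⟩; exact ⟨⟨by omega, h⟩, h'⟩

theorem gg_homog (p : (Fin (d+1) →₀ ℕ) × (Fin (n-d) →₀ ℕ)) :
    gg L Z p ∈ homogeneousSubmodule (Fin (n+1)) ℂ (p.2.degree + p.1.degree) := by
  have h : ∀ {k : ℕ} (M : Matrix (Fin k) (Fin (n+1)) ℂ) (b : Fin k →₀ ℕ),
      (mon (fun i => lin ℂ (M i)) b).IsHomogeneous b.degree := by
    intro k M b
    rw [mon, Finsupp.prod]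
    have := IsHomogeneous.prod b.support (fun i => lin ℂ (M i) ^ b i) (fun i => b i) (fun i _ => by
      have := (show (lin ℂ (M i)).IsHomogeneous 1 from lin_homog ℂ (M i)).pow (b i)
      rwa [one_mul] at this)
    exact this
  rw [add_comm p.2.degree]
  exact (h L p.1).mul (h Z p.2)

theorem indep_KK (hL : GoodL L) (hdn : d ≤ n)
    (hLZ : Submodule.span ℂ (Set.range L) ⊔ Submodule.span ℂ (Set.range Z) = ⊤)
    (u : Fin (n+1) → ℂ) (hu : ∀ i, u i ≠ 0) (J : Ideal (MvPolynomial (Fin (n+1)) ℂ))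
    (hJ : J ≤ RingHom.ker (RA L u))
    (hsp : ∀ q, homogeneousSubmodule (Fin (n+1)) ℂ q ≤ SS ℂ L Z d q ⊔ J.restrictScalars ℂ)
    (q : ℕ) : LinearIndependent ℂ (fun p : KK n d q => RA L u (gg L Z p.1)) := by
  rw [linearIndependent_iff_card_le_finrank_span]
  obtain ⟨u0, hu0, hli⟩ := exists_u0 hL hdn hLZ (KK n d q) (fun p hp => (mem_KK.mp hp).1)
  have h1 : Submodule.span ℂ (Set.range fun p : KK n d q => RA L u0 (gg L Z p.1)) ≤
      (PL n q).map (RA L u).toLinearMap := by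
    refine le_trans ?_ (RA_scale u0 u hu q)
    rw [Submodule.span_le]
    rintro _ ⟨p, rfl⟩
    refine Submodule.mem_map_of_mem (f := (RA L u0).toLinearMap) ?_
    have hp := (mem_KK.mp p.2).2
    exact (le_iSup (fun k : Fin (q+1) => homogeneousSubmodule (Fin (n+1)) ℂ (k : ℕ))
      ⟨_, Nat.lt_succ_of_le hp⟩) (gg_homog p.1)
  have h2 : (PL n q).map (RA L u).toLinearMap ≤
      Submodule.span ℂ (Set.range fun p : KK n d q => RA L u (gg L Z p.1)) := by
    rw [PL, Submodule.map_iSup]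
    refine iSup_le fun k => ?_
    rw [Submodule.map_le_iff_le_comap]
    refine (hsp k).trans (sup_le ?_ ?_)
    · rw [SS, Submodule.span_le]
      rintro _ ⟨b, a, ha, hab, rfl⟩
      exact Submodule.subset_span ⟨⟨(b, a), mem_KK.mpr ⟨ha, by have := k.2; change a.degree + b.degree ≤ q; omega⟩⟩, rfl⟩
    · intro f hf
      have : RA L u f = 0 := hJ hf
      rw [Submodule.mem_comap, AlgHom.toLinearMap_apply, this]
      exact Submodule.zero_mem _
  rw [← finrank_span_eq_card hli]
  have hfin : Module.Finite ℂ (Submodule.span ℂ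
    (Set.range fun p : KK n d q => RA L u (gg L Z p.1))) :=
    FiniteDimensional.span_of_finite ℂ (Set.finite_range _)
  exact Submodule.finrank_mono (h1.trans h2)

theorem indep_any (hL : GoodL L) (hdn : d ≤ n)
    (hLZ : Submodule.span ℂ (Set.range L) ⊔ Submodule.span ℂ (Set.range Z) = ⊤)
    (u : Fin (n+1) → ℂ) (hu : ∀ i, u i ≠ 0) (J : Ideal (MvPolynomial (Fin (n+1)) ℂ))
    (hJ : J ≤ RingHom.ker (RA L u))
    (hsp : ∀ q, homogeneousSubmodule (Fin (n+1)) ℂ q ≤ SS ℂ L Z d q ⊔ J.restrictScalars ℂ)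
    (K : Finset ((Fin (d+1) →₀ ℕ) × (Fin (n-d) →₀ ℕ))) (hK : ∀ p ∈ K, p.2.degree ≤ d) :
    LinearIndependent ℂ (fun p : K => RA L u (gg L Z p.1)) := by
  have hsub : K ⊆ KK n d (K.sup fun p => p.2.degree + p.1.degree) := by
    intro p hp
    exact mem_KK.mpr ⟨hK p hp, Finset.le_sup (f := fun p => p.2.degree + p.1.degree) hp⟩
  have := indep_KK hL hdn hLZ u hu J hJ hsp (K.sup fun p => p.2.degree + p.1.degree)
  exact this.comp (fun p : K => ⟨p.1, hsub p.2⟩) (fun p q h => Subtype.ext (congrArg (fun z => z.1) h))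

theorem free_good (hL : GoodL L) (hdn : d ≤ n)
    (hLZ : Submodule.span ℂ (Set.range L) ⊔ Submodule.span ℂ (Set.range Z) = ⊤)
    (u : Fin (n+1) → ℂ) (hu : ∀ i, u i ≠ 0) (J : Ideal (MvPolynomial (Fin (n+1)) ℂ))
    (hJ : J ≤ RingHom.ker (RA L u))
    (hsp : ∀ q, homogeneousSubmodule (Fin (n+1)) ℂ q ≤ SS ℂ L Z d q ⊔ J.restrictScalars ℂ)
    (p : amons (n-d) d → MvPolynomial (Fin (d+1)) ℂ)
    (hp : ∑ a, aeval (fun k => lin ℂ (L k)) (p a) * mon (fun i => lin ℂ (Z i)) a.1 ∈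
      RingHom.ker (RA L u)) : p = 0 := by
  classical
  let E : Finset (Fin (d+1) →₀ ℕ) := Finset.univ.biUnion fun a => (p a).support
  have hE : ∀ a, aeval (fun k => lin ℂ (L k)) (p a) =
      ∑ b ∈ E, coeff b (p a) • mon (fun k => lin ℂ (L k)) b := by
    intro a
    rw [aeval_def, eval₂_eq]
    have : (p a).support ⊆ E := Finset.subset_biUnion_of_mem (fun a => (p a).support)
      (Finset.mem_univ a)
    rw [Finset.sum_subset this (fun b _ hb => by
      rw [notMem_support_iff.mp hb, map_zero, zero_mul])]
    refine Finset.sum_congr rfl fun b _ => ?_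
    rw [Algebra.smul_def]; rfl
  have hli := indep_any hL hdn hLZ u hu J hJ hsp (E ×ˢ amons (n-d) d)
    (fun q hq => mem_amons.mp (Finset.mem_product.mp hq).2)
  rw [Fintype.linearIndependent_iff] at hli
  have h0 := hli (fun q => coeff q.1.1 (p ⟨q.1.2, (Finset.mem_product.mp q.2).2⟩)) (by
    rw [RingHom.mem_ker] at hp
    rw [← hp]
    simp_rw [hE, Finset.sum_mul, ← map_smul, ← map_sum]
    congr 1
    rw [Finset.sum_comm]
    let G : (Fin (d+1) →₀ ℕ) × (Fin (n-d) →₀ ℕ) → MvPolynomial (Fin (n+1)) ℂ := fun q =>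
      if h : q.2 ∈ amons (n-d) d then coeff q.1 (p ⟨q.2, h⟩) • gg L Z q else 0
    have h1 : ∀ q : (E ×ˢ amons (n-d) d : Finset _),
        coeff q.1.1 (p ⟨q.1.2, (Finset.mem_product.mp q.2).2⟩) • gg L Z q.1 = G q.1 := by
      intro q
      simp only [G, (Finset.mem_product.mp q.2).2, dif_pos]
    simp_rw [h1]
    rw [Finset.sum_coe_sort (E ×ˢ amons (n-d) d) G, Finset.sum_product]
    refine Finset.sum_congr rfl fun b _ => ?_
    rw [← Finset.sum_coe_sort (amons (n-d) d)]
    refine Finset.sum_congr rfl fun a _ => ?_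
    simp only [G, a.2, dif_pos, gg, smul_mul_assoc])
  ext a b
  rw [Pi.zero_apply, coeff_zero]
  by_contra hne
  refine hne (h0 ⟨(b, a.1), Finset.mem_product.mpr ⟨?_, a.2⟩⟩)
  exact Finset.mem_biUnion.mpr ⟨a, Finset.mem_univ _, mem_support_iff.mpr hne⟩

end freeness

/- ### Part 7: the Hilbert polynomial -/

section hilbert
open MvPolynomial

variable {d n : ℕ} {L : Matrix (Fin (d+1)) (Fin (n+1)) ℂ} {Z : Matrix (Fin (n-d)) (Fin (n+1)) ℂ}

theorem finrank_map_eq_of_ker {V W W' : Type} [AddCommGroup V] [Module ℂ V] [AddCommGroup W]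
    [Module ℂ W] [AddCommGroup W'] [Module ℂ W'] (f : V →ₗ[ℂ] W) (g : V →ₗ[ℂ] W')
    (h : ∀ x, f x = 0 ↔ g x = 0) (H : Submodule ℂ V) (hH : H.FG) :
    Module.finrank ℂ (H.map f) = Module.finrank ℂ (H.map g) := by
  have : Module.Finite ℂ H := Module.Finite.iff_fg.mpr hH
  have h1 := (f.domRestrict H).finrank_range_add_finrank_ker
  have h2 := (g.domRestrict H).finrank_range_add_finrank_ker
  have h3 : LinearMap.ker (f.domRestrict H) = LinearMap.ker (g.domRestrict H) := by
    ext x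
    simp only [LinearMap.mem_ker, LinearMap.domRestrict_apply]
    exact h x.1
  rw [LinearMap.range_domRestrict] at h1 h2
  rw [h3] at h1
  omega

/-- Index set for the basis in degree exactly `q` (for `q ≥ d`). -/
def KE (n d q : ℕ) : Finset ((Fin (d+1) →₀ ℕ) × (Fin (n-d) →₀ ℕ)) :=
  (Finset.range (d+1)).biUnion fun k => mons (d+1) (q-k) ×ˢ mons (n-d) k

theorem mem_KE {q : ℕ} (hq : d ≤ q) {p : (Fin (d+1) →₀ ℕ) × (Fin (n-d) →₀ ℕ)} :
    p ∈ KE n d q ↔ p.2.degree ≤ d ∧ p.2.degree + p.1.degree = q := by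
  simp only [KE, Finset.mem_biUnion, Finset.mem_range, Finset.mem_product, mem_mons]
  constructor
  · rintro ⟨k, hk, h1, h2⟩; omega
  · rintro ⟨h1, h2⟩; exact ⟨p.2.degree, by omega, by omega, rfl⟩

theorem card_KE (q : ℕ) : (KE n d q).card =
    ∑ k ∈ Finset.range (d+1), (n-d).multichoose k * (q - k + d).choose d := by
  rw [KE, Finset.card_biUnion]
  · refine Finset.sum_congr rfl fun k _ => ?_
    rw [Finset.card_product, card_mons, card_mons, mul_comm]
    congr 1
    rw [Nat.multichoose_eq, show d + 1 + (q - k) - 1 = q - k + d by omega, ← Nat.choose_symm_add]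
  · intro i _ j _ hij
    rw [Function.onFun, Finset.disjoint_left]
    intro a ha hb
    exact hij ((mem_mons.mp (Finset.mem_product.mp ha).2).symm.trans
      (mem_mons.mp (Finset.mem_product.mp hb).2))

theorem projDegree_of_good (hL : GoodL L) (hdn : d ≤ n)
    (hLZ : Submodule.span ℂ (Set.range L) ⊔ Submodule.span ℂ (Set.range Z) = ⊤)
    (u : Fin (n+1) → ℂ) (hu : ∀ i, u i ≠ 0) (J : Ideal (MvPolynomial (Fin (n+1)) ℂ))
    (hJ : J ≤ RingHom.ker (RA L u))
    (hsp : ∀ q, homogeneousSubmodule (Fin (n+1)) ℂ q ≤ SS ℂ L Z d q ⊔ J.restrictScalars ℂ) :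
    IsProjDegree ℂ (vanishingIdeal ℂ (coneImage L)) d (n.choose d) := by
  have hilb_eq : ∀ q, d ≤ q → hilb ℂ (vanishingIdeal ℂ (coneImage L)) q = (KE n d q).card := by
    intro q hq
    have h1 : hilb ℂ (vanishingIdeal ℂ (coneImage L)) q = Module.finrank ℂ
        ((homogeneousSubmodule (Fin (n+1)) ℂ q).map (RA L (fun _ => 1)).toLinearMap) := by
      refine finrank_map_eq_of_ker _ _ ?_ _ (homogeneousSubmodule_fg _ _ _)
      intro f
      simp only [AlgHom.toLinearMap_apply, Ideal.Quotient.mkₐ_eq_mk, Ideal.Quotient.eq_zero_iff_mem]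
      constructor
      · intro h
        ext v
        rw [RA_apply]
        simpa using h v.1 v.2
      · intro h v hv
        have := congrFun h ⟨v, hv⟩
        rw [RA_apply] at this
        simpa using this
    have h2 : (homogeneousSubmodule (Fin (n+1)) ℂ q).map (RA L (fun _ => 1)).toLinearMap =
        Submodule.span ℂ (Set.range fun p : KE n d q => RA L u (gg L Z p.1)) := by
      refine le_antisymm ((RA_scale_homog _ u hu q).trans ?_)
        (le_trans ?_ (RA_scale_homog u _ (fun _ => one_ne_zero) q))
      · rw [Submodule.map_le_iff_le_comap]
        refine (hsp q).trans (sup_le ?_ ?_)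
        · rw [SS, Submodule.span_le]
          rintro _ ⟨b, a, ha, hab, rfl⟩
          exact Submodule.subset_span ⟨⟨(b, a), (mem_KE hq).mpr ⟨ha, hab⟩⟩, rfl⟩
        · intro f hf
          have : RA L u f = 0 := hJ hf
          rw [Submodule.mem_comap, AlgHom.toLinearMap_apply, this]
          exact Submodule.zero_mem _
      · rw [Submodule.span_le]
        rintro _ ⟨p, rfl⟩
        refine Submodule.mem_map_of_mem (f := (RA L u).toLinearMap) ?_
        have := gg_homog (L := L) (Z := Z) p.1
        rwa [((mem_KE hq).mp p.2).2] at this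
    rw [h1, h2, finrank_span_eq_card
      (indep_any hL hdn hLZ u hu J hJ hsp _ (fun p hp => ((mem_KE hq).mp hp).1)), Fintype.card_coe]
  let P : Polynomial ℚ := ∑ k ∈ Finset.range (d+1),
    ((n-d).multichoose k : ℚ) • Polynomial.preHilbertPoly ℚ d k
  have hcoeff : P.coeff d = (n.choose d : ℚ) / (Nat.factorial d : ℚ) := by
    simp only [P, Polynomial.finsetSum_coeff, Polynomial.coeff_smul,
      Polynomial.coeff_preHilbertPoly_self, smul_eq_mul]
    rw [← Finset.sum_mul, div_eq_mul_inv]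
    congr 1
    rw [← card_amons hdn, card_amons_sum]
    push_cast
    rfl
  have hne : P.coeff d ≠ 0 := by
    rw [hcoeff]
    have h1 : (n.choose d : ℚ) ≠ 0 := by exact_mod_cast (Nat.choose_pos hdn).ne'
    have h2 : (Nat.factorial d : ℚ) ≠ 0 := by exact_mod_cast d.factorial_ne_zero
    exact div_ne_zero h1 h2
  have hdeg : P.natDegree = d := by
    refine le_antisymm ?_ (Polynomial.le_natDegree_of_ne_zero hne)
    refine Polynomial.natDegree_sum_le_of_forall_le _ _ fun k _ => ?_
    exact (Polynomial.natDegree_smul_le _ _).trans (Polynomial.natDegree_preHilbertPoly ℚ d k).le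
  refine ⟨P, ⟨d, fun q hq => ?_⟩, ?_, ?_⟩
  · rw [hilb_eq q hq, card_KE]
    simp only [P, Polynomial.eval_finsetSum, Polynomial.eval_smul, smul_eq_mul]
    push_cast
    refine Finset.sum_congr rfl fun k hk => ?_
    rw [Polynomial.preHilbertPoly_eq_choose_sub_add]
    have := Finset.mem_range.mp hk
    omega
  · rw [Polynomial.degree_eq_natDegree (by intro h; rw [h] at hne; simp at hne), hdeg]
  · rw [Polynomial.leadingCoeff, hdeg, hcoeff]

end hilbert


/-! ### Part 8: counting -/
section Part8
open MvPolynomial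

variable {d n : ℕ} {L : Matrix (Fin (d+1)) (Fin (n+1)) ℂ} {Z : Matrix (Fin (n-d)) (Fin (n+1)) ℂ}

theorem mem_of_homog {N : ℕ} {A : Type} [CommRing A] (W : Submodule A (MvPolynomial (Fin N) A))
    (h : ∀ q, homogeneousSubmodule (Fin N) A q ≤ W) (f : MvPolynomial (Fin N) A) : f ∈ W := by
  rw [← sum_homogeneousComponent f]
  exact Submodule.sum_mem _ fun q _ => h q (homogeneousComponent_mem q f)

theorem mon_sub_mem {R : Type} [CommRing R] (I : Ideal R) {k : ℕ} (v w : Fin k → R)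
    (h : ∀ i, v i - w i ∈ I) (b : Fin k →₀ ℕ) : mon v b - mon w b ∈ I := by
  rw [← Ideal.Quotient.eq, map_mon, map_mon]
  congr 1
  ext i
  exact Ideal.Quotient.eq.mpr (h i)

/-- The affine-linear slice. -/
def Jp (A : Type) [CommRing A] [Algebra ℂ A] (L : Matrix (Fin (d+1)) (Fin (n+1)) ℂ)
    (s : Fin (d+1) → A) : Ideal (MvPolynomial (Fin (n+1)) A) :=
  Ideal.span (Set.range fun k => lin A (L k) - C (s k))

/-- The span of the `ζ^a`. -/
def zspan (A : Type) [CommRing A] [Algebra ℂ A] (d : ℕ) (Z : Matrix (Fin (n-d)) (Fin (n+1)) ℂ) :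
    Submodule A (MvPolynomial (Fin (n+1)) A) :=
  Submodule.span A (Set.range fun a : amons (n-d) d => mon (fun i => lin A (Z i)) a.1)

theorem SS_le_zspan (A : Type) [CommRing A] [Algebra ℂ A] (s : Fin (d+1) → A) (q : ℕ) :
    SS A L Z d q ≤ zspan A d Z ⊔ (Jp A L s).restrictScalars A := by
  rw [SS, Submodule.span_le]
  rintro _ ⟨b, a, ha, -, rfl⟩
  have h1 : mon (fun i => lin A (L i)) b - C (mon s b) ∈ Jp A L s := by
    rw [map_mon]
    have hg : ∀ i, lin A (L i) - C (s i) ∈ Jp A L s := fun i => Ideal.subset_span ⟨i, rfl⟩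
    exact mon_sub_mem _ _ _ hg b
  have h2 : mon (fun i => lin A (L i)) b * mon (fun i => lin A (Z i)) a =
      mon s b • mon (fun i => lin A (Z i)) a +
      mon (fun i => lin A (Z i)) a * (mon (fun i => lin A (L i)) b - C (mon s b)) := by
    rw [smul_eq_C_mul]; ring
  rw [h2]
  have h3 : mon (fun i => lin A (Z i)) a ∈ zspan A d Z :=
    Submodule.subset_span ⟨(⟨a, mem_amons.mpr ha⟩ : amons (n-d) d), rfl⟩
  refine Submodule.add_mem_sup (Submodule.smul_mem _ _ h3) ?_
  exact Ideal.mul_mem_left _ _ h1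

theorem Sat_mono {A M : Type} [CommRing A] [AddCommGroup M] [Module A M] (D : A)
    {W W' : Submodule A M} (h : W ≤ W') : Sat D W ≤ Sat D W' := by
  rintro f ⟨k, hk⟩
  exact ⟨k, h hk⟩

theorem SSJ_le {A : Type} [CommRing A] [Algebra ℂ A] (s : Fin (d+1) → A)
    (J : Ideal (MvPolynomial (Fin (n+1)) A)) (q : ℕ) :
    SS A L Z d q ⊔ J.restrictScalars A ≤ zspan A d Z ⊔ (J ⊔ Jp A L s).restrictScalars A := by
  refine sup_le ((SS_le_zspan A s q).trans (sup_le_sup le_rfl ?_)) (le_sup_of_le_right ?_)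
  · exact fun x hx => (le_sup_right : Jp A L s ≤ _) hx
  · exact fun x hx => (le_sup_left : J ≤ _) hx

/-- Extracting coefficients. -/
theorem exists_coef {A : Type} [CommRing A] [Algebra ℂ A]
    (I : Ideal (MvPolynomial (Fin (n+1)) A)) (f : MvPolynomial (Fin (n+1)) A)
    (hf : f ∈ zspan A d Z ⊔ I.restrictScalars A) :
    ∃ v : amons (n-d) d → A, f - ∑ a, v a • mon (fun i => lin A (Z i)) a.1 ∈ I := by
  obtain ⟨x, hx, y, hy, rfl⟩ := Submodule.mem_sup.mp hf
  obtain ⟨v, rfl⟩ := (Submodule.mem_span_range_iff_exists_fun A).mp hx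
  exact ⟨v, by simpa using hy⟩

theorem exists_coef_theta (I : Ideal (MvPolynomial (Fin (n+1)) ℂ))
    (hsp : ∀ q, homogeneousSubmodule (Fin (n+1)) ℂ q ≤ SS ℂ L Z d q ⊔ I.restrictScalars ℂ)
    (f : MvPolynomial (Fin (n+1)) ℂ) :
    ∃ p : amons (n-d) d → MvPolynomial (Fin (d+1)) ℂ,
      f - ∑ a, aeval (fun k => lin ℂ (L k)) (p a) * mon (fun i => lin ℂ (Z i)) a.1 ∈ I := by
  classical
  let W : Submodule ℂ (MvPolynomial (Fin (n+1)) ℂ) :=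
    { carrier := {f | ∃ p : amons (n-d) d → MvPolynomial (Fin (d+1)) ℂ,
        f - ∑ a, aeval (fun k => lin ℂ (L k)) (p a) * mon (fun i => lin ℂ (Z i)) a.1 ∈ I}
      zero_mem' := ⟨0, by simp⟩
      add_mem' := by
        rintro f g ⟨p, hp⟩ ⟨p', hp'⟩
        refine ⟨p + p', ?_⟩
        have := I.add_mem hp hp'
        convert this using 1
        simp only [Pi.add_apply, map_add, add_mul, Finset.sum_add_distrib]
        ring
      smul_mem' := by
        rintro c f ⟨p, hp⟩
        refine ⟨c • p, ?_⟩
        have := I.mul_mem_left (C c) hp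
        convert this using 1
        rw [mul_sub, Finset.mul_sum, smul_eq_C_mul]
        congr 1
        refine Finset.sum_congr rfl fun a _ => ?_
        rw [Pi.smul_apply, map_smul, smul_eq_C_mul, mul_assoc] }
  refine mem_of_homog W (fun q => (hsp q).trans (sup_le ?_ ?_)) f
  · rw [SS, Submodule.span_le]
    rintro _ ⟨b, a, ha, -, rfl⟩
    refine ⟨Pi.single ⟨a, mem_amons.mpr ha⟩ (mon X b), ?_⟩
    rw [Finset.sum_eq_single ⟨a, mem_amons.mpr ha⟩]
    · have : aeval (fun k => lin ℂ (L k)) (mon X b : MvPolynomial (Fin (d+1)) ℂ) =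
          mon (fun k => lin ℂ (L k)) b := by
        have := map_mon (aeval (fun k => lin ℂ (L k)) : MvPolynomial (Fin (d+1)) ℂ →ₐ[ℂ] _).toRingHom X b
        simpa using this
      rw [Pi.single_eq_same, this, sub_self]
      exact I.zero_mem
    · intro a' _ h
      simp [h]
    · simp
  · intro x hx
    exact ⟨0, by simpa using hx⟩

theorem slice_alg {R P τ κ : Type} [CommRing R] [CommRing P] [Fintype τ] [Fintype κ]
    (φ : P →+* R) (I : Ideal R) (V : τ → P) (z : τ → R) (e : κ → P) (g : κ → R) (p : κ → τ → P)
    (x : R) (hx : x ∈ I) (hp : ∀ k, g k - ∑ a, φ (p k a) * z a ∈ I)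
    (hv : ∑ a, φ (V a) * z a = x + ∑ k, g k * φ (e k)) :
    ∑ a, φ (V a - ∑ k, e k * p k a) * z a ∈ I := by
  have h : ∑ a, φ (V a - ∑ k, e k * p k a) * z a =
      x + ∑ k, φ (e k) * (g k - ∑ a, φ (p k a) * z a) := by
    have h1 : ∀ a, φ (V a - ∑ k, e k * p k a) * z a =
        φ (V a) * z a - ∑ k, φ (e k) * (φ (p k a) * z a) := by
      intro a
      rw [map_sub, sub_mul, map_sum, Finset.sum_mul]
      simp only [map_mul, mul_assoc]
    simp only [h1, mul_sub, Finset.sum_sub_distrib, Finset.mul_sum, hv]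
    rw [Finset.sum_comm, add_sub_assoc]
    simp only [mul_comm]
  rw [h]
  exact I.add_mem hx (I.sum_mem fun k _ => I.mul_mem_left _ (hp k))

theorem indep_slice (hL : GoodL L) (hdn : d ≤ n)
    (hLZ : Submodule.span ℂ (Set.range L) ⊔ Submodule.span ℂ (Set.range Z) = ⊤)
    (u : Fin (n+1) → ℂ) (hu : ∀ i, u i ≠ 0) (J : Ideal (MvPolynomial (Fin (n+1)) ℂ))
    (hJ : J ≤ RingHom.ker (RA L u))
    (hsp : ∀ q, homogeneousSubmodule (Fin (n+1)) ℂ q ≤ SS ℂ L Z d q ⊔ J.restrictScalars ℂ)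
    (s : Fin (d+1) → ℂ) (v : amons (n-d) d → ℂ)
    (hv : ∑ a, v a • mon (fun i => lin ℂ (Z i)) a.1 ∈ RingHom.ker (RA L u) ⊔ Jp ℂ L s) : v = 0 := by
  obtain ⟨x, hx, y, hy, hxy⟩ := Submodule.mem_sup.mp hv
  obtain ⟨g, rfl⟩ := (Submodule.mem_span_range_iff_exists_fun _).mp hy
  choose p hp using fun k => exists_coef_theta J hsp (g k)
  have hv2 : ∑ a : amons (n-d) d, (aeval (fun k => lin ℂ (L k)) :
        MvPolynomial (Fin (d+1)) ℂ →ₐ[ℂ] _).toRingHom (C (v a)) * mon (fun i => lin ℂ (Z i)) a.1 =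
      x + ∑ k, g k * (aeval (fun k => lin ℂ (L k)) :
        MvPolynomial (Fin (d+1)) ℂ →ₐ[ℂ] _).toRingHom (X k - C (s k)) := by
    have h1 : ∀ r : ℂ, (aeval (fun k => lin ℂ (L k)) :
        MvPolynomial (Fin (d+1)) ℂ →ₐ[ℂ] MvPolynomial (Fin (n+1)) ℂ).toRingHom (C r) = C r := by
      intro r
      exact (aeval (fun k => lin ℂ (L k))).commutes r
    have h2 : ∀ k, (aeval (fun k => lin ℂ (L k)) :
        MvPolynomial (Fin (d+1)) ℂ →ₐ[ℂ] MvPolynomial (Fin (n+1)) ℂ).toRingHom (X k) =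
          lin ℂ (L k) := by
      intro k
      exact aeval_X _ k
    have h3 : ∀ a : amons (n-d) d, C (v a) * mon (fun i => lin ℂ (Z i)) a.1 =
        v a • mon (fun i => lin ℂ (Z i)) a.1 := fun a => (smul_eq_C_mul _ _).symm
    simp only [h1, map_sub, h2, h3]
    exact hxy.symm
  have key := free_good hL hdn hLZ u hu J hJ hsp
    (fun a => C (v a) - ∑ k, (X k - C (s k)) * p k a)
    (slice_alg _ _ _ _ _ g p x hx (fun k => hJ (hp k)) hv2)
  ext a
  have := congrArg (eval s) (congrFun key a)
  simpa [map_sum] using this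

end Part8


/-! ### Part 9: counting zeros of an ideal with a known basis -/
section Part9
open MvPolynomial

/-- Zeros of an ideal. -/
def ZZ {N : ℕ} (I : Ideal (MvPolynomial (Fin N) ℂ)) : Set (Fin N → ℂ) := {y | ∀ f ∈ I, eval y f = 0}

theorem exists_zero {N : ℕ} (I : Ideal (MvPolynomial (Fin N) ℂ)) (hI : I ≠ ⊤) :
    ∃ y, y ∈ ZZ I := by
  by_contra h
  push Not at h
  have h1 : zeroLocus ℂ I = ∅ := by
    ext y
    simp only [Set.mem_empty_iff_false, iff_false]
    intro hy
    refine h y fun f hf => ?_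
    rw [← aev]
    exact (mem_zeroLocus_iff.mp hy) f hf
  have h2 := vanishingIdeal_zeroLocus_eq_radical (K := ℂ) I
  rw [h1] at h2
  have h3 : I.radical = ⊤ := by
    rw [← h2, Ideal.eq_top_iff_one]
    intro x hx
    exact absurd hx (by simp)
  exact hI (Ideal.radical_eq_top.mp h3)

theorem zeros_card_le {N : ℕ} {τ : Type} [Fintype τ] (I : Ideal (MvPolynomial (Fin N) ℂ))
    (z : τ → MvPolynomial (Fin N) ℂ) (hsp : ∀ f, ∃ v : τ → ℂ, f - ∑ a, v a • z a ∈ I)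
    (P : Finset (Fin N → ℂ)) (hP : ∀ y ∈ P, y ∈ ZZ I) : P.card ≤ Fintype.card τ := by
  classical
  let φ : (P → ℂ) →ₗ[ℂ] (τ → ℂ) :=
    { toFun := fun c a => ∑ y : P, c y * eval y.1 (z a)
      map_add' := by
        intro c c'; ext a
        simp [add_mul, Finset.sum_add_distrib]
      map_smul' := by
        intro r c; ext a
        simp [Finset.mul_sum, mul_assoc] }
  have hφ : Function.Injective φ := by
    rw [← LinearMap.ker_eq_bot, LinearMap.ker_eq_bot']
    intro c hc
    have hli := linearIndependent_monoidHom (MvPolynomial (Fin N) ℂ) ℂ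
    have hinj : Function.Injective fun y : P => (eval y.1 : MvPolynomial (Fin N) ℂ →* ℂ) := by
      intro y y' h
      apply Subtype.ext
      ext i
      have := DFunLike.congr_fun h (X i)
      simpa using this
    have hli2 := hli.comp _ hinj
    have := Fintype.linearIndependent_iff.mp hli2 c (by
      ext f
      obtain ⟨v, hv⟩ := hsp f
      have h1 : ∀ y : P, eval y.1 f = ∑ a, v a * eval y.1 (z a) := by
        intro y
        have := hP y.1 y.2 _ hv
        rw [map_sub, sub_eq_zero] at this
        rw [this, map_sum]
        simp [smul_eq_C_mul]
      have h2 : ∀ a, ∑ y : P, c y * eval y.1 (z a) = 0 := fun a => congrFun hc a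
      simp only [Finset.sum_apply, Pi.smul_apply, smul_eq_mul, Function.comp, Pi.zero_apply,
        MonoidHom.coe_coe, h1, Finset.mul_sum]
      rw [Finset.sum_comm]
      refine Finset.sum_eq_zero fun a _ => ?_
      rw [← mul_zero (v a), ← h2 a, Finset.mul_sum]
      refine Finset.sum_congr rfl fun y _ => ?_
      ring)
    ext y
    exact this y
  simpa using LinearMap.finrank_le_finrank_of_injective hφ

theorem exists_zero_of_root {N : ℕ} {τ : Type} [Fintype τ] [DecidableEq τ]
    (I : Ideal (MvPolynomial (Fin N) ℂ))
    (z : τ → MvPolynomial (Fin N) ℂ) (hsp : ∀ f, ∃ v : τ → ℂ, f - ∑ a, v a • z a ∈ I)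
    (hind : ∀ v : τ → ℂ, ∑ a, v a • z a ∈ I → v = 0)
    (h : MvPolynomial (Fin N) ℂ) (T : Matrix τ τ ℂ)
    (hT : ∀ a, h * z a - ∑ b, T a b • z b ∈ I) (r : ℂ) (hr : T.charpoly.IsRoot r) :
    ∃ y ∈ ZZ I, eval y h = r := by
  by_contra hcon
  push Not at hcon
  have htop : I ⊔ Ideal.span {h - C r} = ⊤ := by
    by_contra hne
    obtain ⟨y, hy⟩ := exists_zero _ hne
    refine hcon y (fun f hf => hy f (Ideal.mem_sup_left hf)) ?_
    have := hy (h - C r) (Ideal.mem_sup_right (Ideal.mem_span_singleton_self _))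
    rwa [map_sub, eval_C, sub_eq_zero] at this
  have h1 : (1 : MvPolynomial (Fin N) ℂ) ∈ I ⊔ Ideal.span {h - C r} := by rw [htop]; trivial
  obtain ⟨x, hx, y, hy, hxy⟩ := Submodule.mem_sup.mp h1
  obtain ⟨g, rfl⟩ := Ideal.mem_span_singleton'.mp hy
  -- surjectivity of `T - r`
  have hM : ∀ w : τ → ℂ, ∃ v : τ → ℂ, Matrix.vecMul v (T - Matrix.scalar τ r) = w := by
    intro w
    obtain ⟨v, hv⟩ := hsp (g * ∑ a, w a • z a)
    refine ⟨v, ?_⟩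
    rw [← sub_eq_zero]
    apply hind
    set Q : MvPolynomial (Fin N) ℂ := ∑ a, w a • z a with hQ
    have e1 : ∑ b, Matrix.vecMul v (T - Matrix.scalar τ r) b • z b =
        ∑ a, v a • (∑ b, T a b • z b) - r • ∑ a, v a • z a := by
      have : ∀ b, Matrix.vecMul v (T - Matrix.scalar τ r) b = (∑ a, v a * T a b) - r * v b := by
        intro b
        rw [Matrix.vecMul_sub]
        simp [Matrix.vecMul, dotProduct, Matrix.diagonal_apply, mul_comm]
      simp only [this, sub_smul, Finset.sum_sub_distrib, Finset.sum_smul, Finset.smul_sum, mul_smul]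
      rw [Finset.sum_comm]
    have e2 : ∑ b, (Matrix.vecMul v (T - Matrix.scalar τ r) - w) b • z b =
        -(∑ a, C (v a) * (h * z a - ∑ b, T a b • z b)) - (h - C r) * (g * Q - ∑ a, v a • z a)
          - x * Q := by
      simp only [Pi.sub_apply, sub_smul, Finset.sum_sub_distrib]
      rw [e1, ← hQ]
      have e3 : Q = x * Q + (g * (h - C r)) * Q := by rw [← add_mul, hxy, one_mul]
      have e4 : ∑ a, C (v a) * (h * z a - ∑ b, T a b • z b) =
          h * ∑ a, v a • z a - ∑ a, v a • (∑ b, T a b • z b) := by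
        rw [Finset.mul_sum, ← Finset.sum_sub_distrib]
        refine Finset.sum_congr rfl fun a _ => ?_
        rw [smul_eq_C_mul (z a), smul_eq_C_mul (∑ b, T a b • z b)]
        ring
      rw [e4, smul_eq_C_mul _ r]
      linear_combination (-1 : MvPolynomial (Fin N) ℂ) * e3
    rw [e2]
    refine I.sub_mem (I.sub_mem (I.neg_mem (I.sum_mem fun a _ => I.mul_mem_left _ (hT a))) ?_) ?_
    · exact I.mul_mem_left _ hv
    · exact I.mul_mem_right _ hx
  have hU : IsUnit (T - Matrix.scalar τ r) := Matrix.vecMul_surjective_iff_isUnit.mp hM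
  rw [Polynomial.IsRoot, Matrix.eval_charpoly] at hr
  rw [Matrix.isUnit_iff_isUnit_det, isUnit_iff_ne_zero, ← neg_sub, Matrix.det_neg] at hU
  exact hU (by rw [hr, mul_zero])

theorem zeros_card {N : ℕ} {τ : Type} [Fintype τ] [DecidableEq τ]
    (I : Ideal (MvPolynomial (Fin N) ℂ))
    (z : τ → MvPolynomial (Fin N) ℂ) (hsp : ∀ f, ∃ v : τ → ℂ, f - ∑ a, v a • z a ∈ I)
    (hind : ∀ v : τ → ℂ, ∑ a, v a • z a ∈ I → v = 0)
    (h : MvPolynomial (Fin N) ℂ) (T : Matrix τ τ ℂ)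
    (hT : ∀ a, h * z a - ∑ b, T a b • z b ∈ I) (hs : T.charpoly.Separable) :
    (ZZ I).Finite ∧ (ZZ I).ncard = Fintype.card τ := by
  classical
  have hfin : (ZZ I).Finite := by
    by_contra hinf
    obtain ⟨P, hP, hc⟩ := Set.Infinite.exists_subset_card_eq hinf (Fintype.card τ + 1)
    have := zeros_card_le I z hsp P (fun y hy => hP hy)
    omega
  refine ⟨hfin, le_antisymm ?_ ?_⟩
  · rw [Set.ncard_eq_toFinset_card _ hfin]
    exact zeros_card_le I z hsp _ (fun y hy => by simpa using hy)
  · have h1 : Fintype.card (T.charpoly.rootSet ℂ) = Fintype.card τ := by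
      rw [Polynomial.card_rootSet_eq_natDegree hs (IsAlgClosed.splits _),
        Matrix.charpoly_natDegree_eq_dim]
    have hroot : ∀ r : T.charpoly.rootSet ℂ, ∃ y ∈ ZZ I, eval y h = r.1 := by
      intro r
      refine exists_zero_of_root I z hsp hind h T hT r.1 ?_
      have := (Polynomial.mem_rootSet.mp r.2).2
      simpa [Polynomial.IsRoot] using this
    choose y hy1 hy2 using hroot
    rw [← h1, ← Nat.card_eq_fintype_card, ← Nat.card_coe_set_eq]
    have : Finite (ZZ I) := hfin
    refine Nat.card_le_card_of_injective (fun r => (⟨y r, hy1 r⟩ : ZZ I)) ?_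
    intro r r' hrr
    apply Subtype.ext
    rw [← hy2 r, ← hy2 r']
    rw [Subtype.mk.injEq] at hrr
    rw [hrr]

/-- Separability of the characteristic polynomial is an open condition. -/
theorem sep_open {N : ℕ} {τ : Type} [Fintype τ] [DecidableEq τ]
    (T : Matrix τ τ (MvPolynomial (Fin N) ℂ)) :
    ∃ R : MvPolynomial (Fin N) ℂ, ∀ u, eval u R ≠ 0 ↔ (T.map (eval u)).charpoly.Separable := by
  refine ⟨Polynomial.resultant T.charpoly (Polynomial.derivative T.charpoly)
    (Fintype.card τ) (Fintype.card τ - 1), fun u => ?_⟩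
  rw [← Polynomial.resultant_map_map, ← Polynomial.derivative_map, ← Matrix.charpoly_map]
  set p := (T.map (eval u)).charpoly with hp
  have hm : p.Monic := Matrix.charpoly_monic _
  have h1 : p.natDegree = Fintype.card τ := Matrix.charpoly_natDegree_eq_dim _
  have h2 : (Polynomial.derivative p).natDegree = Fintype.card τ - 1 := by
    rw [← h1]
    exact Polynomial.natDegree_derivative p
  rw [← h2, ← h1, Polynomial.Separable, ne_eq, Polynomial.resultant_eq_zero_iff]
  have := hm.ne_zero
  tauto

/-- A matrix with enough distinct eigenvalues has separable characteristic polynomial. -/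
theorem sep_of_eigen {τ κ : Type} [Fintype τ] [DecidableEq τ] [Fintype κ]
    (hcard : Fintype.card τ = Fintype.card κ)
    (T : Matrix τ τ ℂ) (e : κ → ℂ) (he : Function.Injective e)
    (x : κ → τ → ℂ) (hx : ∀ F, x F ≠ 0) (h : ∀ F, T.mulVec (x F) = e F • x F) :
    T.charpoly.Separable := by
  classical
  rw [← Polynomial.card_rootSet_eq_natDegree_iff_of_splits (K := ℂ)
    (Matrix.charpoly_monic T).ne_zero (IsAlgClosed.splits _)]
  refine le_antisymm ?_ ?_
  · rw [Fintype.card_eq_nat_card, Nat.card_coe_set_eq]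
    exact Polynomial.ncard_rootSet_le _ _
  · rw [Matrix.charpoly_natDegree_eq_dim, hcard]
    refine Fintype.card_le_of_injective (fun F => (⟨e F, ?_⟩ : T.charpoly.rootSet ℂ)) ?_
    · rw [Polynomial.mem_rootSet]
      refine ⟨(Matrix.charpoly_monic T).ne_zero, ?_⟩
      rw [Polynomial.coe_aeval_eq_eval, Matrix.eval_charpoly]
      refine Matrix.exists_mulVec_eq_zero_iff.mp ⟨x F, hx F, ?_⟩
      rw [Matrix.sub_mulVec, h F, sub_eq_zero]
      ext a
      simp [Matrix.mulVec_diagonal]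
    · intro F F' hF
      exact he (Subtype.mk.inj hF)

end Part9


/-! ### Part 10: generic separability -/
section Part10
open MvPolynomial

variable {d n : ℕ} {L : Matrix (Fin (d+1)) (Fin (n+1)) ℂ} {Z : Matrix (Fin (n-d)) (Fin (n+1)) ℂ}

theorem map_Jp (u : Fin (n+1) → ℂ) (s : Fin (d+1) → MvPolynomial (Fin (n+1)) ℂ)
    (f : MvPolynomial (Fin (n+1)) (MvPolynomial (Fin (n+1)) ℂ))
    (hf : f ∈ Jp (MvPolynomial (Fin (n+1)) ℂ) L s) :
    map (eval u) f ∈ Jp ℂ L (fun k => eval u (s k)) := by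
  have h : Jp (MvPolynomial (Fin (n+1)) ℂ) L s ≤
      (Jp ℂ L (fun k => eval u (s k))).comap (map (eval u)) := by
    rw [Jp, Ideal.span_le]
    rintro _ ⟨k, rfl⟩
    change map (eval u) _ ∈ Jp ℂ L _
    rw [map_sub, map_lin, map_C]
    exact Ideal.subset_span ⟨k, rfl⟩
  exact h hf

theorem exists_T (hLZ : Submodule.span ℂ (Set.range L) ⊔ Submodule.span ℂ (Set.range Z) = ⊤)
    (A : Type) [CommRing A] [Algebra ℂ A] (J : Ideal (MvPolynomial (Fin (n+1)) A)) (D : A)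
    (hD : ∀ f ∈ homogeneousSubmodule (Fin (n+1)) A (d+1),
      D • f ∈ rowS A L * homogeneousSubmodule (Fin (n+1)) A d ⊔ J.restrictScalars A)
    (s : Fin (d+1) → A) (h : MvPolynomial (Fin (n+1)) A) :
    ∃ (k : ℕ) (T : Matrix (amons (n-d) d) (amons (n-d) d) A), ∀ a,
      D ^ k • (h * mon (fun i => lin A (Z i)) a.1) - ∑ b, T a b • mon (fun i => lin A (Z i)) b.1 ∈
        J ⊔ Jp A L s := by
  have h1 : ∀ f, f ∈ Sat D (zspan A d Z ⊔ (J ⊔ Jp A L s).restrictScalars A) := fun f =>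
    mem_of_homog _ (fun q => (span_all A hLZ d D J hD q).trans (Sat_mono D (SSJ_le s J q))) f
  choose k hk using fun a : amons (n-d) d => h1 (h * mon (fun i => lin A (Z i)) a.1)
  have h2 : ∀ a : amons (n-d) d, D ^ (∑ a, k a) • (h * mon (fun i => lin A (Z i)) a.1) ∈
      zspan A d Z ⊔ (J ⊔ Jp A L s).restrictScalars A := by
    intro a
    have hle : k a ≤ ∑ a, k a := Finset.single_le_sum (f := k) (fun _ _ => Nat.zero_le _) (Finset.mem_univ a)
    rw [← Nat.sub_add_cancel hle, pow_add, mul_smul]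
    exact Submodule.smul_mem _ _ (hk a)
  choose T hT using fun a => exists_coef _ _ (h2 a)
  exact ⟨_, T, hT⟩

theorem exists_sep {κ : Type} [Fintype κ] {N : ℕ} (y : κ → Fin N → ℂ) (hy : Function.Injective y) :
    ∃ v : Fin N → ℂ, Function.Injective fun F => ∑ i, v i * y F i := by
  classical
  have h : ∏ p ∈ (Finset.univ : Finset (κ × κ)).filter (fun p => p.1 ≠ p.2),
      lin ℂ (y p.1 - y p.2) ≠ 0 := by
    rw [Finset.prod_ne_zero_iff]
    intro p hp h0
    apply (Finset.mem_filter.mp hp).2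
    apply hy
    ext i
    have := congrArg (eval (Pi.single i 1)) h0
    rw [eval_lin] at this
    simpa [Pi.single_apply, sub_eq_zero] using this
  obtain ⟨v, hv⟩ : ∃ v, eval v (∏ p ∈ (Finset.univ : Finset (κ × κ)).filter (fun p => p.1 ≠ p.2),
      lin ℂ (y p.1 - y p.2)) ≠ 0 := by
    by_contra hcon
    push Not at hcon
    exact h (MvPolynomial.funext fun v => by rw [hcon v, map_zero])
  refine ⟨v, fun F F' hF => ?_⟩
  by_contra hne
  rw [map_prod, Finset.prod_ne_zero_iff] at hv
  apply hv (F, F') (by simp [hne])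
  rw [eval_lin]
  have : ∑ i, v i * y F i = ∑ i, v i * y F' i := hF
  rw [← sub_eq_zero, ← Finset.sum_sub_distrib] at this
  rw [← this]
  refine Finset.sum_congr rfl fun i _ => ?_
  simp only [Pi.sub_apply]; ring

/-- The special solutions at `u = e_0`. -/
theorem exists_yF (hL : GoodL L) (hdn : d ≤ n) :
    ∃ y : FF n d → Fin (n+1) → ℂ, (∀ F i, i ∉ zS F.1 → y F i = 0) ∧
      (∀ F, L.mulVec (y F) = Pi.single 0 1) ∧ Function.Injective y := by
  classical
  choose y hy1 hy2 using fun (F : FF n d) =>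
    hL.solve (zS F.1) (by rw [card_zS, F.2]) (Pi.single 0 1)
  refine ⟨y, hy1, hy2, ?_⟩
  have hne : ∀ F : FF n d, ∀ i ∈ zS F.1, y F i ≠ 0 := by
    intro F i hi h0
    have hz : y F = 0 := by
      refine hL.ker_smallA hdn (y F) ?_ ((zS F.1).erase i) ?_ ?_
      · intro k
        have := congrFun (hy2 F) k.succ
        simpa [Matrix.mulVec, dotProduct] using this
      · rw [Finset.card_erase_of_mem hi, card_zS, F.2]; simp
      · intro j hj
        by_cases hji : j = i
        · rw [hji, h0]
        · exact hy1 F j fun h => hj (Finset.mem_erase.mpr ⟨hji, h⟩)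
    have := congrFun (hy2 F) 0
    rw [hz] at this
    simp at this
  intro F F' hFF
  apply Subtype.ext
  ext j
  rw [← mem_zS_succ F.1 j, ← mem_zS_succ F'.1 j]
  constructor
  · intro h
    by_contra h'
    exact hne F _ h (by rw [hFF]; exact hy1 F' _ h')
  · intro h
    by_contra h'
    exact hne F' _ h (by rw [← hFF]; exact hy1 F _ h')

theorem FS_vanish (c y : Fin (n+1) → ℂ) (S F : Finset (Fin n)) (hSF : F.card < S.card)
    (hy : ∀ i, i ∉ zS F → y i = 0) : eval y (FS ℂ (Pi.single 0 1) c S) = 0 := by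
  rw [eval_FS]
  refine Finset.sum_eq_zero fun i hi => ?_
  by_cases h0 : i = 0
  · subst h0
    obtain ⟨j, hjS, hjF⟩ := Finset.exists_mem_notMem_of_card_lt_card hSF
    rw [Finset.prod_eq_zero (i := j.succ), mul_zero]
    · exact Finset.mem_erase.mpr ⟨Fin.succ_ne_zero j, (mem_zS_succ S j).mpr hjS⟩
    · exact hy _ (fun h => hjF ((mem_zS_succ F j).mp h))
  · simp [h0]

/-- The right-hand side of the slice. -/
def sA (n d : ℕ) : Fin (d+1) → MvPolynomial (Fin (n+1)) ℂ := Pi.single 0 (∑ i, X i)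

theorem eval_sA (u : Fin (n+1) → ℂ) : (fun k => eval u (sA n d k)) = Pi.single 0 (∑ i, u i) := by
  ext k
  by_cases h : k = 0
  · subst h; simp [sA]
  · simp [sA, h]

theorem exists_gen_T (hL : GoodL L) (hdn : d ≤ n)
    (hLZ : Submodule.span ℂ (Set.range L) ⊔ Submodule.span ℂ (Set.range Z) = ⊤)
    (c : {S : Finset (Fin n) // S.card = d+1} → Fin (n+1) → ℂ) (D : MvPolynomial (Fin (n+1)) ℂ)
    (hD1 : eval (Pi.single 0 1) D = 1)
    (hD : ∀ f ∈ homogeneousSubmodule (Fin (n+1)) (MvPolynomial (Fin (n+1)) ℂ) (d+1),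
        D • f ∈ rowS (MvPolynomial (Fin (n+1)) ℂ) L *
            homogeneousSubmodule (Fin (n+1)) (MvPolynomial (Fin (n+1)) ℂ) d ⊔
          (JJ (MvPolynomial (Fin (n+1)) ℂ) X c).restrictScalars (MvPolynomial (Fin (n+1)) ℂ)) :
    ∃ R : MvPolynomial (Fin (n+1)) ℂ, R ≠ 0 ∧ ∀ u, eval u R ≠ 0 →
      ∃ (h : MvPolynomial (Fin (n+1)) ℂ) (T : Matrix (amons (n-d) d) (amons (n-d) d) ℂ),
        T.charpoly.Separable ∧
        ∀ a, h * mon (fun i => lin ℂ (Z i)) a.1 - ∑ b, T a b • mon (fun i => lin ℂ (Z i)) b.1 ∈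
          JJ ℂ u c ⊔ Jp ℂ L (Pi.single 0 (∑ i, u i)) := by
  classical
  obtain ⟨y, hy1, hy2, hy3⟩ := exists_yF hL hdn
  obtain ⟨v, hv⟩ := exists_sep y hy3
  obtain ⟨k, T, hT⟩ := exists_T hLZ (MvPolynomial (Fin (n+1)) ℂ) _ D hD (sA n d) (lin _ v)
  obtain ⟨R, hR⟩ := sep_open T
  have hspec : ∀ u : Fin (n+1) → ℂ, ∀ a : amons (n-d) d,
      (C (eval u D ^ k) * lin ℂ v) * mon (fun i => lin ℂ (Z i)) a.1
        - ∑ b, T.map (eval u) a b • mon (fun i => lin ℂ (Z i)) b.1 ∈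
          JJ ℂ u c ⊔ Jp ℂ L (Pi.single 0 (∑ i, u i)) := by
    intro u a
    obtain ⟨f, hf, g, hg, hfg⟩ := Submodule.mem_sup.mp (hT a)
    have h1 := congrArg (map (eval u)) hfg
    have h2 : map (eval u) (D ^ k • (lin (MvPolynomial (Fin (n+1)) ℂ) v *
          mon (fun i => lin (MvPolynomial (Fin (n+1)) ℂ) (Z i)) a.1) -
          ∑ b : amons (n-d) d, T a b • mon (fun i => lin (MvPolynomial (Fin (n+1)) ℂ) (Z i)) b.1) =
        (C (eval u D ^ k) * lin ℂ v) * mon (fun i => lin ℂ (Z i)) a.1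
        - ∑ b, T.map (eval u) a b • mon (fun i => lin ℂ (Z i)) b.1 := by
      rw [map_sub, map_sum]
      congr 1
      · rw [smul_eq_C_mul, map_mul, map_mul, map_C, map_lin, map_mon, map_pow, mul_assoc]
        simp only [map_lin]
      · refine Finset.sum_congr rfl fun b _ => ?_
        rw [smul_eq_C_mul, map_mul, map_C, map_mon, smul_eq_C_mul]
        simp only [map_lin]
        rfl
    rw [h2, map_add] at h1
    rw [← h1]
    have h3 := map_Jp u _ g hg
    rw [eval_sA] at h3
    exact Submodule.add_mem_sup (map_JJ u c f hf) h3
  refine ⟨R, ?_, fun u hu => ⟨_, _, (hR u).mp hu, hspec u⟩⟩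
  suffices h : eval (Pi.single 0 1) R ≠ 0 by
    rintro rfl
    exact h (map_zero _)
  rw [hR]
  have hz : ∀ F, ∀ f ∈ JJ ℂ (Pi.single 0 1) c ⊔
      Jp ℂ L (Pi.single 0 (∑ i, (Pi.single 0 1 : Fin (n+1) → ℂ) i)), eval (y F) f = 0 := by
    intro F
    suffices h : JJ ℂ (Pi.single 0 1) c ⊔
      Jp ℂ L (Pi.single 0 (∑ i, (Pi.single 0 1 : Fin (n+1) → ℂ) i)) ≤ RingHom.ker (eval (y F)) from
      fun f hf => h hf
    refine sup_le ?_ ?_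
    · rw [JJ, Ideal.span_le]
      rintro _ ⟨S, rfl⟩
      exact FS_vanish (c S) (y F) S.1 F.1 (by rw [S.2, F.2]; omega) (hy1 F)
    · rw [Jp, Ideal.span_le]
      rintro _ ⟨k, rfl⟩
      change eval (y F) _ = 0
      have := congrFun (hy2 F) k
      rw [map_sub, eval_lin, eval_C, sub_eq_zero]
      rw [show ∑ i, (Pi.single 0 1 : Fin (n+1) → ℂ) i = 1 by simp, ← this]
      rfl
  refine sep_of_eigen (κ := FF n d) ?_ _ (fun F => ∑ i, v i * y F i) hv
    (fun F a => mon (Z.mulVec (y F)) a.1) ?_ ?_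
  · rw [Fintype.card_coe, card_amons hdn]
    simp [FF]
  · intro F h0
    have := congrFun h0 ⟨0, mem_amons.mpr (by simp)⟩
    simp [mon_zero] at this
  · intro F
    ext a
    have := hz F _ (hspec (Pi.single 0 1) a)
    rw [map_sub, sub_eq_zero, map_mul, map_mul, eval_C, hD1, one_pow, one_mul, eval_lin, eval_mon,
      map_sum] at this
    rw [Pi.smul_apply, smul_eq_mul, this]
    simp only [Matrix.mulVec, dotProduct]
    refine Finset.sum_congr rfl fun b _ => ?_
    rw [smul_eq_C_mul, map_mul, eval_C, eval_mon]

end Part10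


/-! ### Part 11: the correspondence between solutions and zeros; the final count -/
section Part11
open MvPolynomial

variable {d n : ℕ} {L : Matrix (Fin (d+1)) (Fin (n+1)) ℂ} {Z : Matrix (Fin (n-d)) (Fin (n+1)) ℂ}

theorem sol_inj (hL : GoodL L) (hdn : d ≤ n) (x x' : Fin d → ℂ)
    (h : ∀ i, ell ℂ L x i = ell ℂ L x' i) : x = x' := by
  obtain ⟨T, -, hT⟩ := Finset.exists_subset_card_eq (s := (Finset.univ : Finset (Fin (n+1))))
    (n := d) (by simp; omega)
  have := hL.kerT' T hT (Fin.cons 0 (x - x')) (by simp) (by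
    intro i _
    have hi := h i
    rw [ell, ell, add_right_inj, ← sub_eq_zero, ← Finset.sum_sub_distrib] at hi
    rw [Matrix.vecMul, dotProduct, Fin.sum_univ_succ]
    simp only [Fin.cons_zero, Fin.cons_succ, zero_mul, zero_add, Pi.sub_apply]
    rw [← hi]
    exact Finset.sum_congr rfl fun k _ => by ring)
  ext k
  have h2 := congrFun this k.succ
  simpa [sub_eq_zero] using h2

theorem sol_zero (u : Fin (n+1) → ℂ) (x : Fin d → ℂ) (hx : IsSol L u x) :
    (fun i => u i / ell ℂ L x i) ∈ ZZ (RingHom.ker (RA L u) ⊔ Jp ℂ L (Pi.single 0 (∑ i, u i))) := by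
  obtain ⟨hx1, hx2⟩ := hx
  suffices h : RingHom.ker (RA L u) ⊔ Jp ℂ L (Pi.single 0 (∑ i, u i)) ≤
      RingHom.ker (eval (fun i => u i / ell ℂ L x i)) from fun f hf => h hf
  refine sup_le ?_ ?_
  · intro f hf
    have hv : (fun i => 1 / ell ℂ L x i) ∈ coneImage L := ⟨1, x, hx1, rfl⟩
    have h1 : RA L u f ⟨_, hv⟩ = 0 := by
      rw [RingHom.mem_ker.mp hf]; rfl
    rw [RA_apply] at h1
    rw [RingHom.mem_ker, ← h1]
    congr 1
    congr 1
    ext i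
    ring
  · rw [Jp, Ideal.span_le]
    rintro _ ⟨k, rfl⟩
    change MvPolynomial.eval (fun i => u i / ell ℂ L x i) _ = 0
    rw [map_sub, eval_lin, eval_C, sub_eq_zero]
    have hk : ∀ k : Fin d, ∑ i, L k.succ i * (u i / ell ℂ L x i) = 0 := by
      intro k
      rw [← hx2 k]
      exact Finset.sum_congr rfl fun i _ => by ring
    refine Fin.cases ?_ (fun k => ?_) k
    · rw [Pi.single_eq_same]
      have h1 : ∀ i, u i = L 0 i * (u i / ell ℂ L x i) +
          ∑ k : Fin d, x k * (L k.succ i * (u i / ell ℂ L x i)) := by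
        intro i
        have e : u i = ell ℂ L x i * (u i / ell ℂ L x i) := by
          rw [mul_div_cancel₀ _ (hx1 i)]
        conv_lhs => rw [e]
        conv_lhs => enter [1]; rw [ell]
        rw [add_mul, Finset.sum_mul]
        congr 1
        exact Finset.sum_congr rfl fun k _ => by ring
      have h2 : ∑ i, u i = ∑ i, (L 0 i * (u i / ell ℂ L x i) +
          ∑ k : Fin d, x k * (L k.succ i * (u i / ell ℂ L x i))) :=
        Finset.sum_congr rfl fun i _ => h1 i
      rw [h2, Finset.sum_add_distrib, Finset.sum_comm (s := Finset.univ) (t := Finset.univ)]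
      simp [← Finset.mul_sum, hk]
    · rw [hk k]
      simp

theorem zero_nonzero (hL : GoodL L) (hdn : d ≤ n) (u : Fin (n+1) → ℂ) (hu : ∀ i, u i ≠ 0)
    (c : {S : Finset (Fin n) // S.card = d+1} → Fin (n+1) → ℂ)
    (hc2 : ∀ S i, c S i ≠ 0 ↔ i ∈ zS S.1) (y : Fin (n+1) → ℂ)
    (hy : ∀ S, eval y (FS ℂ u (c S) S.1) = 0) (hk : ∀ k : Fin d, ∑ i, L k.succ i * y i = 0)
    (hne : y ≠ 0) (i : Fin (n+1)) : y i ≠ 0 := by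
  classical
  intro hi
  have one : ∀ S : {S : Finset (Fin n) // S.card = d+1}, ∀ i ∈ zS S.1, y i = 0 →
      (∀ j ∈ zS S.1, j ≠ i → y j ≠ 0) → False := by
    intro S i hiS h0 hj
    have h := hy S
    rw [eval_FS, Finset.sum_eq_single_of_mem i hiS] at h
    · refine mul_ne_zero (mul_ne_zero ((hc2 S i).mpr hiS) (hu i)) ?_ h
      rw [Finset.prod_ne_zero_iff]
      intro j hj'
      exact hj j (Finset.mem_of_mem_erase hj') (Finset.ne_of_mem_erase hj')
    · intro b _ hb
      rw [Finset.prod_eq_zero (i := i), mul_zero]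
      · exact Finset.mem_erase.mpr ⟨hb.symm, hiS⟩
      · exact h0
  -- support on positive indices
  let Q : Finset (Fin n) := Finset.univ.filter fun j => y j.succ ≠ 0
  have hQ : ∀ j, j ∈ Q ↔ y j.succ ≠ 0 := by intro j; simp [Q]
  by_cases h0 : y 0 = 0
  · by_cases hcard : d + 1 ≤ Q.card
    · obtain ⟨S, hSQ, hS⟩ := Finset.exists_subset_card_eq hcard
      refine one ⟨S, hS⟩ 0 (mem_zS_zero S) h0 ?_
      intro j
      refine Fin.cases (fun _ h => absurd rfl h) (fun j hj _ => ?_) j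
      exact (hQ j).mp (hSQ ((mem_zS_succ S j).mp hj))
    · refine hne (hL.ker_smallA hdn y hk (Q.map (Fin.succEmb n)) (by rw [Finset.card_map]; omega) ?_)
      intro j
      refine Fin.cases (fun _ => h0) (fun j hj => ?_) j
      by_contra h
      exact hj (by simpa using (hQ j).mpr h)
  · by_cases hcard : d ≤ Q.card
    · obtain ⟨F, hFQ, hF⟩ := Finset.exists_subset_card_eq hcard
      obtain ⟨j0, rfl⟩ : ∃ j0 : Fin n, i = j0.succ :=
        Fin.exists_succ_eq.mpr (fun h => h0 (h ▸ hi)) |>.imp fun _ h => h.symm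
      have hj0 : j0 ∉ F := fun h => (hQ j0).mp (hFQ h) hi
      refine one ⟨insert j0 F, by rw [Finset.card_insert_of_notMem hj0, hF]⟩ j0.succ
        ((mem_zS_succ _ _).mpr (Finset.mem_insert_self _ _)) hi ?_
      intro j
      refine Fin.cases (fun _ _ => h0) (fun j hj hjj => ?_) j
      rcases Finset.mem_insert.mp ((mem_zS_succ _ _).mp hj) with h | h
      · exact absurd (by rw [h]) hjj
      · exact (hQ j).mp (hFQ h)
    · refine hne (hL.ker_smallA hdn y hk (zS Q) (by rw [card_zS]; omega) ?_)
      intro j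
      refine Fin.cases (fun h => absurd (mem_zS_zero Q) h) (fun j hj => ?_) j
      by_contra h
      exact hj ((mem_zS_succ _ _).mpr ((hQ j).mpr h))

theorem zero_sol (hL : GoodL L) (hdn : d ≤ n) (u : Fin (n+1) → ℂ) (hu : ∀ i, u i ≠ 0)
    (hus : ∑ i, u i ≠ 0)
    (c : {S : Finset (Fin n) // S.card = d+1} → Fin (n+1) → ℂ)
    (hc1 : ∀ S, L.mulVec (c S) = 0) (hc2 : ∀ S i, c S i ≠ 0 ↔ i ∈ zS S.1) (y : Fin (n+1) → ℂ)
    (hy : y ∈ ZZ (RingHom.ker (RA L u) ⊔ Jp ℂ L (Pi.single 0 (∑ i, u i)))) :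
    ∃ x, IsSol L u x ∧ (fun i => u i / ell ℂ L x i) = y := by
  classical
  have hFS : ∀ S, eval y (FS ℂ u (c S) S.1) = 0 := fun S =>
    hy _ (Ideal.mem_sup_left (JJ_le_ker u c hc1 hc2 (Ideal.subset_span ⟨S, rfl⟩)))
  have hLy : L.mulVec y = Pi.single 0 (∑ i, u i) := by
    ext k
    have h1 : lin ℂ (L k) - C ((Pi.single 0 (∑ i, u i) : Fin (d+1) → ℂ) k) ∈
        Jp ℂ L (Pi.single 0 (∑ i, u i)) := Ideal.subset_span ⟨k, rfl⟩
    have := hy _ (Ideal.mem_sup_right h1)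
    rw [map_sub, eval_lin, eval_C, sub_eq_zero] at this
    exact this
  have hk : ∀ k : Fin d, ∑ i, L k.succ i * y i = 0 := by
    intro k
    have := congrFun hLy k.succ
    simpa [Matrix.mulVec, dotProduct] using this
  have hne : y ≠ 0 := by
    rintro rfl
    have := congrFun hLy 0
    simp only [Matrix.mulVec_zero, Pi.zero_apply, Pi.single_eq_same] at this
    exact hus this.symm
  have hy0 := zero_nonzero hL hdn u hu c hc2 y hFS hk hne
  obtain ⟨F, -, hF⟩ := Finset.exists_subset_card_eq (s := (Finset.univ : Finset (Fin n)))
    (n := d) (by simpa using hdn)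
  obtain ⟨X, hX⟩ := hL.solveT (zS F) (by rw [card_zS, hF]) (fun i => u i / y i)
  have hXall : ∀ i, Matrix.vecMul X L i = u i / y i := by
    intro i
    by_cases hi : i ∈ zS F
    · exact hX i hi
    obtain ⟨j, rfl⟩ : ∃ j : Fin n, i = j.succ :=
      Fin.exists_succ_eq.mpr (fun h : i = 0 => hi (by rw [h]; exact mem_zS_zero F)) |>.imp fun _ h => h.symm
    have hj : j ∉ F := fun h => hi ((mem_zS_succ F j).mpr h)
    set S : {S : Finset (Fin n) // S.card = d+1} :=
      ⟨insert j F, by rw [Finset.card_insert_of_notMem hj, hF]⟩ with hSdef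
    have hjS : j.succ ∈ zS S.1 := (mem_zS_succ _ _).mpr (Finset.mem_insert_self _ _)
    have h1 := hFS S
    rw [eval_FS_recip u (c S) y (fun i => u i / y i) S.1
      (fun i _ => (div_mul_cancel₀ _ (hy0 i)).symm)] at h1
    have h2 : ∑ i ∈ zS S.1, c S i * (u i / y i) = 0 := by
      rcases mul_eq_zero.mp h1 with h | h
      · exact h
      · exact absurd h (Finset.prod_ne_zero_iff.mpr fun i _ => hy0 i)
    have h3 : ∑ i ∈ zS S.1, c S i * Matrix.vecMul X L i = 0 := by
      rw [Finset.sum_subset (Finset.subset_univ _)]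
      · have h4 : dotProduct (Matrix.vecMul X L) (c S) = 0 := by
          rw [← Matrix.dotProduct_mulVec, hc1 S, dotProduct_zero]
        rw [← h4, dotProduct]
        exact Finset.sum_congr rfl fun i _ => mul_comm _ _
      · intro i _ hi'
        have : c S i = 0 := by
          by_contra h
          exact hi' ((hc2 S i).mp h)
        rw [this, zero_mul]
    have h5 : ∑ i ∈ zS S.1, c S i * (Matrix.vecMul X L i - u i / y i) = 0 := by
      simp only [mul_sub, Finset.sum_sub_distrib, h2, h3, sub_zero]
    rw [Finset.sum_eq_single_of_mem j.succ hjS] at h5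
    · rcases mul_eq_zero.mp h5 with h | h
      · exact absurd h ((hc2 S _).mpr hjS)
      · exact sub_eq_zero.mp h
    · intro b hb hbj
      rw [hX b, sub_self, mul_zero]
      revert hb hbj
      refine Fin.cases (fun _ _ => mem_zS_zero F) (fun b hb hbj => ?_) b
      rcases Finset.mem_insert.mp ((mem_zS_succ _ _).mp hb) with h | h
      · exact absurd (by rw [h]) hbj
      · exact (mem_zS_succ _ _).mpr h
  have hX0 : X 0 = 1 := by
    have h1 : dotProduct (Matrix.vecMul X L) y = ∑ i, u i := by
      rw [dotProduct]
      refine Finset.sum_congr rfl fun i _ => ?_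
      rw [hXall i, div_mul_cancel₀ _ (hy0 i)]
    rw [← Matrix.dotProduct_mulVec, hLy, dotProduct_single] at h1
    exact mul_right_cancel₀ hus (h1.trans (one_mul _).symm)
  have hell : ∀ i, ell ℂ L (fun k => X k.succ) i = u i / y i := by
    intro i
    have := vecMul_ell (L := L) X (by rw [hX0]; exact one_ne_zero) i
    rw [hXall i, hX0, one_mul] at this
    simpa using this.symm
  refine ⟨fun k => X k.succ, ⟨fun i => ?_, fun k => ?_⟩, ?_⟩
  · rw [hell i]
    exact div_ne_zero (hu i) (hy0 i)
  · rw [← hk k]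
    refine Finset.sum_congr rfl fun i _ => ?_
    rw [hell i]
    have := hu i
    have := hy0 i
    field_simp
  · ext i
    rw [hell i]
    have := hu i
    have := hy0 i
    field_simp

theorem main_good (hL : GoodL L) (hdn : d ≤ n) :
    IsProjDegree ℂ (vanishingIdeal ℂ (coneImage L)) d (n.choose d) ∧
        Generically (fun u : Fin (n+1) → ℂ =>
          {x : Fin d → ℂ | IsSol L u x}.Finite ∧
          {x : Fin d → ℂ | IsSol L u x}.ncard = n.choose d) := by
  classical
  obtain ⟨Z, hLZ⟩ := hL.exists_Z hdn
  choose c hc1 hc2 using fun S : {S : Finset (Fin n) // S.card = d+1} =>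
    hL.exists_circuit hdn S.1 S.2
  obtain ⟨D, hD1, hD⟩ := exists_D hL hdn hLZ c hc2
  have hD0 : D ≠ 0 := by
    rintro rfl
    simp at hD1
  have hprod : (∏ i : Fin (n+1), (X i : MvPolynomial (Fin (n+1)) ℂ)) ≠ 0 :=
    Finset.prod_ne_zero_iff.mpr fun i _ => X_ne_zero i
  have hsum : (∑ i : Fin (n+1), (X i : MvPolynomial (Fin (n+1)) ℂ)) ≠ 0 := by
    intro h
    have := congrArg (eval (Pi.single 0 1)) h
    simp at this
  have hsp : ∀ u, eval u D ≠ 0 → ∀ q, homogeneousSubmodule (Fin (n+1)) ℂ q ≤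
      SS ℂ L Z d q ⊔ (JJ ℂ u c).restrictScalars ℂ := fun u hu q =>
    span_special hLZ _ (red_special c D hD u hu) q
  constructor
  · obtain ⟨u, hu⟩ : ∃ u, eval u (D * ∏ i, X i) ≠ 0 := by
      by_contra hcon
      push Not at hcon
      exact mul_ne_zero hD0 hprod (MvPolynomial.funext fun v => by rw [hcon v, map_zero])
    rw [map_mul, map_prod] at hu
    have hu1 := left_ne_zero_of_mul hu
    have hu2 : ∀ i, u i ≠ 0 := fun i => by
      have := Finset.prod_ne_zero_iff.mp (right_ne_zero_of_mul hu) i (Finset.mem_univ i)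
      simpa using this
    exact projDegree_of_good hL hdn hLZ u hu2 (JJ ℂ u c) (JJ_le_ker u c hc1 hc2) (hsp u hu1)
  · obtain ⟨R, hR0, hR⟩ := exists_gen_T hL hdn hLZ c D hD1 hD
    refine ⟨((D * ∏ i, X i) * ∑ i, X i) * R,
      mul_ne_zero (mul_ne_zero (mul_ne_zero hD0 hprod) hsum) hR0, fun u hu => ?_⟩
    rw [map_mul, map_mul, map_mul, map_prod] at hu
    have huR := right_ne_zero_of_mul hu
    have hu' := left_ne_zero_of_mul hu
    have hus : ∑ i, u i ≠ 0 := by simpa using right_ne_zero_of_mul hu'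
    have hu'' := left_ne_zero_of_mul hu'
    have hu1 := left_ne_zero_of_mul hu''
    have hu2 : ∀ i, u i ≠ 0 := fun i => by
      have := Finset.prod_ne_zero_iff.mp (right_ne_zero_of_mul hu'') i (Finset.mem_univ i)
      simpa using this
    have hJ := JJ_le_ker (L := L) u c hc1 hc2
    obtain ⟨h, T, hs, hT⟩ := hR u huR
    have hle : JJ ℂ u c ⊔ Jp ℂ L (Pi.single 0 (∑ i, u i)) ≤
        RingHom.ker (RA L u) ⊔ Jp ℂ L (Pi.single 0 (∑ i, u i)) := sup_le_sup_right hJ _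
    obtain ⟨hf, hN⟩ := zeros_card (RingHom.ker (RA L u) ⊔ Jp ℂ L (Pi.single 0 (∑ i, u i)))
      (fun a : amons (n-d) d => mon (fun i => lin ℂ (Z i)) a.1)
      (fun f => by
        obtain ⟨v, hv⟩ := exists_coef (d := d) (Z := Z)
          (JJ ℂ u c ⊔ Jp ℂ L (Pi.single 0 (∑ i, u i))) f
          (mem_of_homog _ (fun q => (hsp u hu1 q).trans (SSJ_le _ _ q)) f)
        exact ⟨v, hle hv⟩)
      (fun v hv => indep_slice hL hdn hLZ u hu2 _ hJ (hsp u hu1) _ v hv)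
      h T (fun a => hle (hT a)) hs
    have himg : (fun x i => u i / ell ℂ L x i) '' {x : Fin d → ℂ | IsSol L u x} =
        ZZ (RingHom.ker (RA L u) ⊔ Jp ℂ L (Pi.single 0 (∑ i, u i))) := by
      ext y
      constructor
      · rintro ⟨x, hx, rfl⟩
        exact sol_zero u x hx
      · intro hy
        obtain ⟨x, hx, hxy⟩ := zero_sol hL hdn u hu2 hus c hc1 hc2 y hy
        exact ⟨x, hx, hxy⟩
    have hinj : Set.InjOn (fun (x : Fin d → ℂ) i => u i / ell ℂ L x i)
        {x : Fin d → ℂ | IsSol L u x} := by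
      intro x hx x' hx' hxx
      refine sol_inj hL hdn x x' fun i => ?_
      have h1 : u i / ell ℂ L x i = u i / ell ℂ L x' i := congrFun hxx i
      rw [div_eq_mul_inv, div_eq_mul_inv] at h1
      exact inv_injective (mul_left_cancel₀ (hu2 i) h1)
    rw [← himg] at hf hN
    refine ⟨Set.Finite.of_finite_image hf hinj, ?_⟩
    rw [hinj.ncard_image] at hN
    rw [hN, Fintype.card_coe, card_amons hdn]

end Part11

/-- Theorem 1.1.  For generic `L` and generic `u`, the number of solutions
of the scattering equations equals `deg ℛ_L = C(n,d)`; i.e. the Proudfoot–Speyer homotopy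
is optimal. -/
theorem generic_arrangement_optimality
    {d n : ℕ} (hdn : d ≤ n) :
    ∃ G : MvPolynomial (Fin (d+1) × Fin (n+1)) ℂ, G ≠ 0 ∧
      ∀ L : Matrix (Fin (d+1)) (Fin (n+1)) ℂ,
        MvPolynomial.eval (fun p : Fin (d+1) × Fin (n+1) => L p.1 p.2) G ≠ 0 →
        IsProjDegree ℂ (vanishingIdeal ℂ (coneImage L)) d (n.choose d) ∧
        Generically (fun u : Fin (n+1) → ℂ =>
          {x : Fin d → ℂ | IsSol L u x}.Finite ∧
          {x : Fin d → ℂ | IsSol L u x}.ncard = n.choose d) := by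
  obtain ⟨G, hG0, hG⟩ := exists_good_poly d n
  exact ⟨G, hG0, fun L hL => main_good (hG L hL) hdn⟩

end ScatteringPaper
end
end

section
/- The reciprocal degree of 𝓜_{0,m} is deg ℛ_{L_m} = (m−3)·(m−3)!, where L_m is the coefficient matrix of the hyperplane arrangement model of 𝓜_{0,m}. -/
open scoped BigOperators
noncomputable section

namespace ScatteringPaper

open CategoryTheory AlgebraicTopology

variable {d : ℕ} {ι : Type} [Fintype ι] [DecidableEq ι]

/-- Column indices of the matrix `L_m`: pairs `0 ≤ a < b ≤ m-2` of labels of the `m-1` finite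
points `z_0 = 0, z_1 = 1, z_{k+1} = x_k (k = 1, …, m-3)` on the line, except the pair `(0,1)`
(whose minor `p_{12}` is constant).  The column `(a,b)` encodes the linear form `z_b − z_a`. -/
def ColIdx (m : ℕ) : Type :=
  {p : Fin (m-1) × Fin (m-1) // p.1 < p.2 ∧ ¬((p.1 : ℕ) = 0 ∧ (p.2 : ℕ) = 1)}

instance (m : ℕ) : Fintype (ColIdx m) := by unfold ColIdx; infer_instance
instance (m : ℕ) : DecidableEq (ColIdx m) := by unfold ColIdx; infer_instance

/-- Coefficient vector of the point `z_t` in the coordinates `(1, x_1, …, x_{m-3})`. -/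
def zCoeff (m : ℕ) (t : Fin (m-1)) : Fin (m-3+1) → ℂ :=
  fun r => if (t : ℕ) = (r : ℕ) + 1 then 1 else 0

/-- The `(m-2) × (m(m-3)/2)` coefficient matrix `L_m` of the hyperplane arrangement model of
`𝓜_{0,m}`: column `(a,b)` is the coefficient vector of `z_b − z_a`. -/
def Lm (m : ℕ) : Matrix (Fin (m-3+1)) (ColIdx m) ℂ :=
  Matrix.of fun r c => zCoeff m c.1.2 r - zCoeff m c.1.1 r

/- ## Helper lemmas -/

/-- Linear independence of partial fractions. -/
lemma pf_indep {W : Type} [DecidableEq W] (S : Finset (W × ℕ)) (C : W × ℕ → ℂ) (p : W → ℂ)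
    (hp : Function.Injective p) (hpos : ∀ s ∈ S, 1 ≤ s.2) (F : Finset ℂ)
    (h : ∀ t ∉ F, ∑ s ∈ S, C s * ((p s.1 - t)⁻¹) ^ s.2 = 0) : ∀ s ∈ S, C s = 0 := by
  classical
  by_contra! hcon
  obtain ⟨s1, hs1, hC1⟩ := hcon
  set T := S.filter (fun s => s.1 = s1.1 ∧ C s ≠ 0) with hT
  have hTne : T.Nonempty := ⟨s1, by simp [hT, hs1, hC1]⟩
  obtain ⟨s0, hs0, hmax⟩ := Finset.exists_max_image T (fun s => s.2) hTne
  have hs0' : s0 ∈ S ∧ s0.1 = s1.1 ∧ C s0 ≠ 0 := by simpa [hT] using hs0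
  obtain ⟨hs0S, hs01, hC0⟩ := hs0'
  apply hC0
  set P := p s0.1 with hP
  let G : ℂ → ℂ := fun t => ∑ s ∈ S, C s *
    (if s.1 = s0.1 then (P - t) ^ (s0.2 - s.2) else ((p s.1 - t)⁻¹) ^ s.2 * (P - t) ^ s0.2)
  have hGcont : ContinuousAt G P := by
    have : ∀ s ∈ S, ContinuousAt (fun t => C s *
      (if s.1 = s0.1 then (P - t) ^ (s0.2 - s.2)
        else ((p s.1 - t)⁻¹) ^ s.2 * (P - t) ^ s0.2)) P := by
      intro s _
      by_cases hs : s.1 = s0.1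
      · simp only [hs, if_true]
        fun_prop
      · simp only [hs, if_false]
        have hne : p s.1 - P ≠ 0 := by
          intro h0
          exact hs (hp (by rw [← hP]; linear_combination h0))
        have : ContinuousAt (fun t => (p s.1 - t)⁻¹) P :=
          ContinuousAt.inv₀ (by fun_prop) hne
        fun_prop
    have h2 := tendsto_finsetSum S (fun s hs => (this s hs))
    exact h2
  have hG0 : ∀ᶠ t in nhdsWithin P {P}ᶜ, G t = 0 := by
    have hF : ∀ᶠ t in nhdsWithin P {P}ᶜ, t ∉ F := by
      have h1 : (↑(F.erase P) : Set ℂ)ᶜ ∈ nhds P := by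
        apply IsOpen.mem_nhds
        · exact (Finset.finite_toSet _).isClosed.isOpen_compl
        · simp
      filter_upwards [nhdsWithin_le_nhds h1, self_mem_nhdsWithin] with t ht ht2 htF
      apply ht
      simp only [Finset.coe_erase, Set.mem_sdiff, Finset.mem_coe]
      exact ⟨htF, ht2⟩
    filter_upwards [hF, self_mem_nhdsWithin] with t ht ht2
    have hne : P - t ≠ 0 := sub_ne_zero.mpr (fun h => ht2 h.symm)
    have : G t = (∑ s ∈ S, C s * ((p s.1 - t)⁻¹) ^ s.2) * (P - t) ^ s0.2 := by
      rw [Finset.sum_mul]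
      apply Finset.sum_congr rfl
      intro s hs
      by_cases hs' : s.1 = s0.1
      · simp only [hs', if_true]
        by_cases hCs : C s = 0
        · simp [hCs]
        · have hle : s.2 ≤ s0.2 := hmax s (by simp [hT, hs, hs', hs01, hCs])
          rw [← hP, mul_assoc]
          congr 1
          rw [inv_pow, pow_sub₀ _ hne hle]
          ring
      · simp only [hs', if_false]
        ring
    rw [this, h t ht, zero_mul]
  have hlim : Filter.Tendsto G (nhdsWithin P {P}ᶜ) (nhds (G P)) :=
    hGcont.tendsto.mono_left nhdsWithin_le_nhds
  have hlim0 : Filter.Tendsto G (nhdsWithin P {P}ᶜ) (nhds 0) :=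
    tendsto_const_nhds.congr' (hG0.mono fun t ht => ht.symm)
  have hGP : G P = 0 := tendsto_nhds_unique hlim hlim0
  have hGP2 : G P = C s0 := by
    show ∑ s ∈ S, _ = _
    rw [Finset.sum_eq_single_of_mem s0 hs0S]
    · simp
    · intro s hs hne
      by_cases hs' : s.1 = s0.1
      · simp only [hs', if_true]
        by_cases hCs : C s = 0
        · simp [hCs]
        · have hle : s.2 ≤ s0.2 := hmax s (by simp [hT, hs, hs', hs01, hCs])
          have : s.2 ≠ s0.2 := fun h2 => hne (Prod.ext hs' h2)
          have : s0.2 - s.2 ≠ 0 := by omega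
          simp [this]
      · have : s0.2 ≠ 0 := by have := hpos s0 hs0S; omega
        simp [hs', this]
  rw [← hGP2, hGP]

/-- The `d+2` points on the line. -/
def Zt {d : ℕ} (x : Fin d → ℂ) : Fin (d + 2) → ℂ := Fin.cons 0 (Fin.cons 1 x)

lemma ell_Lm {d : ℕ} (x : Fin d → ℂ) (c : ColIdx (d + 3)) :
    ell ℂ (Lm (d + 3)) x c = Zt x c.1.2 - Zt x c.1.1 := by
  have key : ∀ t : Fin (d + 2), zCoeff (d + 3) t 0 + ∑ j : Fin d, x j * zCoeff (d + 3) t j.succ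
      = Zt x t := by
    intro t
    refine Fin.cases ?_ (fun t => ?_) t
    · simp [zCoeff, Zt]
    · refine Fin.cases ?_ (fun t => ?_) t
      · simp [zCoeff, Zt]
      · simp [zCoeff, Zt, Fin.val_inj, Finset.sum_ite_eq]
  rw [← key, ← key]
  show (zCoeff (d + 3) c.1.2 0 - zCoeff (d + 3) c.1.1 0) +
    ∑ j : Fin d, x j * (zCoeff (d + 3) c.1.2 j.succ - zCoeff (d + 3) c.1.1 j.succ) = _
  simp only [mul_sub, Finset.sum_sub_distrib]
  ring

/-- The point of the cone attached to a configuration of distinct points. -/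
def ypt {d : ℕ} (z : Fin (d + 2) → ℂ) : ColIdx (d + 3) → ℂ := fun c => (z c.1.2 - z c.1.1)⁻¹

lemma ypt_mem {d : ℕ} (z : Fin (d + 2) → ℂ) (hz : Function.Injective z) :
    ypt z ∈ coneImage (Lm (d + 3)) := by
  have h01 : z 1 - z 0 ≠ 0 := sub_ne_zero.mpr (fun h => by simpa using hz h)
  have hZ : ∀ t, Zt (fun k : Fin d => (z k.succ.succ - z 0) / (z 1 - z 0)) t
      = (z t - z 0) / (z 1 - z 0) := by
    intro t
    refine Fin.cases ?_ (fun t => ?_) t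
    · simp [Zt]
    · refine Fin.cases ?_ (fun t => ?_) t
      · simp only [Zt, Fin.cons_succ, Fin.cons_zero]
        rw [Fin.succ_zero_eq_one, div_self h01]
      · simp [Zt]
  have hell : ∀ c, ell ℂ (Lm (d + 3)) (fun k : Fin d => (z k.succ.succ - z 0) / (z 1 - z 0)) c
      = (z c.1.2 - z c.1.1) / (z 1 - z 0) := by
    intro c
    rw [ell_Lm, hZ, hZ]
    ring
  refine ⟨(z 1 - z 0)⁻¹, fun k => (z k.succ.succ - z 0) / (z 1 - z 0), ?_, ?_⟩
  · intro c
    erw [hell]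
    refine div_ne_zero (sub_ne_zero.mpr fun h => ?_) h01
    exact absurd (hz h) c.2.1.ne'
  · funext c
    have hc : z c.1.2 - z c.1.1 ≠ 0 := sub_ne_zero.mpr fun h => absurd (hz h) c.2.1.ne'
    erw [hell]
    simp only [ypt]
    field_simp

/-- Edges with a given child. -/
abbrev Pa (d : ℕ) (j : Fin (d + 1)) : Type := {c : ColIdx (d + 3) // c.1.1 = j.castSucc}

abbrev GE (d : ℕ) : Type := ((j : Fin (d + 1)) → Pa d j) × (Fin (d + 1) → ℕ)

/-- The standard monomial. -/
def stdMono {d : ℕ} (i : GE d) : MvPolynomial (ColIdx (d + 3)) ℂ :=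
  ∏ j, MvPolynomial.X (i.1 j).1 ^ i.2 j

lemma eval_stdMono {d : ℕ} (i : GE d) (z : Fin (d + 2) → ℂ) :
    MvPolynomial.eval (ypt z) (stdMono i)
      = ∏ j, ((z (i.1 j).1.1.2 - z j.castSucc)⁻¹) ^ i.2 j := by
  simp only [stdMono, map_prod, map_pow, MvPolynomial.eval_X, ypt]
  refine Finset.prod_congr rfl fun j _ => ?_
  rw [(i.1 j).2]

lemma Pa_lt {d : ℕ} {j : Fin (d + 1)} (w : Pa d j) : j.castSucc < w.1.1.2 := by
  have := w.1.2.1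
  rwa [w.2] at this

lemma Pa_ext {d : ℕ} {j : Fin (d + 1)} (w w' : Pa d j) (h : w.1.1.2 = w'.1.1.2) : w = w' := by
  apply Subtype.ext
  apply Subtype.ext
  exact Prod.ext (by rw [w.2, w'.2]) h

lemma indep_step {d : ℕ} (s : Finset (GE d)) (hs : ∀ i ∈ s, ∀ j, 1 ≤ i.2 j) (c : GE d → ℂ)
    (h : ∀ z : Fin (d + 2) → ℂ, Function.Injective z →
      ∑ i ∈ s, c i * ∏ j, ((z (i.1 j).1.1.2 - z j.castSucc)⁻¹) ^ i.2 j = 0) :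
    ∀ k : ℕ, k ≤ d + 1 → ∀ i0 : GE d, ∀ z : Fin (d + 2) → ℂ, Function.Injective z →
      ∑ i ∈ s with (∀ j : Fin (d + 1), j.val < k → i.1 j = i0.1 j ∧ i.2 j = i0.2 j),
        c i * ∏ j with k ≤ j.val, ((z (i.1 j).1.1.2 - z j.castSucc)⁻¹) ^ i.2 j = 0 := by
  intro k
  induction k with
  | zero =>
    intro _ i0 z hz
    simpa using h z hz
  | succ k ih =>
    intro hk i0 z hz
    have ih := ih (by omega) i0
    let kk : Fin (d + 1) := ⟨k, by omega⟩
    set s' := s.filter (fun i => ∀ j : Fin (d + 1), j.val < k → i.1 j = i0.1 j ∧ i.2 j = i0.2 j)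
      with hs'
    let φ : GE d → Pa d kk × ℕ := fun i => (i.1 kk, i.2 kk)
    let R : GE d → ℂ := fun i =>
      c i * ∏ j with k + 1 ≤ j.val, ((z (i.1 j).1.1.2 - z j.castSucc)⁻¹) ^ i.2 j
    let C : Pa d kk × ℕ → ℂ := fun a => ∑ i ∈ s' with φ i = a, R i
    have hfil : s.filter (fun i => ∀ j : Fin (d + 1), j.val < k + 1 →
        i.1 j = i0.1 j ∧ i.2 j = i0.2 j) = s'.filter (fun i => φ i = φ i0) := by
      rw [hs', Finset.filter_filter]
      apply Finset.filter_congr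
      intro i _
      constructor
      · intro H
        refine ⟨fun j hj => H j (by omega), ?_⟩
        have := H kk (by simp [kk])
        exact Prod.ext this.1 this.2
      · rintro ⟨H1, H2⟩ j hj
        rcases Nat.lt_succ_iff_lt_or_eq.mp hj with h1 | h1
        · exact H1 j h1
        · have : j = kk := Fin.ext h1
          subst this
          exact ⟨congrArg Prod.fst H2, congrArg Prod.snd H2⟩
    rw [hfil]
    show C (φ i0) = 0
    by_cases hmem : φ i0 ∈ s'.image φ
    swap
    · apply Finset.sum_eq_zero
      intro i hi
      rw [Finset.mem_filter] at hi
      exact absurd (hi.2 ▸ Finset.mem_image_of_mem φ hi.1) hmem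
    refine pf_indep (s'.image φ) C (fun w => z w.1.1.2) ?_ ?_
      (Finset.univ.image z) ?_ (φ i0) hmem
    · intro w w' hw
      exact Pa_ext _ _ (hz hw)
    · intro a ha
      obtain ⟨i, hi, rfl⟩ := Finset.mem_image.mp ha
      exact hs i (Finset.mem_filter.mp hi).1 kk
    · intro t ht
      have ht' : ∀ v, z v ≠ t := by simpa using ht
      have hz' : Function.Injective (Function.update z kk.castSucc t) := by
        intro a b hab
        by_cases ha : a = kk.castSucc <;> by_cases hb : b = kk.castSucc
        · rw [ha, hb]
        · subst ha
          rw [Function.update_self, Function.update_of_ne hb] at hab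
          exact absurd hab.symm (ht' b)
        · subst hb
          rw [Function.update_self, Function.update_of_ne ha] at hab
          exact absurd hab (ht' a)
        · rw [Function.update_of_ne ha, Function.update_of_ne hb] at hab
          exact hz hab
      have h1 := ih _ hz'
      rw [← h1, ← Finset.sum_fiberwise_of_maps_to (g := φ) (t := s'.image φ)
        (fun i hi => Finset.mem_image_of_mem φ hi)]
      refine Finset.sum_congr rfl fun a _ => ?_
      rw [Finset.sum_mul]
      refine Finset.sum_congr rfl fun i hi => ?_
      rw [Finset.mem_filter] at hi
      have hins : (Finset.univ.filter fun j : Fin (d + 1) => k ≤ j.val)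
          = insert kk (Finset.univ.filter fun j : Fin (d + 1) => k + 1 ≤ j.val) := by
        ext j
        simp only [Finset.mem_filter, Finset.mem_univ, true_and, Finset.mem_insert, Fin.ext_iff, kk]
        omega
      rw [hins, Finset.prod_insert (by simp [kk])]
      have hlt := Pa_lt (i.1 kk)
      rw [Function.update_self, Function.update_of_ne hlt.ne', ← hi.2]
      have hprod : ∀ j ∈ Finset.univ.filter (fun j : Fin (d + 1) => k + 1 ≤ j.val),
          ((Function.update z kk.castSucc t (i.1 j).1.1.2
            - Function.update z kk.castSucc t j.castSucc)⁻¹) ^ i.2 j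
          = ((z (i.1 j).1.1.2 - z j.castSucc)⁻¹) ^ i.2 j := by
        intro j hj
        have hj' : k + 1 ≤ j.val := by simpa using hj
        have hjk : kk.castSucc < j.castSucc := by
          rw [Fin.lt_def]; simp only [Fin.val_castSucc, kk]; omega
        rw [Function.update_of_ne hjk.ne', Function.update_of_ne (hjk.trans (Pa_lt (i.1 j))).ne']
      rw [Finset.prod_congr rfl hprod]
      simp only [R, φ]
      ring

lemma indep_std {d : ℕ} (s : Finset (GE d)) (hs : ∀ i ∈ s, ∀ j, 1 ≤ i.2 j) (c : GE d → ℂ)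
    (h : ∑ i ∈ s, c i • stdMono i ∈ vanishingIdeal ℂ (coneImage (Lm (d + 3)))) :
    ∀ i ∈ s, c i = 0 := by
  have h' : ∀ z : Fin (d + 2) → ℂ, Function.Injective z →
      ∑ i ∈ s, c i * ∏ j, ((z (i.1 j).1.1.2 - z j.castSucc)⁻¹) ^ i.2 j = 0 := by
    intro z hz
    have := h _ (ypt_mem z hz)
    rw [map_sum] at this
    simpa only [MvPolynomial.smul_eval, eval_stdMono] using this
  intro i0 hi0
  have := indep_step s hs c h' (d + 1) le_rfl i0 (fun v => (v.val : ℂ)) (by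
    intro a b hab
    exact Fin.ext (by simpa using hab))
  rw [Finset.sum_eq_single_of_mem i0 (by simp [hi0])] at this
  · rw [Finset.prod_eq_one, mul_one] at this
    · exact this
    · intro j hj
      have := (Finset.mem_filter.mp hj).2
      omega
  · intro i hi hne
    exfalso
    apply hne
    have := (Finset.mem_filter.mp hi).2
    exact Prod.ext (funext fun j => (this j j.2).1) (funext fun j => (this j j.2).2)

/-- The vanishing ideal of the cone. -/
abbrev IL (d : ℕ) : Ideal (MvPolynomial (ColIdx (d + 3)) ℂ) :=
  vanishingIdeal ℂ (coneImage (Lm (d + 3)))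

lemma rel_mem {d : ℕ} (c c' c'' : ColIdx (d + 3)) (h1 : c.1.1 = c'.1.1) (h2 : c''.1.1 = c.1.2)
    (h3 : c''.1.2 = c'.1.2) :
    (MvPolynomial.X c * MvPolynomial.X c' -
      (MvPolynomial.X c'' * MvPolynomial.X c - MvPolynomial.X c'' * MvPolynomial.X c') :
      MvPolynomial (ColIdx (d + 3)) ℂ) ∈ IL d := by
  rintro v ⟨a, x, hx, rfl⟩
  have e1 := hx c
  have e2 := hx c'
  have e3 := hx c''
  simp only [map_sub, map_mul, MvPolynomial.eval_X]
  erw [ell_Lm] at e1 e2 e3 ⊢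
  erw [ell_Lm, ell_Lm]
  rw [h2, h3] at *
  rw [h1] at *
  field_simp
  ring

/-- Span of the standard monomials of degree `q`, modulo the ideal. -/
def stdSpan (d q : ℕ) : Submodule ℂ (MvPolynomial (ColIdx (d + 3)) ℂ) :=
  Submodule.span ℂ {f | ∃ i : GE d, ∑ j, i.2 j = q ∧ f = stdMono i} ⊔ (IL d).restrictScalars ℂ

lemma child_lt {d : ℕ} (c : ColIdx (d + 3)) : c.1.1.val < d + 1 := by
  have h := c.2.1
  have h2 : c.1.2.val < d + 2 := c.1.2.2
  rw [Fin.lt_def] at h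
  omega

lemma std_of {d q : ℕ} (hd : 1 ≤ d) (s : ColIdx (d + 3) →₀ ℕ) (hs : ∑ c, s c = q)
    (h : ∀ c c', s c ≠ 0 → s c' ≠ 0 → c.1.1 = c'.1.1 → c = c') :
    ∃ i : GE d, ∑ j, i.2 j = q ∧ MvPolynomial.monomial s (1 : ℂ) = stdMono i := by
  classical
  have hex : ∀ j : Fin (d + 1), ∃ w : Pa d j, ∀ c, s c ≠ 0 → c.1.1 = j.castSucc → c = w.1 := by
    intro j
    by_cases hj : ∃ c, s c ≠ 0 ∧ c.1.1 = j.castSucc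
    · obtain ⟨c, hc, hcj⟩ := hj
      exact ⟨⟨c, hcj⟩, fun c' h' hj' => h c' c h' hc (hj'.trans hcj.symm)⟩
    · push Not at hj
      refine ⟨⟨⟨(j.castSucc, Fin.last (d + 1)), Fin.castSucc_lt_last j, ?_⟩, rfl⟩, ?_⟩
      · rintro ⟨-, h2⟩
        simp at h2
        omega
      · intro c hc hcj
        exact absurd hcj (hj c hc)
  choose g hg using hex
  have hsum : s = ∑ j, Finsupp.single (g j).1 (s (g j).1) := by
    ext c
    let j0 : Fin (d + 1) := ⟨c.1.1.val, child_lt c⟩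
    have hj0 : c.1.1 = j0.castSucc := Fin.ext rfl
    rw [Finsupp.finsetSum_apply, Finset.sum_eq_single j0]
    · rw [Finsupp.single_apply]
      split_ifs with hc
      · rw [hc]
      · by_contra hne
        exact hc (hg j0 c hne hj0).symm
    · intro j _ hj
      rw [Finsupp.single_apply, if_neg]
      intro hc
      apply hj
      apply Fin.castSucc_injective
      rw [← hj0, ← hc, (g j).2]
    · simp
  refine ⟨(g, fun j => s (g j).1), ?_, ?_⟩
  · rw [← hs]
    conv_rhs => rw [hsum]
    simp only [Finsupp.finsetSum_apply]
    rw [Finset.sum_comm]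
    refine Finset.sum_congr rfl fun j _ => ?_
    simp [Finsupp.single_apply]
  · conv_lhs => rw [hsum]
    rw [MvPolynomial.monomial_sum_one]
    simp only [stdMono, MvPolynomial.X_pow_eq_monomial]

lemma mono_mem {d q : ℕ} (hd : 1 ≤ d) : ∀ (n : ℕ) (s : ColIdx (d + 3) →₀ ℕ),
    ∑ c, s c = q → q * (d + 1) ≤ n + ∑ c, s c * c.1.1.val →
    MvPolynomial.monomial s (1 : ℂ) ∈ stdSpan d q := by
  classical
  intro n
  induction n with
  | zero =>
    intro s hs hw
    have hle : ∀ c, s c * c.1.1.val ≤ s c * d := fun c =>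
      Nat.mul_le_mul_left _ (Nat.lt_succ_iff.mp (child_lt c))
    have h2 : ∑ c, s c * c.1.1.val ≤ q * d := by
      rw [← hs, Finset.sum_mul]
      exact Finset.sum_le_sum fun c _ => hle c
    have hq : q = 0 := by nlinarith
    obtain ⟨i, hi, hi2⟩ := std_of hd s hs (by
      intro c c' hc
      exfalso
      apply hc
      rw [hq] at hs
      exact (Finset.sum_eq_zero_iff.mp hs) c (Finset.mem_univ _))
    exact Submodule.mem_sup_left (Submodule.subset_span ⟨i, hi, hi2⟩)
  | succ n ih =>
    intro s hs hw
    by_cases hstd : ∀ c c', s c ≠ 0 → s c' ≠ 0 → c.1.1 = c'.1.1 → c = c'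
    · obtain ⟨i, hi, hi2⟩ := std_of hd s hs hstd
      exact Submodule.mem_sup_left (Submodule.subset_span ⟨i, hi, hi2⟩)
    have hex : ∃ c c' : ColIdx (d + 3), s c ≠ 0 ∧ s c' ≠ 0 ∧ c.1.1 = c'.1.1 ∧ c.1.2 < c'.1.2 := by
      push Not at hstd
      obtain ⟨c, c', hc, hc', he, hne⟩ := hstd
      rcases lt_trichotomy c.1.2 c'.1.2 with hl | hl | hl
      · exact ⟨c, c', hc, hc', he, hl⟩
      · exact absurd (Subtype.ext (Prod.ext he hl)) hne
      · exact ⟨c', c, hc', hc, he.symm, hl⟩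
    obtain ⟨c, c', hc, hc', he, hl⟩ := hex
    have hcc : c ≠ c' := by
      rintro rfl
      exact lt_irrefl _ hl
    have hclt := c.2.1
    let c'' : ColIdx (d + 3) := ⟨(c.1.2, c'.1.2), hl, by
      rintro ⟨h0, -⟩
      rw [Fin.lt_def] at hclt
      simp only at h0
      omega⟩
    have hle : Finsupp.single c 1 + Finsupp.single c' 1 ≤ s := by
      intro a
      simp only [Finsupp.add_apply, Finsupp.single_apply]
      split_ifs with h1 h2 h2
      · exact absurd (h1.trans h2.symm) hcc
      · subst h1; omega
      · subst h2; omega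
      · omega
    obtain ⟨r, rfl⟩ := exists_add_of_le hle
    have hsd : ∀ a : ColIdx (d + 3), ∑ x, (Finsupp.single a 1 : ColIdx (d + 3) →₀ ℕ) x = 1 := by
      intro a
      simp [Finsupp.single_apply]
    have hsw : ∀ a : ColIdx (d + 3),
        ∑ x, (Finsupp.single a 1 : ColIdx (d + 3) →₀ ℕ) x * x.1.1.val = a.1.1.val := by
      intro a
      simp [Finsupp.single_apply]
    simp only [Finsupp.add_apply, Finset.sum_add_distrib, add_mul, hsd, hsw] at hs hw
    have hclt' : c.1.1.val < c''.1.1.val := hclt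
    have hev : c.1.1.val = c'.1.1.val := congrArg Fin.val he
    have m1 := ih (Finsupp.single c'' 1 + Finsupp.single c 1 + r) (by
      simp only [Finsupp.add_apply, Finset.sum_add_distrib, hsd]; exact hs) (by
      simp only [Finsupp.add_apply, Finset.sum_add_distrib, add_mul, hsw]; omega)
    have m2 := ih (Finsupp.single c'' 1 + Finsupp.single c' 1 + r) (by
      simp only [Finsupp.add_apply, Finset.sum_add_distrib, hsd]; exact hs) (by
      simp only [Finsupp.add_apply, Finset.sum_add_distrib, add_mul, hsw]; omega)
    have hrel := (IL d).mul_mem_left (MvPolynomial.monomial r 1) (rel_mem c c' c'' he rfl rfl)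
    have m3 : _ ∈ stdSpan d q :=
      Submodule.mem_sup_right (T := (IL d).restrictScalars ℂ) hrel
    have mX : ∀ a b : ColIdx (d + 3),
        MvPolynomial.monomial (Finsupp.single a 1 + Finsupp.single b 1 + r) (1 : ℂ)
        = MvPolynomial.monomial r 1 * (MvPolynomial.X a * MvPolynomial.X b) := by
      intro a b
      simp only [MvPolynomial.X, MvPolynomial.monomial_mul, mul_one]
      rw [add_comm _ r]
    rw [mX] at m1 m2 ⊢
    have := Submodule.add_mem _ m3 (Submodule.sub_mem _ m1 m2)
    convert this using 1
    ring

lemma homog_le {d q : ℕ} (hd : 1 ≤ d) :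
    MvPolynomial.homogeneousSubmodule (ColIdx (d + 3)) ℂ q ≤ stdSpan d q := by
  intro f hf
  rw [MvPolynomial.mem_homogeneousSubmodule] at hf
  rw [f.as_sum]
  refine Submodule.sum_mem _ fun s hs => ?_
  have hdeg : ∑ c, s c = q := by
    have := hf (MvPolynomial.mem_support_iff.mp hs)
    rw [← this]
    simp [Finsupp.weight_apply, Finsupp.sum_fintype]
  have := Submodule.smul_mem _ (MvPolynomial.coeff s f)
    (mono_mem hd (q * (d + 1)) s hdeg (Nat.le_add_right _ _))
  rwa [MvPolynomial.smul_monomial, smul_eq_mul, mul_one] at this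

/-- Exponent vectors of degree `q`. -/
def Ex (d q : ℕ) : Finset (Fin (d + 1) → ℕ) := Finset.piAntidiag Finset.univ q

lemma mem_Ex {d q : ℕ} (e : Fin (d + 1) → ℕ) : e ∈ Ex d q ↔ ∑ j, e j = q := by
  simp [Ex, Finset.mem_piAntidiag]

lemma card_Ex (d q : ℕ) : (Ex d q).card = (q + d).choose d := by
  have h := Finset.card_finsuppAntidiag_nat_eq_choose (s := (Finset.univ : Finset (Fin (d + 1)))) q
  have h2 : (Ex d q).card = ((Finset.univ : Finset (Fin (d + 1))).finsuppAntidiag q).card := by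
    rw [Finset.finsuppAntidiag, Finset.card_map, Finset.card_attach, Ex]
  rw [h2, h]
  simp only [Finset.card_univ, Fintype.card_fin]
  rw [show d + 1 + q - 1 = q + d by omega, Nat.choose_symm_add]

/-- The number of choices of parents. -/
abbrev Dg (d : ℕ) : ℕ := Fintype.card ((j : Fin (d + 1)) → Pa d j)

lemma card_Pa (d : ℕ) (j : Fin (d + 1)) :
    Fintype.card (Pa d j) = if j.val = 0 then d else d + 1 - j.val := by
  classical
  let S : Finset (Fin (d + 2)) :=
    Finset.univ.filter (fun b => j.castSucc < b ∧ ¬ (j.val = 0 ∧ b.val = 1))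
  have e : Fintype.card (Pa d j) = S.card := by
    rw [← Finset.card_univ]
    refine Finset.card_bij (fun w _ => w.1.1.2) ?_ ?_ ?_
    · intro w _
      have h2 := w.1.2.2
      rw [w.2] at h2
      simp only [S, Finset.mem_filter, Finset.mem_univ, true_and]
      exact ⟨Pa_lt w, h2⟩
    · intro w _ w' _ h
      exact Pa_ext w w' h
    · intro b hb
      simp only [S, Finset.mem_filter, Finset.mem_univ, true_and] at hb
      exact ⟨⟨⟨(j.castSucc, b), hb⟩, rfl⟩, Finset.mem_univ _, rfl⟩
  rw [e]
  split_ifs with hj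
  · have : S = Finset.Ioi (1 : Fin (d + 2)) := by
      ext b
      simp only [S, Finset.mem_filter, Finset.mem_univ, true_and, Finset.mem_Ioi, Fin.lt_def,
        Fin.val_castSucc, Fin.val_one]
      omega
    rw [this, Fin.card_Ioi]
    simp
  · have : S = Finset.Ioi j.castSucc := by
      ext b
      simp only [S, Finset.mem_filter, Finset.mem_univ, true_and, Finset.mem_Ioi]
      tauto
    rw [this, Fin.card_Ioi]
    simp

lemma Dg_eq (d : ℕ) : Dg d = d * d.factorial := by
  rw [Dg, Fintype.card_pi, Fin.prod_univ_succ]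
  simp only [card_Pa, Fin.val_zero, if_true, Fin.val_succ, Nat.add_eq_zero_iff, one_ne_zero,
    and_false, if_false, Nat.add_sub_add_right]
  congr 1
  rw [Fin.prod_univ_eq_prod_range (fun i => d - i) d, ← Nat.descFactorial_eq_prod_range,
    Nat.descFactorial_self]

lemma gen_upper {V W : Type} [AddCommGroup V] [Module ℂ V] [AddCommGroup W] [Module ℂ W]
    (T : V →ₗ[ℂ] W) (H K : Submodule ℂ V) (F : Finset V)
    (hH : H ≤ Submodule.span ℂ (F : Set V) ⊔ K) (hK : ∀ x ∈ K, T x = 0) :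
    Module.finrank ℂ (H.map T) ≤ F.card ∧ Module.Finite ℂ (H.map T) := by
  classical
  have hle : H.map T ≤ Submodule.span ℂ ((F.image T : Finset W) : Set W) := by
    refine (Submodule.map_mono hH).trans ?_
    rw [Submodule.map_sup]
    refine sup_le ?_ ?_
    · rw [Submodule.map_span, Finset.coe_image]
    · rintro _ ⟨f, hf, rfl⟩
      rw [hK f hf]
      exact zero_mem _
  have hfin : Module.Finite ℂ (Submodule.span ℂ ((F.image T : Finset W) : Set W)) :=
    Module.Finite.span_finset ℂ _
  refine ⟨?_, Submodule.finiteDimensional_of_le hle⟩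
  exact (Submodule.finrank_mono hle).trans
    ((finrank_span_finset_le_card (R := ℂ) (F.image T)).trans Finset.card_image_le)

lemma hilb_upper {d q : ℕ} (hd : 1 ≤ d) :
    hilb ℂ (IL d) q ≤ Dg d * (q + d).choose d ∧
    Module.Finite ℂ ((MvPolynomial.homogeneousSubmodule (ColIdx (d + 3)) ℂ q).map
      (Ideal.Quotient.mkₐ ℂ (IL d)).toLinearMap) := by
  classical
  let F : Finset (MvPolynomial (ColIdx (d + 3)) ℂ) :=
    ((Finset.univ : Finset ((j : Fin (d + 1)) → Pa d j)) ×ˢ Ex d q).image stdMono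
  have hF : F.card ≤ Dg d * (q + d).choose d := by
    refine Finset.card_image_le.trans ?_
    rw [Finset.card_product, card_Ex, Finset.card_univ]
  have hle : MvPolynomial.homogeneousSubmodule (ColIdx (d + 3)) ℂ q
      ≤ Submodule.span ℂ (F : Set (MvPolynomial (ColIdx (d + 3)) ℂ)) ⊔
        (IL d).restrictScalars ℂ := by
    refine (homog_le hd).trans (sup_le_sup_right (Submodule.span_mono ?_) _)
    rintro _ ⟨i, hi, rfl⟩
    rw [Finset.mem_coe, Finset.mem_image]
    exact ⟨i, Finset.mem_product.mpr ⟨Finset.mem_univ _, (mem_Ex _).mpr hi⟩, rfl⟩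
  have hg := gen_upper (Ideal.Quotient.mkₐ ℂ (IL d)).toLinearMap _ _ F hle
    (fun x hx => Ideal.Quotient.eq_zero_iff_mem.mpr hx)
  exact ⟨hg.1.trans hF, hg.2⟩

lemma stdMono_homog {d : ℕ} (i : GE d) :
    stdMono i ∈ MvPolynomial.homogeneousSubmodule (ColIdx (d + 3)) ℂ (∑ j, i.2 j) := by
  rw [MvPolynomial.mem_homogeneousSubmodule]
  apply MvPolynomial.IsHomogeneous.prod
  intro j _
  exact MvPolynomial.isHomogeneous_X_pow _ _

lemma hilb_lower {d q : ℕ} (hd : 1 ≤ d) :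
    Dg d * (q + d).choose d ≤ hilb ℂ (IL d) (q + (d + 1)) := by
  classical
  have hfin := (hilb_upper (q := q + (d + 1)) hd).2
  let J := ((j : Fin (d + 1)) → Pa d j) × Ex d q
  let up : J → GE d := fun i => (i.1, fun j => i.2.1 j + 1)
  have hup : Function.Injective up := by
    intro a b hab
    have h1 : a.1 = b.1 := congrArg (fun i : GE d => i.1) hab
    have h2 : (fun j => a.2.1 j + 1) = (fun j => b.2.1 j + 1) :=
      congrArg (fun i : GE d => i.2) hab
    refine Prod.ext h1 (Subtype.ext (funext fun j => ?_))
    have := congrFun h2 j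
    simpa using this
  let v : J → ((MvPolynomial.homogeneousSubmodule (ColIdx (d + 3)) ℂ (q + (d + 1))).map
      (Ideal.Quotient.mkₐ ℂ (IL d)).toLinearMap) := fun i =>
    ⟨(Ideal.Quotient.mkₐ ℂ (IL d)).toLinearMap (stdMono (up i)), by
      refine Submodule.mem_map_of_mem ?_
      have h := stdMono_homog (up i)
      have h2 : ∑ j, (up i).2 j = q + (d + 1) := by
        simp only [up, Finset.sum_add_distrib]
        rw [(mem_Ex _).mp i.2.2]
        simp
      rwa [h2] at h⟩
  have hv : LinearIndependent ℂ v := by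
    rw [Fintype.linearIndependent_iff]
    intro c hc
    have hc' : (Ideal.Quotient.mkₐ ℂ (IL d)).toLinearMap (∑ i, c i • stdMono (up i)) = 0 := by
      have := congrArg Subtype.val hc
      simpa [v, map_sum] using this
    have hmem : ∑ i, c i • stdMono (up i) ∈ IL d := by
      rw [← Ideal.Quotient.eq_zero_iff_mem]
      exact hc'
    let c2 : GE d → ℂ := Function.extend up c 0
    have hc2 : ∀ i, c2 (up i) = c i := fun i => hup.extend_apply c 0 i
    have hsum : ∑ i ∈ Finset.univ.image up, c2 i • stdMono i = ∑ i, c i • stdMono (up i) := by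
      rw [Finset.sum_image (fun a _ b _ h => hup h)]
      simp only [hc2]
    rw [← hsum] at hmem
    intro i
    rw [← hc2]
    refine indep_std _ ?_ c2 hmem (up i) (Finset.mem_image_of_mem _ (Finset.mem_univ _))
    intro a ha j
    obtain ⟨b, -, rfl⟩ := Finset.mem_image.mp ha
    simp [up]
  have := hv.fintype_card_le_finrank
  rw [Fintype.card_prod, Fintype.card_coe, card_Ex] at this
  exact this

lemma lead_eq {d k D : ℕ} (P : Polynomial ℚ) (h : ℕ → ℕ)
    (hP : ∃ N : ℕ, ∀ q : ℕ, N ≤ q → Polynomial.eval (q : ℚ) P = h q)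
    (hdeg : P.degree = (d : WithBot ℕ)) (hlc : P.leadingCoeff = (k : ℚ) / (Nat.factorial d : ℚ))
    (hup : ∀ q, h q ≤ D * (q + d).choose d) (hlow : ∀ q, D * (q + d).choose d ≤ h (q + (d + 1))) :
    k = D := by
  obtain ⟨N, hN⟩ := hP
  have hf : (0 : ℚ) < (d.factorial : ℚ) := by exact_mod_cast d.factorial_pos
  have hcast : Filter.Tendsto (fun q : ℕ => (q : ℚ)) Filter.atTop Filter.atTop :=
    tendsto_natCast_atTop_atTop
  -- the general limit
  have lim : ∀ Q : Polynomial ℚ, Q.degree = (d : WithBot ℕ) →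
      Filter.Tendsto (fun q : ℕ => Polynomial.eval (q : ℚ) Q / (q : ℚ) ^ d) Filter.atTop
        (nhds Q.leadingCoeff) := by
    intro Q hQ
    have := (Polynomial.div_tendsto_atTop_leadingCoeff_div_of_degree_eq Q (Polynomial.X ^ d)
      (by rw [hQ, Polynomial.degree_X_pow])).comp hcast
    simpa [Function.comp_def] using this
  have lim2 : ∀ (a b : ℚ), a ≠ 0 → Filter.Tendsto
      (fun q : ℕ => a * ((q : ℚ) + b) ^ d / (q : ℚ) ^ d) Filter.atTop (nhds a) := by
    intro a b ha
    have hm : ((Polynomial.X + Polynomial.C b) ^ d : Polynomial ℚ).Monic :=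
      (Polynomial.monic_X_add_C b).pow d
    have := lim (Polynomial.C a * (Polynomial.X + Polynomial.C b) ^ d) (by
      rw [Polynomial.degree_C_mul ha, Polynomial.degree_pow, Polynomial.degree_X_add_C]
      simp)
    rw [Polynomial.leadingCoeff_mul, hm.leadingCoeff, Polynomial.leadingCoeff_C, mul_one] at this
    simpa using this
  have lim3 : ∀ (a b : ℚ), Filter.Tendsto
      (fun q : ℕ => a * ((q : ℚ) + b) ^ d / (q : ℚ) ^ d) Filter.atTop (nhds a) := by
    intro a b
    by_cases ha : a = 0
    · subst ha; simp
    · exact lim2 a b ha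
  have hPl := lim P hdeg
  rw [hlc] at hPl
  have hch : ∀ q : ℕ, (((q + d).choose d : ℕ) : ℚ) = ((q + d).descFactorial d : ℚ) / d.factorial := by
    intro q
    rw [Nat.descFactorial_eq_factorial_mul_choose]
    push_cast
    field_simp
  have U := lim3 ((D : ℚ) / d.factorial) d
  have Lw := lim3 ((D : ℚ) / d.factorial) (-((d : ℚ) + 1) + 1)
  have h1 : (k : ℚ) / d.factorial ≤ D / d.factorial := by
    refine le_of_tendsto_of_tendsto hPl U ?_
    filter_upwards [Filter.eventually_ge_atTop N] with q hq
    rw [hN q hq]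
    gcongr
    calc (h q : ℚ) ≤ ((D * (q + d).choose d : ℕ) : ℚ) := by exact_mod_cast hup q
      _ = (D : ℚ) * ((q + d).descFactorial d : ℚ) / d.factorial := by
          push_cast; rw [hch]; ring
      _ ≤ (D : ℚ) * ((q : ℚ) + d) ^ d / d.factorial := by
          gcongr
          exact_mod_cast Nat.descFactorial_le_pow (q + d) d
      _ = _ := by ring
  have h2 : (D : ℚ) / d.factorial ≤ (k : ℚ) / d.factorial := by
    refine le_of_tendsto_of_tendsto Lw hPl ?_
    filter_upwards [Filter.eventually_ge_atTop (N + (d + 1))] with q hq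
    rw [hN q (by omega)]
    obtain ⟨r, rfl⟩ := Nat.exists_eq_add_of_le (show d + 1 ≤ q by omega)
    gcongr
    rw [show d + 1 + r = r + (d + 1) by ring]
    rw [← ge_iff_le]
    calc (h (r + (d + 1)) : ℚ) ≥ ((D * (r + d).choose d : ℕ) : ℚ) := by exact_mod_cast hlow r
      _ = (D : ℚ) * ((r + d).descFactorial d : ℚ) / d.factorial := by
          push_cast; rw [hch]; ring
      _ ≥ (D : ℚ) * ((r : ℚ) + 1) ^ d / d.factorial := by
          have := Nat.pow_sub_le_descFactorial (r + d) d
          rw [show r + d + 1 - d = r + 1 by omega] at this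
          have h' : ((r : ℚ) + 1) ^ d ≤ ((r + d).descFactorial d : ℚ) := by exact_mod_cast this
          gcongr
      _ = _ := by push_cast; ring
  have h3 := le_antisymm h1 h2
  field_simp at h3
  exact_mod_cast h3

/-- Proposition 5.1.  The reciprocal degree of `𝓜_{0,m}` is
`deg ℛ_{L_m} = (m-3)·(m-3)!`. -/
theorem reciprocal_degree_M0m (m : ℕ) (hm : 4 ≤ m) :
    ∀ k : ℕ, IsProjDegree ℂ (vanishingIdeal ℂ (coneImage (Lm m))) (m-3) k →
      k = (m-3) * Nat.factorial (m-3) := by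
  intro k hk
  obtain ⟨d, rfl⟩ := Nat.exists_eq_add_of_le' (show 3 ≤ m by omega)
  have hd : 1 ≤ d := by omega
  obtain ⟨P, hP, hdeg, hlc⟩ := hk
  show k = d * d.factorial
  rw [← Dg_eq]
  exact lead_eq P (hilb ℂ (IL d)) hP hdeg hlc (fun q => (hilb_upper hd).1) (fun q => hilb_lower hd)

end ScatteringPaper
end
end
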